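/- Let ω be a radial weight in the class D̂ and let 1<q<∞ with q'=q/(q−1). Then (A^{1,q}_ω)* ≃ BMOA(q',ω) under the A²_ω-pairing with equivalence of norms: there exist constants C₁,C₂>0 (depending only on q,ω) such that (a) for every g∈BMOA(q',ω) and every f∈A^{1,q}_ω the limit defining ⟨f,g⟩_{A²_ω} exists and L_g(f)=⟨f,g⟩_{A²_ω} defines a bounded linear functional on A^{1,q}_ω with ‖L_g‖ ≤ C₂‖g‖_{BMOA(q',ω)}, and (b) every bounded linear functional L on A^{1,q}_ω equals L_g for some g∈BMOA(q',ω) with ‖g‖_{BMOA(q',ω)} ≤ C₁‖L‖. -/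

import Mathlib

open MeasureTheory Filter Set
open scoped ENNReal

noncomputable section

/-- `ω̂(r) = ∫_r^1 ω(s) ds`. -/
def omegaHat (ω : ℝ → ℝ) (r : ℝ) : ℝ := ∫ s in r..1, ω s

/-- A radial weight: nonnegative and Lebesgue integrable on `[0,1)`. -/
def IsRadialWeight (ω : ℝ → ℝ) : Prop :=
  (∀ r ∈ Set.Ico (0:ℝ) 1, 0 ≤ ω r) ∧ MeasureTheory.IntegrableOn ω (Set.Ico 0 1)

/-- The class `D̂` of upper doubling radial weights. -/
def InDhat (ω : ℝ → ℝ) : Prop :=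
  ∃ C > (0:ℝ), ∀ r ∈ Set.Ico (0:ℝ) 1, omegaHat ω r ≤ C * omegaHat ω ((1 + r) / 2)

/-- The class `Ď`. -/
def InDcheck (ω : ℝ → ℝ) : Prop :=
  ∃ K > (1:ℝ), ∃ C > (1:ℝ), ∀ r ∈ Set.Ico (0:ℝ) 1,
    C * omegaHat ω (1 - (1 - r) / K) ≤ omegaHat ω r

/-- Moments `μ_x = ∫_0^1 r^x μ(r) dr`. -/
def momentW (μ : ℝ → ℝ) (x : ℝ) : ℝ := ∫ r in (0:ℝ)..1, r ^ x * μ r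

/-- The coefficients `μ_{2k+1}` of the `A²_μ` pairing. -/
def momentCoeff (μ : ℝ → ℝ) : ℕ → ℝ := fun k => momentW μ (2 * (k:ℝ) + 1)

/-- The point `r e^{iθ}` of the circle of radius `r`. -/
def circlePt (r θ : ℝ) : ℂ := (r:ℂ) * Complex.exp ((θ:ℂ) * Complex.I)

/-- Integral means `M_p(r,f)` (with values in `[0,∞]`). -/
def MpE (p r : ℝ) (f : ℂ → ℂ) : ℝ≥0∞ :=
  (ENNReal.ofReal (1 / (2 * Real.pi)) *
    ∫⁻ θ in Set.Ioo (0:ℝ) (2 * Real.pi), ENNReal.ofReal (‖f (circlePt r θ)‖ ^ p)) ^ (1 / p)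

/-- Integral means of a `[0,∞]`-valued function. -/
def MpEE (p r : ℝ) (F : ℂ → ℝ≥0∞) : ℝ≥0∞ :=
  (ENNReal.ofReal (1 / (2 * Real.pi)) *
    ∫⁻ θ in Set.Ioo (0:ℝ) (2 * Real.pi), (F (circlePt r θ)) ^ p) ^ (1 / p)

/-- The norm of the mixed norm space `L^{p,q}_ω`. -/
def LpqNormE (ω : ℝ → ℝ) (p q : ℝ) (f : ℂ → ℂ) : ℝ≥0∞ :=
  (∫⁻ r in Set.Ioo (0:ℝ) 1, (MpE p r f) ^ q * ENNReal.ofReal (r * ω r)) ^ (1 / q)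

/-- The `L^{p,q}_ω` norm of a `[0,∞]`-valued function. -/
def LpqNormEE (ω : ℝ → ℝ) (p q : ℝ) (F : ℂ → ℝ≥0∞) : ℝ≥0∞ :=
  (∫⁻ r in Set.Ioo (0:ℝ) 1, (MpEE p r F) ^ q * ENNReal.ofReal (r * ω r)) ^ (1 / q)

/-- The norm of `A^{p,∞}_ω` : `sup_{0 ≤ r < 1} M_p(r,f) ω̂(r)`. -/
def ApInfNormE (ω : ℝ → ℝ) (p : ℝ) (f : ℂ → ℂ) : ℝ≥0∞ :=
  ⨆ r ∈ Set.Ico (0:ℝ) 1, MpE p r f * ENNReal.ofReal (omegaHat ω r)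

/-- Membership in the mixed norm space `A^{p,q}_ω`. -/
def InApq (ω : ℝ → ℝ) (p q : ℝ) (f : ℂ → ℂ) : Prop :=
  DifferentiableOn ℂ f (Metric.ball 0 1) ∧ LpqNormE ω p q f < ⊤

/-- Membership in `A^{p,∞}_ω`. -/
def InApInf (ω : ℝ → ℝ) (p : ℝ) (f : ℂ → ℂ) : Prop :=
  DifferentiableOn ℂ f (Metric.ball 0 1) ∧ ApInfNormE ω p f < ⊤

/-- Taylor coefficient of `f` at `0`. -/
def taylorCoeff (f : ℂ → ℂ) (n : ℕ) : ℂ := iteratedDeriv n f 0 / (n.factorial : ℂ)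

/-- The pairing `⟨f,g⟩ = lim_{r→1⁻} ∑_k f̂(k) conj(ĝ(k)) c(k) r^k` exists and equals `l`. -/
def HasPairingC (c : ℕ → ℝ) (f g : ℂ → ℂ) (l : ℂ) : Prop :=
  (∀ r ∈ Set.Ico (0:ℝ) 1, Summable (fun k : ℕ =>
    taylorCoeff f k * (starRingEnd ℂ) (taylorCoeff g k) * ((c k : ℝ) : ℂ) * ((r:ℂ)) ^ k)) ∧
  Filter.Tendsto (fun r : ℝ => ∑' k : ℕ,
    taylorCoeff f k * (starRingEnd ℂ) (taylorCoeff g k) * ((c k : ℝ) : ℂ) * ((r:ℂ)) ^ k)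
    (nhdsWithin 1 (Set.Iio 1)) (nhds l)

/-- `L` is linear on the functions satisfying `P`. -/
def IsLinearOn (P : (ℂ → ℂ) → Prop) (L : (ℂ → ℂ) → ℂ) : Prop :=
  (∀ f g : ℂ → ℂ, P f → P g → L (f + g) = L f + L g) ∧
  (∀ (c : ℂ) (f : ℂ → ℂ), P f → L (c • f) = c * L f)

/-- Dilation `f_r(z) = f(rz)`. -/
def dilateF (f : ℂ → ℂ) (r : ℝ) : ℂ → ℂ := fun z => f ((r:ℂ) * z)

/-- The BMOA norm `|f(0)| + sup_{a∈D} sup_{0<r<1} M₂(r, f∘φ_a - f(a))`. -/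
def BMOANormE (f : ℂ → ℂ) : ℝ≥0∞ :=
  ENNReal.ofReal ‖f 0‖ +
    ⨆ a ∈ Metric.ball (0:ℂ) 1, ⨆ r ∈ Set.Ioo (0:ℝ) 1,
      MpE 2 r (fun z => f ((a - z) / (1 - (starRingEnd ℂ) a * z)) - f a)

/-- The Bloch norm `|f(0)| + sup_{z∈D} (1-|z|²)|f'(z)|`. -/
def BlochNormE (f : ℂ → ℂ) : ℝ≥0∞ :=
  ENNReal.ofReal ‖f 0‖ +
    ⨆ z ∈ Metric.ball (0:ℂ) 1, ENNReal.ofReal ((1 - ‖z‖ ^ 2) * ‖deriv f z‖)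

/-- The norm of `X(q,ω)`: `(∫_0^1 ‖f_r‖_X^q ω(r) dr)^{1/q}`. -/
def XqNormE (Xnorm : (ℂ → ℂ) → ℝ≥0∞) (ω : ℝ → ℝ) (q : ℝ) (f : ℂ → ℂ) : ℝ≥0∞ :=
  (∫⁻ r in Set.Ioo (0:ℝ) 1, (Xnorm (dilateF f r)) ^ q * ENNReal.ofReal (ω r)) ^ (1 / q)

/-- The norm of `X(∞,ω)`: `sup_{0<r<1} ‖f_r‖_X ω̂(r)`. -/
def XInfNormE (Xnorm : (ℂ → ℂ) → ℝ≥0∞) (ω : ℝ → ℝ) (f : ℂ → ℂ) : ℝ≥0∞ :=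
  ⨆ r ∈ Set.Ioo (0:ℝ) 1, Xnorm (dilateF f r) * ENNReal.ofReal (omegaHat ω r)

/-- The standard radial weight `ν_β(r) = (β+1)(1-r²)^β`. -/
def nuWeight (β : ℝ) : ℝ → ℝ := fun r => (β + 1) * (1 - r ^ 2) ^ β

/-- The Bergman reproducing kernel `B^ω_a(z) = ∑ (z conj a)^n / (2 ω_{2n+1})`. -/
def bergmanKernel (ω : ℝ → ℝ) (a z : ℂ) : ℂ :=
  ∑' n : ℕ, (z * (starRingEnd ℂ) a) ^ n / (2 * ((momentW ω (2 * (n:ℝ) + 1) : ℝ) : ℂ))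

/-- The Bergman projection (`dA` is normalized area measure). -/
def PomegaProj (ω : ℝ → ℝ) (f : ℂ → ℂ) (z : ℂ) : ℂ :=
  (Real.pi)⁻¹ • ∫ ζ in Metric.ball (0:ℂ) 1,
    f ζ * (starRingEnd ℂ) (bergmanKernel ω z ζ) * ((ω ‖ζ‖ : ℝ) : ℂ)

/-- The maximal Bergman projection applied to `|f|`, with values in `[0,∞]`. -/
def PomegaPlusL (ω : ℝ → ℝ) (f : ℂ → ℂ) (z : ℂ) : ℝ≥0∞ :=
  ∫⁻ ζ in Metric.ball (0:ℂ) 1,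
    ENNReal.ofReal (‖f ζ‖ * ‖bergmanKernel ω z ζ‖ * ω ‖ζ‖ / Real.pi)

/-- The Hardy `H¹` norm. -/
def H1NormE (f : ℂ → ℂ) : ℝ≥0∞ := ⨆ r ∈ Set.Ioo (0:ℝ) 1, MpE 1 r f

/-- `r_n = inf{ r ∈ [0,1) : ω̂(r) = ω̂(0) K^{-n} }`. -/
def rSeq (ω : ℝ → ℝ) (K : ℝ) (n : ℕ) : ℝ :=
  sInf {r | r ∈ Set.Ico (0:ℝ) 1 ∧ omegaHat ω r = omegaHat ω 0 * K ^ (-(n:ℝ))}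

/-- `M_n = ⌊1/(1-r_n)⌋`. -/
def MSeq (ω : ℝ → ℝ) (K : ℝ) (n : ℕ) : ℕ := ⌊1 / (1 - rSeq ω K n)⌋₊

/-- Weighted Hadamard product of a polynomial with an analytic function:
`z ↦ ∑_j c(j) P̂(j) ĝ(j) z^j`. -/
def hadamardPolyC (c : ℕ → ℂ) (P : Polynomial ℂ) (g : ℂ → ℂ) : ℂ → ℂ :=
  fun z => ∑ j ∈ Finset.range (P.natDegree + 1), c j * P.coeff j * taylorCoeff g j * z ^ j

/-- An admissible Banach space of analytic functions on the unit disc, given by a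
carrier set and a norm function. -/
structure AdmissibleSpace where
  carrier : Set (ℂ → ℂ)
  nrm : (ℂ → ℂ) → ℝ
  mem_analytic : ∀ f ∈ carrier, DifferentiableOn ℂ f (Metric.ball 0 1)
  zero_mem : (0 : ℂ → ℂ) ∈ carrier
  add_mem : ∀ f g : ℂ → ℂ, f ∈ carrier → g ∈ carrier → f + g ∈ carrier
  smul_mem : ∀ (c : ℂ) (f : ℂ → ℂ), f ∈ carrier → c • f ∈ carrier
  nrm_nonneg : ∀ f ∈ carrier, 0 ≤ nrm f
  nrm_eq_zero : ∀ f ∈ carrier, nrm f = 0 → ∀ z ∈ Metric.ball (0:ℂ) 1, f z = 0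
  nrm_add : ∀ f g : ℂ → ℂ, f ∈ carrier → g ∈ carrier → nrm (f + g) ≤ nrm f + nrm g
  nrm_smul : ∀ (c : ℂ) (f : ℂ → ℂ), f ∈ carrier → nrm (c • f) = ‖c‖ * nrm f
  complete : ∀ u : ℕ → (ℂ → ℂ), (∀ n, u n ∈ carrier) →
    (∀ ε : ℝ, 0 < ε → ∃ N : ℕ, ∀ m ≥ N, ∀ n ≥ N, nrm (u m - u n) < ε) →
    ∃ f ∈ carrier, Filter.Tendsto (fun n => nrm (u n - f)) Filter.atTop (nhds 0)
  norm_conv_implies_ucc : ∀ (u : ℕ → (ℂ → ℂ)) (f : ℂ → ℂ),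
    (∀ n, u n ∈ carrier) → f ∈ carrier →
    Filter.Tendsto (fun n => nrm (u n - f)) Filter.atTop (nhds 0) →
    ∀ Kc : Set ℂ, Kc ⊆ Metric.ball 0 1 → IsCompact Kc →
      TendstoUniformlyOn (fun n => u n) f Filter.atTop Kc
  ucc_implies_norm_conv : ∀ R : ℝ, 1 < R → ∀ (u : ℕ → (ℂ → ℂ)) (f : ℂ → ℂ),
    (∀ n, u n ∈ carrier ∧ DifferentiableOn ℂ (u n) (Metric.ball 0 R)) →
    DifferentiableOn ℂ f (Metric.ball 0 R) →
    (∀ Kc : Set ℂ, Kc ⊆ Metric.ball (0:ℂ) R → IsCompact Kc →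
      TendstoUniformlyOn (fun n => u n) f Filter.atTop Kc) →
    f ∈ carrier ∧ Filter.Tendsto (fun n => nrm (u n - f)) Filter.atTop (nhds 0)
  dilation_bound : ∃ C > (0:ℝ), ∀ f ∈ carrier, ∀ ζ : ℂ, ‖ζ‖ ≤ 1 →
    (fun z => f (ζ * z)) ∈ carrier ∧ nrm (fun z => f (ζ * z)) ≤ C * nrm f

/-- The operator `T_p = I^{ν_{1/p-2}}`. -/
def TpOp (p : ℝ) (g : ℂ → ℂ) : ℂ → ℂ :=
  fun z => ∑' k : ℕ,
    taylorCoeff g k * ((momentW (nuWeight (1 / p - 2)) (2 * (k:ℝ) + 1) : ℝ) : ℂ) * z ^ k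

/-- Membership in the Bloch space. -/
def InBloch (g : ℂ → ℂ) : Prop :=
  DifferentiableOn ℂ g (Metric.ball 0 1) ∧ BlochNormE g < ⊤

open Classical in
/-- The norm of the space `X_p = T_p(B)`, normed so that `T_p` is an isometry. -/
def XpNormE (p : ℝ) (h : ℂ → ℂ) : ℝ≥0∞ :=
  if H : ∃ g : ℂ → ℂ, InBloch g ∧ Set.EqOn h (TpOp p g) (Metric.ball 0 1)
  then BlochNormE H.choose else ⊤

/-- The polynomial `V_n ∗ g` where `V_n(z) = ∑_{j=2^{n-1}}^{2^{n+1}-1} ψ(j/2^{n-1}) z^j`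
and `ψ(t) = Ψ(t/2) - Ψ(t)`. -/
def VnStar (Ψ : ℝ → ℝ) (n : ℕ) (g : ℂ → ℂ) : ℂ → ℂ :=
  fun z => ∑ j ∈ Finset.Icc (2 ^ (n - 1) : ℕ) (2 ^ (n + 1) - 1 : ℕ),
    (((Ψ ((j:ℝ) / 2 ^ n) - Ψ ((j:ℝ) / 2 ^ (n - 1))) : ℝ) : ℂ) * taylorCoeff g j * z ^ j

/-- `D^ω(V_n ∗ g)`, where `D^ω h(z) = ∑ ĥ(k) z^k/(2ω_{2k+1})`. -/
def DVnStar (Ψ : ℝ → ℝ) (ω : ℝ → ℝ) (n : ℕ) (g : ℂ → ℂ) : ℂ → ℂ :=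
  fun z => ∑ j ∈ Finset.Icc (2 ^ (n - 1) : ℕ) (2 ^ (n + 1) - 1 : ℕ),
    (((Ψ ((j:ℝ) / 2 ^ n) - Ψ ((j:ℝ) / 2 ^ (n - 1))) : ℝ) : ℂ) * taylorCoeff g j * z ^ j /
      (2 * ((momentW ω (2 * (j:ℝ) + 1) : ℝ) : ℂ))

/-- `J_ω(t) = ∫_0^t ds/(ω̂(s)(1-s))`. -/
def Jomega (ω : ℝ → ℝ) (t : ℝ) : ℝ := ∫ s in (0:ℝ)..t, 1 / (omegaHat ω s * (1 - s))

/-- Differentiation under the integral sign for jointly continuous integrands. -/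
lemma hasDerivAt_intervalIntegral_of_continuous {F F' : ℝ → ℝ → ℝ} (a b : ℝ)
    (hF : Continuous (Function.uncurry F)) (hF' : Continuous (Function.uncurry F'))
    (hd : ∀ x t, HasDerivAt (fun x => F x t) (F' x t) x) (x : ℝ) :
    HasDerivAt (fun x => ∫ t in a..b, F x t) (∫ t in a..b, F' x t) x := by
  obtain ⟨C, hC⟩ := ((isCompact_closedBall x 1).prod (isCompact_uIcc (a := a) (b := b))).exists_bound_of_continuousOn
    hF'.continuousOn
  have hFx : ∀ x, Continuous (F x) := fun x => hF.comp (Continuous.prodMk_right x)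
  have hFx' : ∀ x, Continuous (F' x) := fun x => hF'.comp (Continuous.prodMk_right x)
  refine (intervalIntegral.hasDerivAt_integral_of_dominated_loc_of_deriv_le (F' := F')
    (bound := fun _ => C) (Metric.closedBall_mem_nhds x one_pos)
    (Eventually.of_forall fun y => (hFx y).aestronglyMeasurable)
    ((hFx x).intervalIntegrable _ _) (hFx' x).aestronglyMeasurable
    (Eventually.of_forall fun t ht y hy => ?_) (by simp)
    (Eventually.of_forall fun t _ y _ => hd y t)).2
  exact hC (y, t) ⟨hy, uIoc_subset_uIcc ht⟩

/-- A function on a half-strip that is periodic in the second variable and subharmonic has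
nondecreasing means. -/
lemma monotoneOn_integral_of_laplacian_nonneg {Ψ Ψx Ψxx Ψy Ψyy : ℝ → ℝ → ℝ} {C T : ℝ}
    (h0 : Continuous (Function.uncurry Ψ)) (h1 : Continuous (Function.uncurry Ψx))
    (h2 : Continuous (Function.uncurry Ψxx)) (h3 : Continuous (Function.uncurry Ψyy))
    (dx : ∀ x t, HasDerivAt (fun x => Ψ x t) (Ψx x t) x)
    (dxx : ∀ x t, HasDerivAt (fun x => Ψx x t) (Ψxx x t) x)
    (dyy : ∀ x t, HasDerivAt (Ψy x) (Ψyy x t) t)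
    (per : ∀ x, Ψy x T = Ψy x 0) (hT : 0 ≤ T)
    (hC : ∀ x ≤ 0, ∀ t, Ψ x t ≤ C)
    (lap : ∀ x ≤ 0, ∀ t, 0 ≤ Ψxx x t + Ψyy x t) :
    MonotoneOn (fun x => ∫ t in (0:ℝ)..T, Ψ x t) (Iic 0) := by
  set m := fun x => ∫ t in (0:ℝ)..T, Ψ x t
  set m1 := fun x => ∫ t in (0:ℝ)..T, Ψx x t
  have hm : ∀ x, HasDerivAt m (m1 x) x := hasDerivAt_intervalIntegral_of_continuous 0 T h0 h1 dx
  have hm1 : ∀ x, HasDerivAt m1 (∫ t in (0:ℝ)..T, Ψxx x t) x :=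
    hasDerivAt_intervalIntegral_of_continuous 0 T h1 h2 dxx
  have cxx : ∀ x, Continuous (Ψxx x) := fun x => h2.comp (Continuous.prodMk_right x)
  have cyy : ∀ x, Continuous (Ψyy x) := fun x => h3.comp (Continuous.prodMk_right x)
  have c0 : ∀ x, Continuous (Ψ x) := fun x => h0.comp (Continuous.prodMk_right x)
  have hy : ∀ x, ∫ t in (0:ℝ)..T, Ψyy x t = 0 := fun x => by
    rw [intervalIntegral.integral_eq_sub_of_hasDerivAt (fun t _ => dyy x t)
      ((cyy x).intervalIntegrable _ _), per, sub_self]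
  have hnn : ∀ x ≤ 0, 0 ≤ ∫ t in (0:ℝ)..T, Ψxx x t := fun x hx => by
    have : ∫ t in (0:ℝ)..T, Ψxx x t = ∫ t in (0:ℝ)..T, (Ψxx x t + Ψyy x t) := by
      rw [intervalIntegral.integral_add ((cxx x).intervalIntegrable _ _)
        ((cyy x).intervalIntegrable _ _), hy, add_zero]
    rw [this]
    exact intervalIntegral.integral_nonneg hT fun t _ => lap x hx t
  have mono1 : MonotoneOn m1 (Iic 0) := by
    refine monotoneOn_of_deriv_nonneg (convex_Iic 0)
      (fun x _ => (hm1 x).continuousAt.continuousWithinAt)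
      (fun x _ => (hm1 x).differentiableAt.differentiableWithinAt) fun x hx => ?_
    rw [(hm1 x).deriv]
    exact hnn x (mem_Iic.1 (interior_subset hx))
  have m_le : ∀ x ≤ 0, m x ≤ C * T := fun x hx => by
    calc m x ≤ ∫ t in (0:ℝ)..T, C := by
          apply intervalIntegral.integral_mono_on hT ((c0 x).intervalIntegrable _ _) (by simp)
          exact fun t _ => hC x hx t
      _ = C * T := by simp [mul_comm]
  have pos1 : ∀ x ≤ 0, 0 ≤ m1 x := by
    intro x0 hx0
    by_contra! hneg
    have anti : AntitoneOn (fun x => m x - m1 x0 * x) (Iic x0) := by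
      refine antitoneOn_of_deriv_nonpos (convex_Iic x0)
        (fun x _ => ((hm x).sub ((hasDerivAt_id x).const_mul _)).continuousAt.continuousWithinAt)
        (fun x _ => ((hm x).sub
          ((hasDerivAt_id x).const_mul _)).differentiableAt.differentiableWithinAt) fun x hx => ?_
      have hx' : x ≤ x0 := mem_Iic.1 (interior_subset hx)
      have := ((hm x).sub ((hasDerivAt_id x).const_mul (m1 x0))).deriv
      simp only [id] at this
      erw [this]
      have := mono1 (hx'.trans hx0) hx0 hx'
      linarith
    -- far to the left the mean would exceed its bound
    obtain ⟨d, hd⟩ : ∃ d : ℝ, C * T - m x0 < d * (-m1 x0) ∧ 0 ≤ d := by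
      obtain ⟨n, hn⟩ := exists_nat_gt ((C * T - m x0) / (-m1 x0))
      exact ⟨n, (div_lt_iff₀ (by linarith)).1 hn, n.cast_nonneg⟩
    have h := anti (show x0 - d ∈ Iic x0 by simp [hd.2]) (self_mem_Iic) (by linarith [hd.2])
    have h' := m_le (x0 - d) (by linarith [hd.2])
    simp only at h
    nlinarith
  exact monotoneOn_of_deriv_nonneg (convex_Iic 0)
    (fun x _ => (hm x).continuousAt.continuousWithinAt)
    (fun x _ => (hm x).differentiableAt.differentiableWithinAt)
    fun x hx => by rw [(hm x).deriv]; exact pos1 x (mem_Iic.1 (interior_subset hx))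

/-- The regularized modulus `√(x² + y² + ε²)`. -/
def regAbs (ε x y : ℝ) : ℝ := √(x ^ 2 + y ^ 2 + ε ^ 2)

/-- First derivative of `regAbs` along a curve. -/
def regAbsD (ε x y x1 y1 : ℝ) : ℝ := (x * x1 + y * y1) / regAbs ε x y

/-- Second derivative of `regAbs` along a curve. -/
def regAbsDD (ε x y x1 y1 x2 y2 : ℝ) : ℝ :=
  (x1 ^ 2 + y1 ^ 2 + x * x2 + y * y2) / regAbs ε x y -
    (x * x1 + y * y1) ^ 2 / regAbs ε x y ^ 3

/-- The Bellman-type function behind Fefferman's inequality: with `f = x + iy`, `g = v + is` and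
`η = Re G` it is `2|f|_ε (1 + e^{|g|² - Re G}) - Re (f conj g)`. -/
def bell (ε x y v s η : ℝ) : ℝ :=
  2 * (regAbs ε x y + regAbs ε x y * Real.exp (v ^ 2 + s ^ 2 - η)) - (x * v + y * s)

/-- First derivative of `bell` along a curve. -/
def bellD (ε x y v s η x1 y1 v1 s1 η1 : ℝ) : ℝ :=
  2 * (regAbsD ε x y x1 y1 + (regAbsD ε x y x1 y1 +
    regAbs ε x y * (2 * (v * v1 + s * s1) - η1)) * Real.exp (v ^ 2 + s ^ 2 - η)) -
    (x1 * v + x * v1 + (y1 * s + y * s1))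

/-- Second derivative of `bell` along a curve. -/
def bellDD (ε x y v s η x1 y1 v1 s1 η1 x2 y2 v2 s2 η2 : ℝ) : ℝ :=
  2 * (regAbsDD ε x y x1 y1 x2 y2 + (regAbsDD ε x y x1 y1 x2 y2 +
    2 * regAbsD ε x y x1 y1 * (2 * (v * v1 + s * s1) - η1) +
    regAbs ε x y * (2 * (v1 ^ 2 + s1 ^ 2 + v * v2 + s * s2) - η2 +
      (2 * (v * v1 + s * s1) - η1) ^ 2)) * Real.exp (v ^ 2 + s ^ 2 - η)) -
    (x2 * v + 2 * (x1 * v1) + x * v2 + (y2 * s + 2 * (y1 * s1) + y * s2))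

lemma regAbs_pos {ε : ℝ} (hε : 0 < ε) (x y : ℝ) : 0 < regAbs ε x y :=
  Real.sqrt_pos.2 (by positivity)

lemma regAbs_sq (ε x y : ℝ) : regAbs ε x y ^ 2 = x ^ 2 + y ^ 2 + ε ^ 2 :=
  Real.sq_sqrt (by positivity)

section curves
variable {ε : ℝ} {x y v s η x1 y1 v1 s1 η1 x2 y2 v2 s2 η2 : ℝ → ℝ}

lemma hasDerivAt_regAbs (hε : 0 < ε) (hx : ∀ t, HasDerivAt x (x1 t) t)
    (hy : ∀ t, HasDerivAt y (y1 t) t) (t : ℝ) :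
    HasDerivAt (fun t => regAbs ε (x t) (y t)) (regAbsD ε (x t) (y t) (x1 t) (y1 t)) t := by
  have h := ((((hx t).pow 2).add ((hy t).pow 2)).add_const (ε ^ 2)).sqrt
    (by simp only [Pi.add_apply, Pi.pow_apply]; positivity)
  refine h.congr_deriv ?_
  have := regAbs_pos hε (x t) (y t)
  simp only [regAbsD]
  rw [show √((x ^ 2 + y ^ 2) t + ε ^ 2) = regAbs ε (x t) (y t) from rfl]
  field_simp
  push_cast
  ring

lemma hasDerivAt_regAbsD (hε : 0 < ε) (hx : ∀ t, HasDerivAt x (x1 t) t)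
    (hy : ∀ t, HasDerivAt y (y1 t) t) (hx1 : ∀ t, HasDerivAt x1 (x2 t) t)
    (hy1 : ∀ t, HasDerivAt y1 (y2 t) t) (t : ℝ) :
    HasDerivAt (fun t => regAbsD ε (x t) (y t) (x1 t) (y1 t))
      (regAbsDD ε (x t) (y t) (x1 t) (y1 t) (x2 t) (y2 t)) t := by
  have hp := regAbs_pos hε (x t) (y t)
  have h := (((hx t).mul (hx1 t)).add ((hy t).mul (hy1 t))).div (hasDerivAt_regAbs hε hx hy t) hp.ne'
  refine h.congr_deriv ?_
  simp only [regAbsDD, regAbsD, Pi.add_apply, Pi.mul_apply]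
  field_simp
  ring

lemma hasDerivAt_bell (hε : 0 < ε) (hx : ∀ t, HasDerivAt x (x1 t) t)
    (hy : ∀ t, HasDerivAt y (y1 t) t) (hv : ∀ t, HasDerivAt v (v1 t) t)
    (hs : ∀ t, HasDerivAt s (s1 t) t) (hη : ∀ t, HasDerivAt η (η1 t) t) (t : ℝ) :
    HasDerivAt (fun t => bell ε (x t) (y t) (v t) (s t) (η t))
      (bellD ε (x t) (y t) (v t) (s t) (η t) (x1 t) (y1 t) (v1 t) (s1 t) (η1 t)) t := by
  have hw := hasDerivAt_regAbs hε hx hy t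
  have he := ((((hv t).pow 2).add ((hs t).pow 2)).sub (hη t)).exp
  have h := ((hw.add (hw.mul he)).const_mul 2).sub (((hx t).mul (hv t)).add ((hy t).mul (hs t)))
  refine h.congr_deriv ?_
  simp only [bellD, Pi.add_apply, Pi.sub_apply, Pi.pow_apply]
  push_cast
  ring

lemma hasDerivAt_bellD (hε : 0 < ε) (hx : ∀ t, HasDerivAt x (x1 t) t)
    (hy : ∀ t, HasDerivAt y (y1 t) t) (hv : ∀ t, HasDerivAt v (v1 t) t)
    (hs : ∀ t, HasDerivAt s (s1 t) t) (hη : ∀ t, HasDerivAt η (η1 t) t)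
    (hx1 : ∀ t, HasDerivAt x1 (x2 t) t)
    (hy1 : ∀ t, HasDerivAt y1 (y2 t) t) (hv1 : ∀ t, HasDerivAt v1 (v2 t) t)
    (hs1 : ∀ t, HasDerivAt s1 (s2 t) t) (hη1 : ∀ t, HasDerivAt η1 (η2 t) t) (t : ℝ) :
    HasDerivAt (fun t => bellD ε (x t) (y t) (v t) (s t) (η t) (x1 t) (y1 t) (v1 t) (s1 t) (η1 t))
      (bellDD ε (x t) (y t) (v t) (s t) (η t) (x1 t) (y1 t) (v1 t) (s1 t) (η1 t)
        (x2 t) (y2 t) (v2 t) (s2 t) (η2 t)) t := by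
  have hw := hasDerivAt_regAbs hε hx hy t
  have hw1 := hasDerivAt_regAbsD hε hx hy hx1 hy1 t
  have he := ((((hv t).pow 2).add ((hs t).pow 2)).sub (hη t)).exp
  have hu := ((((hv t).mul (hv1 t)).add ((hs t).mul (hs1 t))).const_mul 2).sub (hη1 t)
  have h := ((hw1.add ((hw1.add (hw.mul hu)).mul he)).const_mul 2).sub
    ((((hx1 t).mul (hv t)).add ((hx t).mul (hv1 t))).add
      (((hy1 t).mul (hs t)).add ((hy t).mul (hs1 t))))
  refine h.congr_deriv ?_
  simp only [bellDD, Pi.add_apply, Pi.sub_apply, Pi.pow_apply, Pi.mul_apply]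
  push_cast
  ring
end curves

/-- The Laplacian of `bell` along analytic data is nonnegative where `|g|² - Re G ≥ -1`. -/
lemma bell_laplacian_nonneg {ε x y v s η a b c d a' b' c' d' e e' k : ℝ} (hε : 0 < ε)
    (hu : -1 ≤ v ^ 2 + s ^ 2 - η) :
    0 ≤ bellDD ε x y v s η a b c d e a' b' c' d' e' +
      bellDD ε x y v s η (-b) a (-d) c k (-a') (-b') (-c') (-d') (-e') := by
  have hE : 1 / 4 ≤ Real.exp (v ^ 2 + s ^ 2 - η) := by
    have h1 : Real.exp (-1) ≤ Real.exp (v ^ 2 + s ^ 2 - η) := Real.exp_le_exp.2 hu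
    have h2 : 1 / 4 ≤ Real.exp (-1) := by
      rw [Real.exp_neg, one_div]
      gcongr
      linarith [Real.exp_one_lt_d9]
    linarith
  unfold bellDD regAbsDD regAbsD
  set E := Real.exp (v ^ 2 + s ^ 2 - η)
  have hw := regAbs_pos hε x y
  have hsq := regAbs_sq ε x y
  set w := regAbs ε x y
  set u := 2 * (v * c + s * d) - e with hu_def
  set u' := 2 * (v * -d + s * c) - k with hu'_def
  -- gradient and Laplacian of the modulus
  set p := x * a + y * b
  set p' := x * -b + y * a
  have hpp : p ^ 2 + p' ^ 2 = (w ^ 2 - ε ^ 2) * (a ^ 2 + b ^ 2) := by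
    simp only [p, p']; rw [hsq]; ring
  have key : 0 ≤ 2 * (((a ^ 2 + b ^ 2) / w + ε ^ 2 * (a ^ 2 + b ^ 2) / w ^ 3) * (1 + E)
      + E * (2 * (p / w * u + p' / w * u') + w * (4 * (c ^ 2 + d ^ 2) + u ^ 2 + u' ^ 2)))
      - 4 * (a * c + b * d) := by
    have h1 : (a ^ 2 + b ^ 2) / w + ε ^ 2 * (a ^ 2 + b ^ 2) / w ^ 3
        + (2 * (p / w * u + p' / w * u') + w * (u ^ 2 + u' ^ 2)) =
        w * ((p / w ^ 2 + u) ^ 2 + (p' / w ^ 2 + u') ^ 2)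
          + 2 * ε ^ 2 * (a ^ 2 + b ^ 2) / w ^ 3 := by
      field_simp
      linear_combination (-1) * hpp
    have h2 : 0 ≤ w * ((p / w ^ 2 + u) ^ 2 + (p' / w ^ 2 + u') ^ 2)
          + 2 * ε ^ 2 * (a ^ 2 + b ^ 2) / w ^ 3 := by positivity
    rw [← h1] at h2
    have h3 : 0 ≤ ε ^ 2 * (a ^ 2 + b ^ 2) / w ^ 3 := by positivity
    have h4 : 4 * (a * c + b * d) ≤ 2 * ((a ^ 2 + b ^ 2) / w + 4 * E * w * (c ^ 2 + d ^ 2)) := by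
      have h5 : 2 * (a * c + b * d) ≤ (a ^ 2 + b ^ 2) / w + w * (c ^ 2 + d ^ 2) := by
        have : (a ^ 2 + b ^ 2) / w + w * (c ^ 2 + d ^ 2) - 2 * (a * c + b * d) =
          ((a - w * c) ^ 2 + (b - w * d) ^ 2) / w := by field_simp; ring
        have h6 : 0 ≤ ((a - w * c) ^ 2 + (b - w * d) ^ 2) / w := by positivity
        linarith
      have h7 : w * (c ^ 2 + d ^ 2) ≤ 4 * E * (w * (c ^ 2 + d ^ 2)) :=
        le_mul_of_one_le_left (by positivity) (by linarith)
      linarith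
    have h8 := mul_nonneg (show 0 ≤ E by linarith) h2
    nlinarith
  refine key.trans (le_of_eq ?_)
  have hpp' : (p ^ 2 + p' ^ 2) / w ^ 3 = (a ^ 2 + b ^ 2) / w - ε ^ 2 * (a ^ 2 + b ^ 2) / w ^ 3 := by
    rw [hpp]; field_simp
  have hs : (a ^ 2 + b ^ 2 + x * a' + y * b') / w - p ^ 2 / w ^ 3 +
      (((-b) ^ 2 + a ^ 2 + x * -a' + y * -b') / w - p' ^ 2 / w ^ 3) =
      (a ^ 2 + b ^ 2) / w + ε ^ 2 * (a ^ 2 + b ^ 2) / w ^ 3 := by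
    have : (a ^ 2 + b ^ 2 + x * a' + y * b') / w - p ^ 2 / w ^ 3 +
      (((-b) ^ 2 + a ^ 2 + x * -a' + y * -b') / w - p' ^ 2 / w ^ 3) =
        2 * ((a ^ 2 + b ^ 2) / w) - (p ^ 2 + p' ^ 2) / w ^ 3 := by
      ring
    rw [this, hpp']; ring
  rw [← hs]
  ring

open Polynomial in
/-- The Euler operator `z d/dz` on polynomials. -/
def eulerOp (p : Polynomial ℂ) : Polynomial ℂ := X * derivative p

lemma hasDerivAt_eval_exp (p : Polynomial ℂ) (ζ : ℂ) :
    HasDerivAt (fun ζ => p.eval (Complex.exp ζ)) ((eulerOp p).eval (Complex.exp ζ)) ζ := by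
  have := (p.hasDerivAt (Complex.exp ζ)).comp ζ (Complex.hasDerivAt_exp ζ)
  refine this.congr_deriv ?_
  simp [eulerOp, mul_comm]

lemma hasDerivAt_eval_polar_left (p : Polynomial ℂ) (t x : ℝ) :
    HasDerivAt (fun x : ℝ => p.eval (Complex.exp (x + t * Complex.I)))
      ((eulerOp p).eval (Complex.exp (x + t * Complex.I))) x := by
  have h : HasDerivAt (fun x : ℝ => (x : ℂ) + t * Complex.I) 1 x := by
    simpa using (Complex.ofRealCLM.hasDerivAt (x := x)).add_const (t * Complex.I)
  have := (hasDerivAt_eval_exp p (x + t * Complex.I)).comp_of_eq x h rfl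
  exact this.congr_deriv (mul_one _)

lemma hasDerivAt_eval_polar_right (p : Polynomial ℂ) (x t : ℝ) :
    HasDerivAt (fun t : ℝ => p.eval (Complex.exp (x + t * Complex.I)))
      (Complex.I * (eulerOp p).eval (Complex.exp (x + t * Complex.I))) t := by
  have h : HasDerivAt (fun t : ℝ => (x : ℂ) + t * Complex.I) Complex.I t := by
    simpa using ((Complex.ofRealCLM.hasDerivAt (x := t)).mul_const Complex.I).const_add (x : ℂ)
  have := (hasDerivAt_eval_exp p (x + t * Complex.I)).comp_of_eq t h rfl
  exact this.congr_deriv (mul_comm _ _)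

lemma HasDerivAt.complex_re {f : ℝ → ℂ} {f' : ℂ} {t : ℝ} (h : HasDerivAt f f' t) :
    HasDerivAt (fun t => (f t).re) f'.re t :=
  Complex.reCLM.hasFDerivAt.comp_hasDerivAt t h

lemma HasDerivAt.complex_im {f : ℝ → ℂ} {f' : ℂ} {t : ℝ} (h : HasDerivAt f f' t) :
    HasDerivAt (fun t => (f t).im) f'.im t :=
  Complex.imCLM.hasFDerivAt.comp_hasDerivAt t h

/-- `bell` in complex notation. -/
def bellC (ε : ℝ) (f g G : ℂ) : ℝ := bell ε f.re f.im g.re g.im G.re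

lemma continuous_bellC (ε : ℝ) : Continuous fun p : ℂ × ℂ × ℂ => bellC ε p.1 p.2.1 p.2.2 := by
  unfold bellC bell regAbs; fun_prop

lemma continuous_eval_polar (p : Polynomial ℂ) :
    Continuous fun z : ℝ × ℝ => p.eval (Complex.exp (z.1 + z.2 * Complex.I)) :=
  p.continuous.comp (by fun_prop)

/-- Submean property of `bell` along polynomial data. -/
lemma monotoneOn_circleAverage_bellC {ε : ℝ} (hε : 0 < ε) (f g G : Polynomial ℂ)
    (hu : ∀ z : ℂ, ‖z‖ ≤ 1 → -1 ≤ ‖g.eval z‖ ^ 2 - (G.eval z).re) :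
    MonotoneOn (fun r => Real.circleAverage
      (fun z => bellC ε (f.eval z) (g.eval z) (G.eval z)) 0 r) (Icc 0 1) := by
  have hcont : Continuous fun z => bellC ε (f.eval z) (g.eval z) (G.eval z) :=
    (continuous_bellC ε).comp (f.continuous.prodMk (g.continuous.prodMk G.continuous))
  obtain ⟨C, hC⟩ := (isCompact_closedBall (0:ℂ) 1).exists_bound_of_continuousOn hcont.continuousOn
  let z : ℝ → ℝ → ℂ := fun x t => Complex.exp (x + t * Complex.I)
  have hz : ∀ x ≤ 0, ∀ t, ‖z x t‖ ≤ 1 := fun x hx t => by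
    simp [z, Complex.norm_exp, hx]
  have cf := continuous_eval_polar f
  have cf1 := continuous_eval_polar (eulerOp f)
  have cf2 := continuous_eval_polar (eulerOp (eulerOp f))
  have cg := continuous_eval_polar g
  have cg1 := continuous_eval_polar (eulerOp g)
  have cg2 := continuous_eval_polar (eulerOp (eulerOp g))
  have cG := continuous_eval_polar G
  have cG1 := continuous_eval_polar (eulerOp G)
  have cG2 := continuous_eval_polar (eulerOp (eulerOp G))
  have cw : Continuous fun p : ℝ × ℝ => regAbs ε (f.eval (Complex.exp (p.1 + p.2 * Complex.I))).re
      (f.eval (Complex.exp (p.1 + p.2 * Complex.I))).im := by unfold regAbs; fun_prop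
  have hw : ∀ p : ℝ × ℝ, regAbs ε (f.eval (Complex.exp (p.1 + p.2 * Complex.I))).re
      (f.eval (Complex.exp (p.1 + p.2 * Complex.I))).im ≠ 0 := fun p => (regAbs_pos hε _ _).ne'
  have hw3 : ∀ p : ℝ × ℝ, regAbs ε (f.eval (Complex.exp (p.1 + p.2 * Complex.I))).re
      (f.eval (Complex.exp (p.1 + p.2 * Complex.I))).im ^ 3 ≠ 0 := fun p => pow_ne_zero _ (hw p)
  have key := monotoneOn_integral_of_laplacian_nonneg (C := C) (T := 2 * Real.pi)
    (Ψ := fun x t => bellC ε (f.eval (z x t)) (g.eval (z x t)) (G.eval (z x t)))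
    (Ψx := fun x t => bellD ε (f.eval (z x t)).re (f.eval (z x t)).im
      (g.eval (z x t)).re (g.eval (z x t)).im (G.eval (z x t)).re
      ((eulerOp f).eval (z x t)).re ((eulerOp f).eval (z x t)).im
      ((eulerOp g).eval (z x t)).re ((eulerOp g).eval (z x t)).im ((eulerOp G).eval (z x t)).re)
    (Ψxx := fun x t => bellDD ε (f.eval (z x t)).re (f.eval (z x t)).im
      (g.eval (z x t)).re (g.eval (z x t)).im (G.eval (z x t)).re
      ((eulerOp f).eval (z x t)).re ((eulerOp f).eval (z x t)).im
      ((eulerOp g).eval (z x t)).re ((eulerOp g).eval (z x t)).im ((eulerOp G).eval (z x t)).re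
      ((eulerOp (eulerOp f)).eval (z x t)).re ((eulerOp (eulerOp f)).eval (z x t)).im
      ((eulerOp (eulerOp g)).eval (z x t)).re ((eulerOp (eulerOp g)).eval (z x t)).im
      ((eulerOp (eulerOp G)).eval (z x t)).re)
    (Ψy := fun x t => bellD ε (f.eval (z x t)).re (f.eval (z x t)).im
      (g.eval (z x t)).re (g.eval (z x t)).im (G.eval (z x t)).re
      (-((eulerOp f).eval (z x t)).im) ((eulerOp f).eval (z x t)).re
      (-((eulerOp g).eval (z x t)).im) ((eulerOp g).eval (z x t)).re
      (-((eulerOp G).eval (z x t)).im))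
    (Ψyy := fun x t => bellDD ε (f.eval (z x t)).re (f.eval (z x t)).im
      (g.eval (z x t)).re (g.eval (z x t)).im (G.eval (z x t)).re
      (-((eulerOp f).eval (z x t)).im) ((eulerOp f).eval (z x t)).re
      (-((eulerOp g).eval (z x t)).im) ((eulerOp g).eval (z x t)).re
      (-((eulerOp G).eval (z x t)).im)
      (-((eulerOp (eulerOp f)).eval (z x t)).re) (-((eulerOp (eulerOp f)).eval (z x t)).im)
      (-((eulerOp (eulerOp g)).eval (z x t)).re) (-((eulerOp (eulerOp g)).eval (z x t)).im)
      (-((eulerOp (eulerOp G)).eval (z x t)).re))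
    (hcont.comp (by simp only [z]; fun_prop))
    (by simp only [Function.uncurry_def, z, bellD, regAbsD]; fun_prop (disch := assumption))
    (by simp only [Function.uncurry_def, z, bellDD, regAbsD, regAbsDD]
        fun_prop (disch := assumption))
    (by simp only [Function.uncurry_def, z, bellDD, regAbsD, regAbsDD]
        fun_prop (disch := assumption))
    (fun x t => hasDerivAt_bell hε
      (fun x => (hasDerivAt_eval_polar_left f t x).complex_re)
      (fun x => (hasDerivAt_eval_polar_left f t x).complex_im)
      (fun x => (hasDerivAt_eval_polar_left g t x).complex_re)
      (fun x => (hasDerivAt_eval_polar_left g t x).complex_im)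
      (fun x => (hasDerivAt_eval_polar_left G t x).complex_re) x)
    (fun x t => hasDerivAt_bellD hε
      (fun x => (hasDerivAt_eval_polar_left f t x).complex_re)
      (fun x => (hasDerivAt_eval_polar_left f t x).complex_im)
      (fun x => (hasDerivAt_eval_polar_left g t x).complex_re)
      (fun x => (hasDerivAt_eval_polar_left g t x).complex_im)
      (fun x => (hasDerivAt_eval_polar_left G t x).complex_re)
      (fun x => (hasDerivAt_eval_polar_left _ t x).complex_re)
      (fun x => (hasDerivAt_eval_polar_left _ t x).complex_im)
      (fun x => (hasDerivAt_eval_polar_left _ t x).complex_re)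
      (fun x => (hasDerivAt_eval_polar_left _ t x).complex_im)
      (fun x => (hasDerivAt_eval_polar_left _ t x).complex_re) x)
    (fun x t => by
      have hr : ∀ (p : Polynomial ℂ) (t : ℝ), HasDerivAt (fun t => (p.eval (z x t)).re)
          (-((eulerOp p).eval (z x t)).im) t := fun p t => by
        simpa [z] using (hasDerivAt_eval_polar_right p x t).complex_re
      have hi : ∀ (p : Polynomial ℂ) (t : ℝ), HasDerivAt (fun t => (p.eval (z x t)).im)
          (((eulerOp p).eval (z x t)).re) t := fun p t => by
        simpa [z] using (hasDerivAt_eval_polar_right p x t).complex_im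
      exact hasDerivAt_bellD hε (hr f) (hi f) (hr g) (hi g) (hr G)
        (fun t => (hi _ t).fun_neg) (hr _) (fun t => (hi _ t).fun_neg) (hr _)
        (fun t => (hi _ t).fun_neg) t)
    (fun x => by
      have : z x (2 * Real.pi) = z x 0 := by
        simp only [z, Complex.exp_add]; push_cast; simp
      simp only [this])
    (by positivity)
    (fun x hx t => (le_abs_self _).trans (hC _ (by simpa using hz x hx t)))
    (fun x hx t => bell_laplacian_nonneg hε (by
      have := hu _ (hz x hx t)
      rw [Complex.sq_norm, Complex.normSq_apply] at this
      nlinarith))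
  have hmono : MonotoneOn (fun r => Real.circleAverage
      (fun z => bellC ε (f.eval z) (g.eval z) (G.eval z)) 0 r) (Ioc 0 1) := by
    intro r hr s hs hrs
    have h := key (mem_Iic.2 (Real.log_nonpos hr.1.le hr.2))
      (mem_Iic.2 (Real.log_nonpos hs.1.le hs.2)) (Real.log_le_log hr.1 hrs)
    have e : ∀ r > 0, ∀ t, z (Real.log r) t = circleMap 0 r t := fun r hr t => by
      simp only [z, Complex.exp_add, circleMap, zero_add]
      rw [← Complex.ofReal_exp, Real.exp_log hr]
    simp only [e _ hr.1, e _ hs.1] at h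
    simp only [Real.circleAverage]
    exact smul_le_smul_of_nonneg_left h (by positivity)
  have hc := (Real.Continuous.circleAverage (c := 0) hcont).continuousOn (s := Icc 0 1)
  intro r hr s hs hrs
  rcases hr.1.eq_or_lt with rfl | hr0
  · rcases hs.1.eq_or_lt with rfl | hs0
    · exact le_rfl
    · refine le_of_tendsto ((Real.Continuous.circleAverage (c := 0) hcont).continuousAt.tendsto.mono_left
        (nhdsWithin_le_nhds (s := Ioi 0))) ?_
      filter_upwards [Ioc_mem_nhdsGT hs0] with x hx
      exact hmono ⟨hx.1, hx.2.trans hs.2⟩ ⟨hs0, hs.2⟩ hx.2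
  · exact hmono ⟨hr0, hr.2⟩ ⟨hr0.trans_le hrs, hs.2⟩ hrs

open Real in
lemma norm_circleAverage_le (f : ℂ → ℂ) (c : ℂ) (r : ℝ) :
    ‖circleAverage f c r‖ ≤ circleAverage (fun z => ‖f z‖) c r := by
  unfold circleAverage
  rw [norm_smul, Real.norm_of_nonneg (by positivity), smul_eq_mul]
  gcongr
  exact intervalIntegral.norm_integral_le_integral_norm (by positivity)

/-- The real part of `p conj q` agrees on the unit circle with the real part of a polynomial. -/
lemma exists_re_mul_conj_eq_re (p q : Polynomial ℂ) : ∃ G : Polynomial ℂ, ∀ z : ℂ, ‖z‖ = 1 →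
    (p.eval z * (starRingEnd ℂ) (q.eval z)).re = (G.eval z).re := by
  induction p using Polynomial.induction_on' with
  | add p p' hp hp' =>
    obtain ⟨G, hG⟩ := hp
    obtain ⟨G', hG'⟩ := hp'
    refine ⟨G + G', fun z hz => ?_⟩
    simp only [Polynomial.eval_add, add_mul, Complex.add_re, hG z hz, hG' z hz]
  | monomial m a =>
    induction q using Polynomial.induction_on' with
    | add q q' hq hq' =>
      obtain ⟨G, hG⟩ := hq
      obtain ⟨G', hG'⟩ := hq'
      refine ⟨G + G', fun z hz => ?_⟩
      simp only [Polynomial.eval_add, map_add, mul_add, Complex.add_re, hG z hz, hG' z hz]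
    | monomial n b =>
      have hz1 : ∀ z : ℂ, ‖z‖ = 1 → z * (starRingEnd ℂ) z = 1 := fun z hz => by
        rw [Complex.mul_conj']; simp [hz]
      rcases le_total n m with h | h
      · obtain ⟨k, rfl⟩ := Nat.exists_eq_add_of_le h
        refine ⟨Polynomial.monomial k (a * (starRingEnd ℂ) b), fun z hz => ?_⟩
        simp only [Polynomial.eval_monomial, map_mul, map_pow]
        congr 1
        have := congrArg (· ^ n) (hz1 z hz)
        simp only [mul_pow, one_pow] at this
        rw [pow_add]
        linear_combination (a * z ^ k * (starRingEnd ℂ) b) * this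
      · obtain ⟨k, rfl⟩ := Nat.exists_eq_add_of_le h
        refine ⟨Polynomial.monomial k ((starRingEnd ℂ) a * b), fun z hz => ?_⟩
        rw [← Complex.conj_re]
        simp only [Polynomial.eval_monomial, map_mul, map_pow, Complex.conj_conj]
        congr 1
        have := congrArg (· ^ m) (hz1 z hz)
        simp only [mul_pow, one_pow] at this
        rw [pow_add]
        linear_combination ((starRingEnd ℂ) a * z ^ k * b) * this

/-- The Poisson kernel of the unit disc. -/
def poissonKer (a z : ℂ) : ℝ := (1 - ‖a‖ ^ 2) / ‖z - a‖ ^ 2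

lemma poissonKer_nonneg {a : ℂ} (ha : ‖a‖ < 1) (z : ℂ) : 0 ≤ poissonKer a z := by
  have : ‖a‖ ^ 2 < 1 := by nlinarith [norm_nonneg a]
  exact div_nonneg (by linarith) (by positivity)

lemma sub_ne_zero_of_mem_sphere {a z : ℂ} (ha : ‖a‖ < 1) (hz : ‖z‖ = 1) : z - a ≠ 0 :=
  sub_ne_zero.2 fun h => by simp_all

lemma continuousOn_poissonKer {a : ℂ} (ha : ‖a‖ < 1) :
    ContinuousOn (poissonKer a) (Metric.sphere 0 1) := by
  unfold poissonKer
  refine ContinuousOn.div continuousOn_const (by fun_prop) fun z hz => ?_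
  have := sub_ne_zero_of_mem_sphere ha (mem_sphere_zero_iff_norm.1 hz)
  positivity

lemma circleIntegrable_of_continuousOn_sphere {E : Type*} [NormedAddCommGroup E] {f : ℂ → E}
    (hf : ContinuousOn f (Metric.sphere 0 1)) : CircleIntegrable f 0 1 :=
  hf.circleIntegrable zero_le_one

lemma circleAverage_poissonKer_eval {a : ℂ} (ha : ‖a‖ < 1) (G : Polynomial ℂ) :
    Real.circleAverage (fun z => poissonKer a z • G.eval z) 0 1 = G.eval a := by
  have h := DiffContOnCl.circleAverage_poissonKernel_smul' (c := 0) (R := 1) (w := a)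
    (G.differentiable.diffContOnCl (s := Metric.ball 0 1)) (by simpa using ha)
  rw [← h]
  refine Real.circleAverage_congr_sphere fun z hz => ?_
  have : ‖z‖ = 1 := by simpa using hz
  simp [poissonKer, this]

lemma circleAverage_poissonKer_re_eval {a : ℂ} (ha : ‖a‖ < 1) (G : Polynomial ℂ) :
    Real.circleAverage (fun z => poissonKer a z * (G.eval z).re) 0 1 = (G.eval a).re := by
  have h := Complex.reCLM.circleAverage_comp_comm (f := fun z => poissonKer a z • G.eval z)
    (c := 0) (R := 1) (circleIntegrable_of_continuousOn_sphere
      ((continuousOn_poissonKer ha).smul G.continuous.continuousOn))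
  rw [circleAverage_poissonKer_eval ha] at h
  rw [← Complex.reCLM_apply, ← h]
  congr 1
  ext z
  simp

lemma circleAverage_poissonKer {a : ℂ} (ha : ‖a‖ < 1) :
    Real.circleAverage (poissonKer a) 0 1 = 1 := by
  simpa using circleAverage_poissonKer_re_eval ha 1

/-- The square of the Garsia seminorm of `g` at `a`. -/
def garsia (g : Polynomial ℂ) (a : ℂ) : ℝ :=
  Real.circleAverage (fun z => poissonKer a z * ‖g.eval z - g.eval a‖ ^ 2) 0 1

lemma garsia_nonneg (g : Polynomial ℂ) {a : ℂ} (ha : ‖a‖ < 1) : 0 ≤ garsia g a :=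
  Real.circleAverage_nonneg_of_nonneg fun z _ => mul_nonneg (poissonKer_nonneg ha z) (by positivity)

open Polynomial in
lemma garsia_eq {g G : Polynomial ℂ}
    (hG : ∀ z : ℂ, ‖z‖ = 1 → ‖g.eval z‖ ^ 2 = (G.eval z).re) {a : ℂ} (ha : ‖a‖ < 1) :
    garsia g a = (G.eval a).re - ‖g.eval a‖ ^ 2 := by
  have h := circleAverage_poissonKer_re_eval ha
    (G - C (2 * (starRingEnd ℂ) (g.eval a)) * g + C ((‖g.eval a‖ ^ 2 : ℝ) : ℂ))
  have e : ((G - C (2 * (starRingEnd ℂ) (g.eval a)) * g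
      + C ((‖g.eval a‖ ^ 2 : ℝ) : ℂ)).eval a).re = (G.eval a).re - ‖g.eval a‖ ^ 2 := by
    simp only [eval_add, eval_sub, eval_mul, eval_C, Complex.add_re, Complex.sub_re,
      Complex.ofReal_re, Complex.sq_norm, Complex.normSq_apply]
    simp [Complex.mul_re]
    ring
  rw [← e, ← h, garsia]
  refine Real.circleAverage_congr_sphere fun z hz => ?_
  have hz : ‖z‖ = 1 := by simpa using hz
  simp only [eval_add, eval_sub, eval_mul, eval_C, Complex.add_re, Complex.sub_re,
      Complex.ofReal_re, ← hG z hz, Complex.sq_norm, Complex.normSq_apply]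
  simp [Complex.mul_re]
  left
  ring

lemma one_sub_conj_mul_ne_zero {a z : ℂ} (ha : ‖a‖ < 1) (hz : ‖z‖ ≤ 1) :
    1 - (starRingEnd ℂ) a * z ≠ 0 := by
  intro h
  have : ‖(starRingEnd ℂ) a * z‖ = 1 := by rw [← sub_eq_zero.1 h]; simp
  rw [norm_mul, RCLike.norm_conj] at this
  nlinarith [norm_nonneg a, norm_nonneg z]

/-- The disc involution `φ_a`. -/
def mob (a z : ℂ) : ℂ := (a - z) / (1 - (starRingEnd ℂ) a * z)

lemma mob_sq_sub {a z : ℂ} :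
    ‖1 - (starRingEnd ℂ) a * z‖ ^ 2 - ‖a - z‖ ^ 2 = (1 - ‖a‖ ^ 2) * (1 - ‖z‖ ^ 2) := by
  simp only [Complex.sq_norm, Complex.normSq_apply]
  simp
  ring

lemma norm_mob_le {a z : ℂ} (ha : ‖a‖ < 1) (hz : ‖z‖ ≤ 1) : ‖mob a z‖ ≤ 1 := by
  have h := mob_sq_sub (a := a) (z := z)
  have h0 := norm_pos_iff.2 (one_sub_conj_mul_ne_zero ha hz)
  rw [mob, norm_div, div_le_one h0]
  refine le_of_sq_le_sq ?_ h0.le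
  have : 0 ≤ (1 - ‖a‖ ^ 2) * (1 - ‖z‖ ^ 2) := by
    apply mul_nonneg <;> nlinarith [norm_nonneg a, norm_nonneg z]
  linarith

lemma norm_mob_eq_one {a z : ℂ} (ha : ‖a‖ < 1) (hz : ‖z‖ = 1) : ‖mob a z‖ = 1 := by
  have h := mob_sq_sub (a := a) (z := z)
  have h0 := norm_pos_iff.2 (one_sub_conj_mul_ne_zero ha hz.le)
  rw [mob, norm_div, div_eq_one_iff_eq h0.ne']
  rw [hz] at h
  exact (pow_left_inj₀ (norm_nonneg _) h0.le two_ne_zero).1 (by linarith)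

lemma differentiableOn_mob {a : ℂ} (ha : ‖a‖ < 1) :
    DifferentiableOn ℂ (mob a) (Metric.closedBall 0 1) := by
  unfold mob
  refine DifferentiableOn.div (by fun_prop) (by fun_prop) fun z hz => ?_
  exact one_sub_conj_mul_ne_zero ha (by simpa using hz)

lemma norm_sq_le_re {g G : Polynomial ℂ}
    (hG : ∀ z : ℂ, ‖z‖ = 1 → ‖g.eval z‖ ^ 2 = (G.eval z).re) {z : ℂ} (hz : ‖z‖ ≤ 1) :
    ‖g.eval z‖ ^ 2 ≤ (G.eval z).re := by
  rcases hz.eq_or_lt with h | h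
  · exact (hG z h).le
  · linarith [garsia_nonneg g h, garsia_eq hG h]

lemma exists_norm_sq_eq_re (g : Polynomial ℂ) :
    ∃ G : Polynomial ℂ, ∀ z : ℂ, ‖z‖ = 1 → ‖g.eval z‖ ^ 2 = (G.eval z).re := by
  obtain ⟨G, hG⟩ := exists_re_mul_conj_eq_re g g
  refine ⟨G, fun z hz => ?_⟩
  rw [← hG z hz, Complex.mul_conj']
  norm_cast

open Polynomial in
lemma exists_garsia_majorant (g : Polynomial ℂ) {a : ℂ} (ha : ‖a‖ < 1) :
    ∃ K : Polynomial ℂ, (K.eval a).re = garsia g a ∧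
      (∀ z : ℂ, ‖z‖ ≤ 1 → ‖g.eval z - g.eval a‖ ^ 2 ≤ (K.eval z).re) ∧
      ∀ z : ℂ, ‖z‖ = 1 → ‖g.eval z - g.eval a‖ ^ 2 = (K.eval z).re := by
  obtain ⟨K, hK⟩ := exists_norm_sq_eq_re (g - C (g.eval a))
  refine ⟨K, ?_, fun z hz => ?_, fun z hz => ?_⟩
  · have := garsia_eq hK ha
    simp only [eval_sub, eval_C, sub_self, norm_zero, ne_eq, OfNat.ofNat_ne_zero,
      not_false_eq_true, zero_pow, sub_zero] at this
    rw [← this]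
    simp [garsia]
  · simpa using norm_sq_le_re hK hz
  · simpa using hK z hz

lemma circleAverage_re_eval_mob (K : Polynomial ℂ) {a : ℂ} (ha : ‖a‖ < 1) {r : ℝ}
    (h0 : 0 ≤ r) (h1 : r ≤ 1) :
    Real.circleAverage (fun z => (K.eval (mob a z)).re) 0 r = (K.eval a).re := by
  have hd : DifferentiableOn ℂ (fun z => K.eval (mob a z)) (Metric.closedBall 0 r) :=
    K.differentiable.comp_differentiableOn
      ((differentiableOn_mob ha).mono (Metric.closedBall_subset_closedBall h1))
  have hc : DiffContOnCl ℂ (fun z => K.eval (mob a z)) (Metric.ball 0 |r|) := by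
    rw [abs_of_nonneg h0]
    exact DifferentiableOn.diffContOnCl (hd.mono Metric.closure_ball_subset_closedBall)
  have h := Complex.reCLM.circleAverage_comp_comm (f := fun z => K.eval (mob a z))
    (c := 0) (R := r) ((hd.continuousOn.mono Metric.sphere_subset_closedBall).circleIntegrable h0)
  rw [hc.circleAverage] at h
  simpa [mob, Function.comp_def] using h

lemma continuousOn_norm_eval_mob_sub (g : Polynomial ℂ) {a : ℂ} (ha : ‖a‖ < 1) :
    ContinuousOn (fun z => ‖g.eval (mob a z) - g.eval a‖ ^ 2) (Metric.closedBall 0 1) := by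
  have := g.continuous.comp_continuousOn (differentiableOn_mob ha).continuousOn
  exact ((this.sub continuousOn_const).norm.pow 2)

lemma circleAverage_mob_le_garsia (g : Polynomial ℂ) {a : ℂ} (ha : ‖a‖ < 1) {r : ℝ}
    (h0 : 0 ≤ r) (h1 : r ≤ 1) :
    Real.circleAverage (fun z => ‖g.eval (mob a z) - g.eval a‖ ^ 2) 0 r ≤ garsia g a := by
  obtain ⟨K, hK, hle, -⟩ := exists_garsia_majorant g ha
  rw [← hK, ← circleAverage_re_eval_mob K ha h0 h1]
  have hs : Metric.sphere (0:ℂ) r ⊆ Metric.closedBall 0 1 :=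
    Metric.sphere_subset_closedBall.trans (Metric.closedBall_subset_closedBall h1)
  refine Real.circleAverage_mono
    (((continuousOn_norm_eval_mob_sub g ha).mono hs).circleIntegrable h0)
    (((Complex.continuous_re.comp K.continuous).comp_continuousOn
      ((differentiableOn_mob ha).continuousOn.mono hs)).circleIntegrable h0) fun z hz => ?_
  rw [abs_of_nonneg h0] at hz
  exact hle _ (norm_mob_le ha (by simpa using hs hz))

lemma tendsto_circleAverage_mob (g : Polynomial ℂ) {a : ℂ} (ha : ‖a‖ < 1) :
    Tendsto (fun r => Real.circleAverage (fun z => ‖g.eval (mob a z) - g.eval a‖ ^ 2) 0 r)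
      (nhdsWithin 1 (Iio 1)) (nhds (garsia g a)) := by
  obtain ⟨K, hK, -, heq⟩ := exists_garsia_majorant g ha
  have hc := Real.ContinuousOn.circleAverage (s := Icc 0 1) (c := 0)
    (f := fun z => ‖g.eval (mob a z) - g.eval a‖ ^ 2)
    ((continuousOn_norm_eval_mob_sub g ha).mono fun z hz => by simpa using hz.2) fun r hr => hr.1
  have h := (hc 1 (by simp)).tendsto
  have e : Real.circleAverage (fun z => ‖g.eval (mob a z) - g.eval a‖ ^ 2) 0 1 = garsia g a := by
    rw [← hK, ← circleAverage_re_eval_mob K ha zero_le_one le_rfl]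
    exact Real.circleAverage_congr_sphere fun z hz =>
      heq _ (norm_mob_eq_one ha (by simpa using hz))
  rw [e] at h
  have h2 : nhdsWithin (1:ℝ) (Iio 1) ≤ nhdsWithin 1 (Icc 0 1) := by
    rw [← nhdsWithin_Ioo_eq_nhdsLT (show (0:ℝ) < 1 by norm_num)]
    exact nhdsWithin_mono _ Ioo_subset_Icc_self
  exact h.mono_left h2

section PolynomialMeans

open Polynomial ComplexConjugate

lemma circleAverage_const_mul (a : ℝ) (f : ℂ → ℝ) (c : ℂ) (r : ℝ) :
    Real.circleAverage (fun z => a * f z) c r = a * Real.circleAverage f c r :=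
  Real.circleAverage_fun_smul (a := a) (f := f)

/-- The integral mean `M_1(r,p)` of a polynomial. -/
def M1 (p : Polynomial ℂ) (r : ℝ) : ℝ := Real.circleAverage (fun z => ‖p.eval z‖) 0 r

lemma continuous_norm_eval (p : Polynomial ℂ) : Continuous fun z => ‖p.eval z‖ := by fun_prop

lemma Continuous.circleIntegrable' {E : Type*} [NormedAddCommGroup E] {f : ℂ → E}
    (hf : Continuous f) (c : ℂ) (r : ℝ) : CircleIntegrable f c r := by
  refine Continuous.intervalIntegrable ?_ _ _
  fun_prop

lemma le_regAbs (ε : ℝ) (w : ℂ) : ‖w‖ ≤ regAbs ε w.re w.im := by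
  rw [Complex.norm_eq_sqrt_sq_add_sq, regAbs]
  exact Real.sqrt_le_sqrt (by nlinarith [sq_nonneg ε])

lemma regAbs_le {ε : ℝ} (hε : 0 ≤ ε) (w : ℂ) : regAbs ε w.re w.im ≤ ‖w‖ + ε := by
  refine Real.sqrt_le_iff.2 ⟨by positivity, ?_⟩
  have := Complex.sq_norm w
  rw [Complex.normSq_apply] at this
  nlinarith [norm_nonneg w, mul_nonneg (norm_nonneg w) hε]

lemma continuous_regAbs_eval (ε : ℝ) (p : Polynomial ℂ) :
    Continuous fun z => regAbs ε (p.eval z).re (p.eval z).im := by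
  unfold regAbs; fun_prop

lemma circleAverage_regAbs_le {ε : ℝ} (hε : 0 ≤ ε) (p : Polynomial ℂ) (r : ℝ) :
    Real.circleAverage (fun z => regAbs ε (p.eval z).re (p.eval z).im) 0 r ≤ M1 p r + ε := by
  have : M1 p r + ε = Real.circleAverage (fun z => ‖p.eval z‖ + ε) 0 r := by
    rw [Real.circleAverage_fun_add ((continuous_norm_eval p).circleIntegrable' 0 r)
      (circleIntegrable_const _ _ _), Real.circleAverage_const, M1]
  rw [this]
  exact Real.circleAverage_mono ((continuous_regAbs_eval ε p).circleIntegrable' 0 r)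
    (((continuous_norm_eval p).add continuous_const).circleIntegrable' 0 r)
    fun z _ => regAbs_le hε _

lemma M1_mono (p : Polynomial ℂ) : MonotoneOn (M1 p) (Icc 0 1) := by
  intro r hr s hs hrs
  refine le_of_forall_pos_le_add fun ε hε => ?_
  have h := monotoneOn_circleAverage_bellC hε p 0 0 (fun z _ => by simp) hr hs hrs
  have e : ∀ z, bellC ε (p.eval z) ((0 : Polynomial ℂ).eval z) ((0 : Polynomial ℂ).eval z) =
      4 * regAbs ε (p.eval z).re (p.eval z).im := fun z => by
    simp [bellC, bell]; ring
  simp only [e, circleAverage_const_mul] at h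
  have h1 : M1 p r ≤ Real.circleAverage (fun z => regAbs ε (p.eval z).re (p.eval z).im) 0 r :=
    Real.circleAverage_mono ((continuous_norm_eval p).circleIntegrable' 0 r)
      ((continuous_regAbs_eval ε p).circleIntegrable' 0 r) fun z _ => le_regAbs _ _
  linarith [circleAverage_regAbs_le hε.le p s]

lemma M1_nonneg (p : Polynomial ℂ) (r : ℝ) : 0 ≤ M1 p r :=
  Real.circleAverage_nonneg_of_nonneg fun _ _ => norm_nonneg _

lemma M1_add_le (p q : Polynomial ℂ) (r : ℝ) : M1 (p + q) r ≤ M1 p r + M1 q r := by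
  unfold M1
  rw [← Real.circleAverage_fun_add ((continuous_norm_eval p).circleIntegrable' 0 r)
    ((continuous_norm_eval q).circleIntegrable' 0 r)]
  refine Real.circleAverage_mono ((continuous_norm_eval _).circleIntegrable' 0 r)
    (((continuous_norm_eval p).add (continuous_norm_eval q)).circleIntegrable' 0 r) fun z _ => ?_
  simpa using norm_add_le _ _

lemma M1_C_mul (c : ℂ) (p : Polynomial ℂ) (r : ℝ) : M1 (C c * p) r = ‖c‖ * M1 p r := by
  unfold M1
  rw [← circleAverage_const_mul]
  simp

lemma M1_zero (r : ℝ) : M1 0 r = 0 := by simp [M1, Real.circleAverage_const]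

lemma M1_sum_le {ι : Type*} (s : Finset ι) (p : ι → Polynomial ℂ) (r : ℝ) :
    M1 (∑ i ∈ s, p i) r ≤ ∑ i ∈ s, M1 (p i) r :=
  Finset.le_sum_of_subadditive (fun p => M1 p r) (M1_zero r).le (fun p q => M1_add_le p q r) s p

/-- The pairing `∑ p_k conj (b_k)`. -/
def coeffPair (p : Polynomial ℂ) (b : ℕ → ℂ) : ℂ := p.sum fun k a => a * conj (b k)

lemma coeffPair_add (p q : Polynomial ℂ) (b : ℕ → ℂ) :
    coeffPair (p + q) b = coeffPair p b + coeffPair q b :=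
  Polynomial.sum_add_index _ _ _ (by simp) (by intros; ring)

lemma coeffPair_monomial (k : ℕ) (a : ℂ) (b : ℕ → ℂ) :
    coeffPair (monomial k a) b = a * conj (b k) :=
  Polynomial.sum_monomial_index _ _ (by simp)

lemma coeffPair_C_mul (c : ℂ) (p : Polynomial ℂ) (b : ℕ → ℂ) :
    coeffPair (C c * p) b = c * coeffPair p b := by
  induction p using Polynomial.induction_on' with
  | add p q hp hq => rw [mul_add, coeffPair_add, hp, hq, coeffPair_add, mul_add]
  | monomial n a => rw [C_mul_monomial, coeffPair_monomial, coeffPair_monomial, mul_assoc]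

lemma coeffPair_add_right (p : Polynomial ℂ) (b c : ℕ → ℂ) :
    coeffPair p (b + c) = coeffPair p b + coeffPair p c := by
  simp [coeffPair, Polynomial.sum, mul_add, Finset.sum_add_distrib]

lemma circleAverage_eval (p : Polynomial ℂ) (r : ℝ) :
    Real.circleAverage (fun z => p.eval z) 0 r = p.eval 0 :=
  DiffContOnCl.circleAverage p.differentiable.diffContOnCl

lemma circleAverage_conj {f : ℂ → ℂ} (hf : Continuous f) :
    Real.circleAverage (fun z => conj (f z)) 0 1 = conj (Real.circleAverage f 0 1) :=
  Complex.conjCLE.toContinuousLinearMap.circleAverage_comp_comm (hf.circleIntegrable' 0 1)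

lemma circleAverage_pow_mul_conj_pow (m n : ℕ) :
    Real.circleAverage (fun z : ℂ => z ^ m * conj (z ^ n)) 0 1 = if m = n then 1 else 0 := by
  have hz1 : ∀ z : ℂ, ‖z‖ = 1 → z * conj z = 1 := fun z hz => by
    rw [Complex.mul_conj']; simp [hz]
  have key : ∀ n k, Real.circleAverage (fun z : ℂ => z ^ (n + k) * conj (z ^ n)) 0 1 =
      if n + k = n then 1 else 0 := fun n k => by
    have h := circleAverage_eval (X ^ k) 1
    simp only [eval_pow, eval_X] at h
    rw [Real.circleAverage_congr_sphere (f₂ := fun z => z ^ k), h]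
    · simp [zero_pow_eq]
    · intro z hz
      have := congrArg (· ^ n) (hz1 z (by simpa using hz))
      simp only [mul_pow, one_pow] at this
      simp only [map_pow, pow_add]
      linear_combination z ^ k * this
  rcases le_total n m with h | h
  · obtain ⟨k, rfl⟩ := Nat.exists_eq_add_of_le h
    exact key n k
  · obtain ⟨k, rfl⟩ := Nat.exists_eq_add_of_le h
    have h := congrArg conj (key m k)
    rw [← circleAverage_conj (by fun_prop)] at h
    simp only [map_mul, map_pow, Complex.conj_conj] at h
    simp only [map_pow]
    rw [show (fun z : ℂ => z ^ m * conj z ^ (m + k)) = fun z => conj z ^ (m + k) * z ^ m by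
      ext; ring, h]
    simp

lemma circleAverage_eval_mul_conj (p q : Polynomial ℂ) :
    Real.circleAverage (fun z => p.eval z * conj (q.eval z)) 0 1 = coeffPair p q.coeff := by
  have hi : ∀ p q : Polynomial ℂ, CircleIntegrable (fun z => p.eval z * conj (q.eval z)) 0 1 :=
    fun p q => Continuous.circleIntegrable' (by fun_prop) _ _
  induction p using Polynomial.induction_on' with
  | add p p' hp hp' =>
    rw [coeffPair_add, ← hp, ← hp', ← Real.circleAverage_fun_add (hi _ _) (hi _ _)]
    simp [add_mul]
  | monomial m a =>
    rw [coeffPair_monomial]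
    induction q using Polynomial.induction_on' with
    | add q q' hq hq' =>
      rw [coeff_add, map_add, mul_add, ← hq, ← hq', ← Real.circleAverage_fun_add (hi _ _) (hi _ _)]
      simp [mul_add]
    | monomial n b =>
      have := circleAverage_pow_mul_conj_pow m n
      rw [show (fun z : ℂ => (monomial m a).eval z * conj ((monomial n b).eval z)) =
        fun z => (a * conj b) • (z ^ m * conj (z ^ n)) by
          ext z; simp only [eval_monomial, map_mul, smul_eq_mul]; ring,
        Real.circleAverage_fun_smul, this, coeff_monomial]
      by_cases h : m = n
      · simp [h]
      · simp [h, Ne.symm h]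

lemma coeffPair_le_sup (p : Polynomial ℂ) (q : Polynomial ℂ) {B : ℝ}
    (hB : ∀ z : ℂ, ‖z‖ = 1 → ‖q.eval z‖ ≤ B) : ‖coeffPair p q.coeff‖ ≤ B * M1 p 1 := by
  rw [← circleAverage_eval_mul_conj]
  refine (norm_circleAverage_le _ _ _).trans ?_
  rw [M1, ← circleAverage_const_mul]
  refine Real.circleAverage_mono (Continuous.circleIntegrable' (by fun_prop) _ _)
    (Continuous.circleIntegrable' (by fun_prop) _ _) fun z hz => ?_
  rw [norm_mul, RCLike.norm_conj, mul_comm]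
  gcongr
  exact hB z (by simpa using hz)

lemma norm_coeff_le_M1 (p : Polynomial ℂ) (k : ℕ) : ‖p.coeff k‖ ≤ M1 p 1 := by
  have h := coeffPair_le_sup p (X ^ k) (B := 1) (fun z hz => by simp [hz])
  have e : coeffPair p (X ^ k : Polynomial ℂ).coeff = p.coeff k := by
    simp only [coeffPair, Polynomial.sum, coeff_X_pow]
    simp
    tauto
  simpa [e] using h

/-- Fefferman's inequality, normalized real form. -/
lemma re_coeffPair_le {g : Polynomial ℂ} (h0 : g.eval 0 = 0)
    (hg : ∀ a : ℂ, ‖a‖ < 1 → garsia g a ≤ 1) (f : Polynomial ℂ) :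
    (coeffPair f g.coeff).re ≤ 4 * M1 f 1 := by
  obtain ⟨G, hG⟩ := exists_norm_sq_eq_re g
  refine le_of_forall_pos_le_add fun δ hδ => ?_
  have hε : 0 < δ / 4 := by positivity
  set ε := δ / 4
  have h := monotoneOn_circleAverage_bellC hε f g G (fun z hz => ?_)
    (left_mem_Icc.2 zero_le_one) (right_mem_Icc.2 zero_le_one) zero_le_one
  · have h1 : (0:ℝ) ≤ Real.circleAverage
        (fun z => bellC ε (f.eval z) (g.eval z) (G.eval z)) 0 0 := by
      rw [Real.circleAverage_zero]
      simp only [bellC, bell, h0]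
      have := regAbs_pos hε (f.eval 0).re (f.eval 0).im
      simp only [Complex.zero_re, Complex.zero_im, mul_zero, add_zero, sub_zero]
      positivity
    have hi : CircleIntegrable (fun z => f.eval z * conj (g.eval z)) 0 1 :=
      Continuous.circleIntegrable' (by fun_prop) _ _
    have h2 : Real.circleAverage (fun z => bellC ε (f.eval z) (g.eval z) (G.eval z)) 0 1 =
        4 * Real.circleAverage (fun z => regAbs ε (f.eval z).re (f.eval z).im) 0 1 -
          (coeffPair f g.coeff).re := by
      rw [← circleAverage_eval_mul_conj, ← Complex.reCLM_apply,
        ← Complex.reCLM.circleAverage_comp_comm hi, ← circleAverage_const_mul,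
        ← Real.circleAverage_sub
          (((continuous_regAbs_eval ε f).const_mul 4).circleIntegrable' 0 1)
          (Continuous.circleIntegrable' (f := Complex.reCLM ∘ fun z => f.eval z * conj (g.eval z))
            (Complex.reCLM.continuous.comp (by fun_prop)) _ _)]
      refine Real.circleAverage_congr_sphere fun z hz => ?_
      have := hG z (by simpa using hz)
      rw [Complex.sq_norm, Complex.normSq_apply] at this
      simp only [bellC, bell]
      rw [show (g.eval z).re ^ 2 + (g.eval z).im ^ 2 - (G.eval z).re = 0 by linarith]
      simp [Complex.mul_re]
      ring
    have h3 := circleAverage_regAbs_le hε.le f 1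
    simp only [h2] at h
    have : 4 * ε = δ := by simp only [ε]; ring
    linarith
  · rcases hz.eq_or_lt with h | h
    · rw [hG z h]; simp
    · linarith [garsia_eq hG h, hg z h]

lemma norm_coeffPair_le_of_garsia_le_one {g : Polynomial ℂ} (h0 : g.eval 0 = 0)
    (hg : ∀ a : ℂ, ‖a‖ < 1 → garsia g a ≤ 1) (f : Polynomial ℂ) :
    ‖coeffPair f g.coeff‖ ≤ 4 * M1 f 1 := by
  obtain ⟨c, hc, hcf⟩ : ∃ c : ℂ, ‖c‖ = 1 ∧ c * coeffPair f g.coeff = ‖coeffPair f g.coeff‖ := by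
    by_cases h : coeffPair f g.coeff = 0
    · exact ⟨1, by simp, by simp [h]⟩
    · have h' : (‖coeffPair f g.coeff‖ : ℂ) ≠ 0 := by simpa using h
      refine ⟨conj (coeffPair f g.coeff) / ‖coeffPair f g.coeff‖, by simp [h], ?_⟩
      field_simp
      rw [Complex.conj_mul']
  have := re_coeffPair_le h0 hg (C c * f)
  rw [coeffPair_C_mul, hcf, M1_C_mul, hc, one_mul, Complex.ofReal_re] at this
  exact this

/-- Fefferman's inequality for polynomials. -/
lemma norm_coeffPair_le {g : Polynomial ℂ} {B : ℝ} (hB : 0 ≤ B)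
    (hg : ∀ a : ℂ, ‖a‖ < 1 → garsia g a ≤ B ^ 2) (f : Polynomial ℂ) :
    ‖coeffPair f g.coeff‖ ≤ (4 * B + ‖g.eval 0‖) * M1 f 1 := by
  refine le_of_forall_pos_le_add fun δ hδ => ?_
  have hM := M1_nonneg f 1
  obtain ⟨η, hη, hηδ⟩ : ∃ η > 0, 4 * η * M1 f 1 ≤ δ := by
    refine ⟨δ / (4 * (M1 f 1 + 1)), by positivity, ?_⟩
    rw [mul_div_assoc', div_mul_eq_mul_div, div_le_iff₀ (by positivity)]
    nlinarith
  set b := B + η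
  have hb : 0 < b := by positivity
  have h1 := norm_coeffPair_le_of_garsia_le_one
    (g := C ((b : ℂ)⁻¹) * (g - C (g.eval 0))) (by simp) (fun a ha => by
      have e : garsia (C ((b : ℂ)⁻¹) * (g - C (g.eval 0))) a = (b ^ 2)⁻¹ * garsia g a := by
        unfold garsia
        rw [← circleAverage_const_mul]
        congr 1
        ext z
        simp only [eval_mul, eval_C, eval_sub, ← mul_sub, sub_sub_sub_cancel_right, norm_mul,
          norm_inv, Complex.norm_real, mul_pow, inv_pow, Real.norm_eq_abs, sq_abs]
        ring
      rw [e, inv_mul_le_iff₀ (by positivity), mul_one]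
      exact (hg a ha).trans (by simp only [b]; gcongr; linarith)) f
  have e1 : coeffPair f (C ((b : ℂ)⁻¹) * (g - C (g.eval 0))).coeff =
      (b : ℂ)⁻¹ * (coeffPair f g.coeff - coeffPair f (C (g.eval 0)).coeff) := by
    simp only [coeffPair, Polynomial.sum, coeff_C_mul, coeff_sub, map_mul, map_sub, map_inv₀,
      Complex.conj_ofReal, Finset.mul_sum, ← Finset.sum_sub_distrib]
    exact Finset.sum_congr rfl fun k _ => by ring
  have h2 := coeffPair_le_sup f (C (g.eval 0)) (B := ‖g.eval 0‖) (fun z _ => by simp)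
  rw [e1, norm_mul, norm_inv, Complex.norm_real, Real.norm_of_nonneg hb.le,
    inv_mul_le_iff₀ hb] at h1
  have h3 := norm_add_le (coeffPair f g.coeff - coeffPair f (C (g.eval 0)).coeff)
    (coeffPair f (C (g.eval 0)).coeff)
  rw [sub_add_cancel] at h3
  simp only [b] at h1
  nlinarith

lemma circleAverage_poissonKer_mul_norm_sq_le (g : Polynomial ℂ) {a : ℂ} (ha : ‖a‖ < 1) :
    Real.circleAverage (fun z => poissonKer a z * ‖g.eval z - g.eval a‖) 0 1 ^ 2 ≤ garsia g a := by
  set m := Real.circleAverage (fun z => poissonKer a z * ‖g.eval z - g.eval a‖) 0 1 with hm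
  have hP := continuousOn_poissonKer ha
  have hn : ContinuousOn (fun z => ‖g.eval z - g.eval a‖) (Metric.sphere 0 1) := by fun_prop
  have h0 : 0 ≤ Real.circleAverage
      (fun z => poissonKer a z * (‖g.eval z - g.eval a‖ - m) ^ 2) 0 1 :=
    Real.circleAverage_nonneg_of_nonneg fun z _ => mul_nonneg (poissonKer_nonneg ha z) (by positivity)
  have e : (fun z => poissonKer a z * (‖g.eval z - g.eval a‖ - m) ^ 2) = fun z =>
      (poissonKer a z * ‖g.eval z - g.eval a‖ ^ 2 +
        (-2 * m) * (poissonKer a z * ‖g.eval z - g.eval a‖)) + m ^ 2 * poissonKer a z := by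
    ext z; ring
  rw [e, Real.circleAverage_fun_add, Real.circleAverage_fun_add, circleAverage_const_mul,
    circleAverage_const_mul, circleAverage_poissonKer ha, ← hm] at h0
  · unfold garsia; linarith
  · exact circleIntegrable_of_continuousOn_sphere (hP.mul (hn.pow 2))
  · exact circleIntegrable_of_continuousOn_sphere (continuousOn_const.mul (hP.mul hn))
  · exact circleIntegrable_of_continuousOn_sphere
      ((hP.mul (hn.pow 2)).add (continuousOn_const.mul (hP.mul hn)))
  · exact circleIntegrable_of_continuousOn_sphere (continuousOn_const.mul hP)

lemma circleAverage_poissonKer_mul_conj (g : Polynomial ℂ) {a : ℂ} (ha : ‖a‖ < 1) :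
    Real.circleAverage (fun z => poissonKer a z • ((g.eval z - g.eval a) * conj (g.eval z))) 0 1 =
      garsia g a := by
  have hP := continuousOn_poissonKer ha
  have h1 : Real.circleAverage (fun z => ((poissonKer a z * ‖g.eval z - g.eval a‖ ^ 2 : ℝ) : ℂ)) 0 1
      = garsia g a := by
    rw [garsia]
    exact Complex.ofRealCLM.circleAverage_comp_comm
      (f := fun z => poissonKer a z * ‖g.eval z - g.eval a‖ ^ 2)
      (circleIntegrable_of_continuousOn_sphere (hP.mul (by fun_prop)))
  have h2 := circleAverage_poissonKer_eval ha (C (conj (g.eval a)) * (g - C (g.eval a)))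
  have e : (fun z => poissonKer a z • ((g.eval z - g.eval a) * conj (g.eval z))) = fun z =>
      ((poissonKer a z * ‖g.eval z - g.eval a‖ ^ 2 : ℝ) : ℂ) +
      poissonKer a z • (C (conj (g.eval a)) * (g - C (g.eval a))).eval z := by
    ext z
    push_cast
    rw [← Complex.mul_conj']
    simp only [Complex.real_smul, eval_mul, eval_C, eval_sub, map_sub]
    ring
  rw [e, Real.circleAverage_fun_add, h1, h2]
  · simp
  · refine circleIntegrable_of_continuousOn_sphere
      (Complex.continuous_ofReal.comp_continuousOn (hP.mul (by fun_prop)))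
  · exact circleIntegrable_of_continuousOn_sphere (hP.smul (by fun_prop))

/-- Polynomials approximating `(g - g(a)) P_a` on the unit circle. -/
lemma exists_poly_eq_poissonKer_mul (g : Polynomial ℂ) {a : ℂ} (ha : ‖a‖ < 1) (M : ℕ) :
    ∃ f : Polynomial ℂ, ∀ z : ℂ, ‖z‖ = 1 →
      f.eval z = poissonKer a z • ((g.eval z - g.eval a) * (1 - (conj a * z) ^ M)) := by
  obtain ⟨Q, hQ⟩ := dvd_iff_isRoot.2 (show (g - C (g.eval a)).IsRoot a by simp)
  refine ⟨X * Q * C ((1 - ‖a‖ ^ 2 : ℝ) : ℂ) * ∑ m ∈ Finset.range M, C (conj a ^ m) * X ^ m,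
    fun z hz => ?_⟩
  have hQz := congrArg (eval z) hQ
  simp only [eval_sub, eval_C, eval_mul, eval_X] at hQz
  have hz1 : z * conj z = 1 := by rw [Complex.mul_conj']; simp [hz]
  have hne := sub_ne_zero_of_mem_sphere ha hz
  have hne' : conj (z - a) ≠ 0 := (_root_.map_ne_zero _).2 hne
  have hne2 := one_sub_conj_mul_ne_zero ha hz.le
  have hg := geom_sum_eq (x := conj a * z) (fun h => hne2 (by rw [h]; ring)) M
  simp only [eval_mul, eval_X, eval_C, eval_finsetSum, eval_pow, ← mul_pow, hg]
  have hne3 : conj a * z - 1 ≠ 0 := fun h => hne2 (by linear_combination -h)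
  have hP : ((poissonKer a z : ℝ) : ℂ) = ((1 - ‖a‖ ^ 2 : ℝ) : ℂ) / ((z - a) * conj (z - a)) := by
    rw [poissonKer, Complex.mul_conj']; push_cast; ring
  rw [Complex.real_smul, hP, hQz]
  have : z * conj (z - a) = 1 - conj a * z := by rw [map_sub]; linear_combination hz1
  have h3 : z / (conj a * z - 1) = - (1 / conj (z - a)) := by
    rw [div_eq_iff hne3, show conj a * z - 1 = - (z * conj (z - a)) by rw [this]; ring]
    field_simp
  calc _ = (z / (conj a * z - 1)) * (Q.eval z * ((1 - ‖a‖ ^ 2 : ℝ) : ℂ) * ((conj a * z) ^ M - 1)) := by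
        ring
    _ = _ := by rw [h3]; field_simp; ring

lemma garsia_le_of_coeffPair_le {g : Polynomial ℂ} {D : ℝ} (hD0 : 0 ≤ D)
    (hD : ∀ p : Polynomial ℂ, ‖coeffPair p g.coeff‖ ≤ D * M1 p 1) {a : ℂ} (ha : ‖a‖ < 1) :
    garsia g a ≤ D ^ 2 := by
  have hP := continuousOn_poissonKer ha
  set m := Real.circleAverage (fun z => poissonKer a z * ‖g.eval z - g.eval a‖) 0 1 with hm
  set K := Real.circleAverage
    (fun z => poissonKer a z * (‖g.eval z - g.eval a‖ * ‖g.eval z‖)) 0 1 with hK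
  have key : ∀ M : ℕ, garsia g a ≤ D * ((1 + ‖a‖ ^ M) * m) + ‖a‖ ^ M * K := fun M => by
    obtain ⟨f, hf⟩ := exists_poly_eq_poissonKer_mul g ha M
    have h1 : M1 f 1 ≤ (1 + ‖a‖ ^ M) * m := by
      rw [M1, hm, ← circleAverage_const_mul]
      refine Real.circleAverage_mono ((continuous_norm_eval f).circleIntegrable' 0 1)
        (circleIntegrable_of_continuousOn_sphere (continuousOn_const.mul (hP.mul (by fun_prop))))
        fun z hz => ?_
      have hz : ‖z‖ = 1 := by simpa using hz
      rw [hf z hz, norm_smul, norm_mul, Real.norm_of_nonneg (poissonKer_nonneg ha z), mul_comm (1 + _),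
        mul_assoc]
      have : ‖1 - (conj a * z) ^ M‖ ≤ 1 + ‖a‖ ^ M := by
        refine (norm_sub_le _ _).trans ?_
        simp [hz]
      have := poissonKer_nonneg ha z
      gcongr
    have h2 : (garsia g a : ℂ) = coeffPair f g.coeff + Real.circleAverage (fun z =>
        poissonKer a z • ((g.eval z - g.eval a) * conj (g.eval z) * (conj a * z) ^ M)) 0 1 := by
      rw [← circleAverage_poissonKer_mul_conj g ha, ← circleAverage_eval_mul_conj,
        ← Real.circleAverage_fun_add]
      · refine Real.circleAverage_congr_sphere fun z hz => ?_
        simp only [hf z (by simpa using hz), Complex.real_smul]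
        ring
      · exact Continuous.circleIntegrable' (by fun_prop) _ _
      · exact circleIntegrable_of_continuousOn_sphere (hP.smul (by fun_prop))
    have h3 : ‖Real.circleAverage (fun z =>
        poissonKer a z • ((g.eval z - g.eval a) * conj (g.eval z) * (conj a * z) ^ M)) 0 1‖ ≤
        ‖a‖ ^ M * K := by
      refine (norm_circleAverage_le _ _ _).trans (le_of_eq ?_)
      rw [hK, ← circleAverage_const_mul]
      refine Real.circleAverage_congr_sphere fun z hz => ?_
      have hz : ‖z‖ = 1 := by simpa using hz
      simp only [norm_smul, norm_mul, norm_pow, RCLike.norm_conj, hz,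
        Real.norm_of_nonneg (poissonKer_nonneg ha z)]
      ring
    have h4 : garsia g a = ‖(garsia g a : ℂ)‖ := by
      rw [Complex.norm_real, Real.norm_of_nonneg (garsia_nonneg g ha)]
    rw [h4, h2]
    refine (norm_add_le _ _).trans (add_le_add ((hD f).trans ?_) h3)
    gcongr
  have hlim : Tendsto (fun M : ℕ => D * ((1 + ‖a‖ ^ M) * m) + ‖a‖ ^ M * K) atTop (nhds (D * m)) := by
    have h := tendsto_pow_atTop_nhds_zero_of_lt_one (norm_nonneg a) ha
    have := (((h.const_add 1).mul_const m).const_mul D).add (h.mul_const K)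
    simpa using this
  have h1 := ge_of_tendsto' hlim key
  have h2 : m ^ 2 ≤ garsia g a := circleAverage_poissonKer_mul_norm_sq_le g ha
  have h3 : 0 ≤ m := Real.circleAverage_nonneg_of_nonneg fun z _ =>
    mul_nonneg (poissonKer_nonneg ha z) (norm_nonneg _)
  have h4 : m ≤ D := by
    rcases h3.eq_or_lt with h | h
    · rwa [← h]
    · nlinarith
  nlinarith

/-- Mean over a circle of a `[0,∞]`-valued function. -/
def circleLAvg (r : ℝ) (φ : ℂ → ℝ≥0∞) : ℝ≥0∞ :=
  ENNReal.ofReal (1 / (2 * Real.pi)) * ∫⁻ θ in Ioo (0:ℝ) (2 * Real.pi), φ (circlePt r θ)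

lemma norm_circlePt {r : ℝ} (hr : 0 ≤ r) (θ : ℝ) : ‖circlePt r θ‖ = r := by
  simp [circlePt, Complex.norm_exp, abs_of_nonneg hr]

lemma circlePt_eq_circleMap (r θ : ℝ) : circlePt r θ = circleMap 0 r θ := by
  simp [circlePt, circleMap]

lemma circleLAvg_mono {r : ℝ} (hr : 0 ≤ r) {φ ψ : ℂ → ℝ≥0∞} (h : ∀ z, ‖z‖ = r → φ z ≤ ψ z) :
    circleLAvg r φ ≤ circleLAvg r ψ := by
  unfold circleLAvg
  gcongr
  exact h _ (norm_circlePt hr _)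

lemma circleLAvg_const (r : ℝ) (c : ℝ≥0∞) : circleLAvg r (fun _ => c) = c := by
  rw [circleLAvg, lintegral_const, Measure.restrict_apply_univ, Real.volume_Ioo, sub_zero,
    mul_comm c, ← mul_assoc, ← ENNReal.ofReal_mul (by positivity),
    one_div_mul_cancel (by positivity), ENNReal.ofReal_one, one_mul]

lemma circleLAvg_add_const (r : ℝ) (φ : ℂ → ℝ≥0∞) (c : ℝ≥0∞) :
    circleLAvg r (fun z => φ z + c) = circleLAvg r φ + c := by
  conv_rhs => rw [← circleLAvg_const r c]
  unfold circleLAvg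
  rw [lintegral_add_right _ measurable_const, mul_add]

lemma circleLAvg_const_mul (r : ℝ) (φ : ℂ → ℝ≥0∞) {c : ℝ≥0∞} (hc : c ≠ ⊤) :
    circleLAvg r (fun z => c * φ z) = c * circleLAvg r φ := by
  unfold circleLAvg
  rw [lintegral_const_mul' _ _ hc, mul_left_comm]

lemma circleLAvg_ofReal {r : ℝ} (hr : 0 ≤ r) {φ : ℂ → ℝ} (h0 : ∀ z, 0 ≤ φ z)
    (hc : ContinuousOn φ (Metric.sphere 0 r)) :
    circleLAvg r (fun z => ENNReal.ofReal (φ z)) = ENNReal.ofReal (Real.circleAverage φ 0 r) := by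
  have hi := hc.circleIntegrable hr
  have hi' : IntegrableOn (fun θ => φ (circleMap 0 r θ)) (Ioc 0 (2 * Real.pi)) :=
    (intervalIntegrable_iff_integrableOn_Ioc_of_le (by positivity)).1 hi
  rw [circleLAvg, Real.circleAverage, smul_eq_mul, ENNReal.ofReal_mul (by positivity), one_div,
    intervalIntegral.integral_of_le (by positivity),
    ofReal_integral_eq_lintegral_ofReal hi' (Eventually.of_forall fun _ => h0 _),
    setLIntegral_congr Ioo_ae_eq_Ioc]
  simp only [circlePt_eq_circleMap]

lemma MpE_eq_circleLAvg (p r : ℝ) (f : ℂ → ℂ) :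
    MpE p r f = circleLAvg r (fun z => ENNReal.ofReal (‖f z‖ ^ p)) ^ (1 / p) := rfl

lemma MpE_one_eq (r : ℝ) (f : ℂ → ℂ) :
    MpE 1 r f = circleLAvg r (fun z => ENNReal.ofReal ‖f z‖) := by
  simp [MpE_eq_circleLAvg]

lemma MpE_two_sq (r : ℝ) (f : ℂ → ℂ) :
    MpE 2 r f ^ 2 = circleLAvg r (fun z => ENNReal.ofReal (‖f z‖ ^ 2)) := by
  rw [MpE_eq_circleLAvg, ← ENNReal.rpow_two, ← ENNReal.rpow_mul]
  simp

/-- The norm of the functional `p ↦ ∑ p_k conj (b_k)` with respect to `M_1(1,·)`. -/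
def dualE (b : ℕ → ℂ) : ℝ≥0∞ :=
  ⨆ p : Polynomial ℂ, ⨆ _ : M1 p 1 ≤ 1, ENNReal.ofReal ‖coeffPair p b‖

lemma coeffPair_zero (b : ℕ → ℂ) : coeffPair 0 b = 0 := by simp [coeffPair]

lemma eq_zero_of_M1_eq_zero {p : Polynomial ℂ} (h : M1 p 1 = 0) : p = 0 := by
  ext k
  simpa [h] using norm_coeff_le_M1 p k

lemma ofReal_norm_coeffPair_le (p : Polynomial ℂ) (b : ℕ → ℂ) :
    ENNReal.ofReal ‖coeffPair p b‖ ≤ dualE b * ENNReal.ofReal (M1 p 1) := by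
  rcases (M1_nonneg p 1).eq_or_lt with h | h
  · simp [eq_zero_of_M1_eq_zero h.symm, coeffPair_zero]
  · have h1 : ENNReal.ofReal ‖coeffPair (C (((M1 p 1)⁻¹ : ℝ) : ℂ) * p) b‖ ≤ dualE b :=
      le_iSup₂_of_le (C (((M1 p 1)⁻¹ : ℝ) : ℂ) * p) (by
        rw [M1_C_mul, Complex.norm_real, Real.norm_of_nonneg (by positivity), inv_mul_cancel₀ h.ne'])
        le_rfl
    refine le_trans (le_of_eq ?_) (mul_le_mul_left h1 (ENNReal.ofReal (M1 p 1)))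
    rw [coeffPair_C_mul, norm_mul, Complex.norm_real, Real.norm_of_nonneg (by positivity),
      ← ENNReal.ofReal_mul (by positivity)]
    congr 1
    field_simp

lemma norm_coeffPair_le_toReal {b : ℕ → ℂ} (hb : dualE b ≠ ⊤) (p : Polynomial ℂ) :
    ‖coeffPair p b‖ ≤ (dualE b).toReal * M1 p 1 := by
  have h := ofReal_norm_coeffPair_le p b
  rw [← ENNReal.ofReal_toReal hb, ← ENNReal.ofReal_mul ENNReal.toReal_nonneg] at h
  exact (ENNReal.ofReal_le_ofReal_iff (mul_nonneg ENNReal.toReal_nonneg (M1_nonneg p 1))).1 h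

lemma dualE_le {b : ℕ → ℂ} {D : ℝ} (hD0 : 0 ≤ D) (hD : ∀ p, ‖coeffPair p b‖ ≤ D * M1 p 1) :
    dualE b ≤ ENNReal.ofReal D :=
  iSup₂_le fun p hp => ENNReal.ofReal_le_ofReal
    ((hD p).trans (mul_le_of_le_one_right hD0 hp))

lemma norm_coeffPair_le_tsum {b : ℕ → ℂ} (hb : Summable fun k => ‖b k‖) (p : Polynomial ℂ) :
    ‖coeffPair p b‖ ≤ (∑' k, ‖b k‖) * M1 p 1 := by
  refine (norm_sum_le _ _).trans ?_
  calc ∑ k ∈ p.support, ‖p.coeff k * conj (b k)‖ ≤ ∑ k ∈ p.support, ‖b k‖ * M1 p 1 := by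
        gcongr with k _
        rw [norm_mul, RCLike.norm_conj, mul_comm]
        gcongr
        exact norm_coeff_le_M1 p k
    _ ≤ _ := by
        rw [← Finset.sum_mul]
        have := M1_nonneg p 1
        gcongr
        exact hb.sum_le_tsum _ fun _ _ => norm_nonneg _

lemma dualE_ne_top {b : ℕ → ℂ} (hb : Summable fun k => ‖b k‖) : dualE b ≠ ⊤ :=
  ((dualE_le (tsum_nonneg fun _ => norm_nonneg _) (norm_coeffPair_le_tsum hb)).trans_lt
    ENNReal.ofReal_lt_top).ne

section truncation
variable {b : ℕ → ℂ} {F : ℂ → ℂ}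

/-- Partial sums of a power series, as polynomials. -/
def truncPoly (b : ℕ → ℂ) (N : ℕ) : Polynomial ℂ := ∑ k ∈ Finset.range N, monomial k (b k)

lemma coeff_truncPoly (b : ℕ → ℂ) (N k : ℕ) :
    (truncPoly b N).coeff k = if k < N then b k else 0 := by
  simp [truncPoly, coeff_monomial]

lemma eval_truncPoly (b : ℕ → ℂ) (N : ℕ) (z : ℂ) :
    (truncPoly b N).eval z = ∑ k ∈ Finset.range N, b k * z ^ k := by
  simp [truncPoly, eval_finsetSum]

/-- Tail of the series of absolute values. -/
def tailSum (b : ℕ → ℂ) (N : ℕ) : ℝ := ∑' k, ‖b (k + N)‖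

lemma tendsto_tailSum (b : ℕ → ℂ) : Tendsto (tailSum b) atTop (nhds 0) :=
  tendsto_sum_nat_add fun k => ‖b k‖

lemma tailSum_nonneg (b : ℕ → ℂ) (N : ℕ) : 0 ≤ tailSum b N := tsum_nonneg fun _ => norm_nonneg _

lemma norm_sub_eval_truncPoly_le (hb : Summable fun k => ‖b k‖)
    (hF : ∀ z : ℂ, ‖z‖ ≤ 1 → HasSum (fun k => b k * z ^ k) (F z)) (N : ℕ) {z : ℂ} (hz : ‖z‖ ≤ 1) :
    ‖F z - (truncPoly b N).eval z‖ ≤ tailSum b N := by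
  have h := (hasSum_nat_add_iff' N).2 (hF z hz)
  rw [eval_truncPoly, ← h.tsum_eq]
  refine tsum_of_norm_bounded ((summable_nat_add_iff N).2 hb).hasSum fun k => ?_
  rw [norm_mul, norm_pow]
  exact mul_le_of_le_one_right (norm_nonneg _) (pow_le_one₀ (norm_nonneg _) hz)

lemma norm_coeffPair_truncPoly_le (hb : Summable fun k => ‖b k‖) (p : Polynomial ℂ) (N : ℕ) :
    ‖coeffPair p (truncPoly b N).coeff‖ ≤ ((dualE b).toReal + tailSum b N) * M1 p 1 := by
  set c : ℕ → ℂ := fun k => if k < N then 0 else b k with hc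
  have hbc : b = (truncPoly b N).coeff + c := by
    ext k; simp only [Pi.add_apply, coeff_truncPoly, hc]; split_ifs <;> simp
  have hcs : Summable fun k => ‖c k‖ := by
    refine Summable.of_nonneg_of_le (fun _ => norm_nonneg _) (fun k => ?_) hb
    simp only [hc]; split_ifs <;> simp
  have hct : ∑' k, ‖c k‖ = tailSum b N := by
    rw [← hcs.sum_add_tsum_nat_add N, Finset.sum_eq_zero fun k hk => by
      simp [hc, Finset.mem_range.1 hk], zero_add, tailSum]
    simp [hc]
  have h1 := norm_coeffPair_le_toReal (dualE_ne_top hb) p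
  have h2 := norm_coeffPair_le_tsum hcs p
  rw [hct] at h2
  have h3 : coeffPair p (truncPoly b N).coeff = coeffPair p b - coeffPair p c := by
    conv_rhs => rw [hbc, coeffPair_add_right]
    ring
  rw [h3, add_mul]
  exact (norm_sub_le _ _).trans (add_le_add h1 h2)

lemma coeffPair_truncPoly (b : ℕ → ℂ) (p : Polynomial ℂ) {N : ℕ} (hN : p.natDegree < N) :
    coeffPair p (truncPoly b N).coeff = coeffPair p b := by
  refine Finset.sum_congr rfl fun k hk => ?_
  beta_reduce
  rw [coeff_truncPoly, if_pos ((le_natDegree_of_mem_supp k hk).trans_lt hN)]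

/-- Passing between a power series and its partial sums in the Garsia means. -/
lemma norm_sub_sq_le_two_mul {u v u' v' : ℂ} {t : ℝ} (hu : ‖u - u'‖ ≤ t) (hv : ‖v - v'‖ ≤ t) :
    ‖u - v‖ ^ 2 ≤ 2 * ‖u' - v'‖ ^ 2 + 8 * t ^ 2 := by
  have h : ‖u - v‖ ≤ ‖u' - v'‖ + 2 * t := by
    calc ‖u - v‖ = ‖(u' - v') + (u - u') - (v - v')‖ := by congr 1; ring
      _ ≤ ‖u' - v'‖ + ‖u - u'‖ + ‖v - v'‖ :=
        (norm_sub_le _ _).trans (by gcongr; exact norm_add_le _ _)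
      _ ≤ _ := by linarith
  have h2 : ‖u - v‖ ^ 2 ≤ (‖u' - v'‖ + 2 * t) ^ 2 := by gcongr
  nlinarith [sq_nonneg (‖u' - v'‖ - 2 * t)]

lemma garsia_truncPoly_le (hb : Summable fun k => ‖b k‖)
    (hF : ∀ z : ℂ, ‖z‖ ≤ 1 → HasSum (fun k => b k * z ^ k) (F z)) {S : ℝ} (hS : 0 ≤ S)
    {a : ℂ} (ha : ‖a‖ < 1)
    (h : ∀ r ∈ Ioo (0:ℝ) 1, MpE 2 r (fun z => F (mob a z) - F a) ≤ ENNReal.ofReal S) (N : ℕ) :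
    garsia (truncPoly b N) a ≤ 2 * S ^ 2 + 8 * tailSum b N ^ 2 := by
  refine le_of_tendsto (tendsto_circleAverage_mob (truncPoly b N) ha) ?_
  filter_upwards [Ioo_mem_nhdsLT (show (0:ℝ) < 1 by norm_num)] with r hr
  have hc : ContinuousOn (fun z => ‖(truncPoly b N).eval (mob a z) - (truncPoly b N).eval a‖ ^ 2)
      (Metric.sphere 0 r) := (continuousOn_norm_eval_mob_sub _ ha).mono
    (Metric.sphere_subset_closedBall.trans (Metric.closedBall_subset_closedBall hr.2.le))
  rw [← ENNReal.ofReal_le_ofReal_iff (by positivity),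
    ← circleLAvg_ofReal hr.1.le (fun _ => by positivity) hc]
  have h1 : MpE 2 r (fun z => F (mob a z) - F a) ^ 2 ≤ ENNReal.ofReal (S ^ 2) := by
    rw [ENNReal.ofReal_pow hS]
    gcongr
    exact h r hr
  rw [MpE_two_sq] at h1
  calc _ ≤ circleLAvg r (fun z => ENNReal.ofReal 2 * ENNReal.ofReal (‖F (mob a z) - F a‖ ^ 2) +
          ENNReal.ofReal (8 * tailSum b N ^ 2)) := by
        refine circleLAvg_mono hr.1.le fun z hz => ?_
        rw [← ENNReal.ofReal_mul (by norm_num), ← ENNReal.ofReal_add (by positivity) (by positivity)]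
        refine ENNReal.ofReal_le_ofReal (norm_sub_sq_le_two_mul ?_ ?_)
        · rw [norm_sub_rev]
          exact norm_sub_eval_truncPoly_le hb hF N (norm_mob_le ha (hz.le.trans hr.2.le))
        · rw [norm_sub_rev]
          exact norm_sub_eval_truncPoly_le hb hF N ha.le
    _ ≤ ENNReal.ofReal 2 * ENNReal.ofReal (S ^ 2) + ENNReal.ofReal (8 * tailSum b N ^ 2) := by
        rw [circleLAvg_add_const, circleLAvg_const_mul _ _ ENNReal.ofReal_ne_top]
        gcongr
    _ = _ := by
        rw [← ENNReal.ofReal_mul (by norm_num), ← ENNReal.ofReal_add (by positivity) (by positivity)]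

/-- Fefferman's theorem: the dual norm is dominated by the `BMOA` norm. -/
lemma dualE_le_BMOANormE (hb : Summable fun k => ‖b k‖)
    (hF : ∀ z : ℂ, ‖z‖ ≤ 1 → HasSum (fun k => b k * z ^ k) (F z)) :
    dualE b ≤ 8 * BMOANormE F := by
  by_cases htop : BMOANormE F = ⊤
  · rw [htop, ENNReal.mul_top (by norm_num)]; exact le_top
  set S := (⨆ a ∈ Metric.ball (0:ℂ) 1, ⨆ r ∈ Ioo (0:ℝ) 1,
      MpE 2 r (fun z => F ((a - z) / (1 - conj a * z)) - F a)) with hS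
  have hBS : BMOANormE F = ENNReal.ofReal ‖F 0‖ + S := rfl
  have hStop : S ≠ ⊤ := fun h => htop (by rw [hBS, h, add_top])
  set s := S.toReal
  have hs0 : 0 ≤ s := ENNReal.toReal_nonneg
  have hg : ∀ N, ∀ a : ℂ, ‖a‖ < 1 → garsia (truncPoly b N) a ≤ (2 * s + 4 * tailSum b N) ^ 2 := by
    intro N a ha
    have := garsia_truncPoly_le hb hF hs0 ha (fun r hr => by
      rw [ENNReal.ofReal_toReal hStop]
      exact le_iSup₂_of_le a (by simpa using ha) (le_iSup₂_of_le r hr le_rfl)) N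
    have ht := tailSum_nonneg b N
    nlinarith [mul_nonneg hs0 ht, sq_nonneg s, sq_nonneg (tailSum b N)]
  have hF0 : ∀ N, 0 < N → (truncPoly b N).eval 0 = F 0 := fun N hN => by
    have h0 := hF 0 (by simp)
    have h1 := hasSum_single (f := fun k => b k * (0:ℂ) ^ k) 0 (fun k hk => by simp [hk])
    rw [h0.unique h1, eval_truncPoly, Finset.sum_eq_single 0 (by
      intro k _ hk; simp [hk]) (by simp; omega)]
  have key : ∀ p, ‖coeffPair p b‖ ≤ (8 * s + ‖F 0‖) * M1 p 1 := fun p => by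
    have hlim : Tendsto (fun N => (4 * (2 * s + 4 * tailSum b N) + ‖F 0‖) * M1 p 1) atTop
        (nhds ((4 * (2 * s + 4 * 0) + ‖F 0‖) * M1 p 1)) :=
      (((((tendsto_tailSum b).const_mul 4).const_add _).const_mul 4).add_const _).mul_const _
    rw [show (8 * s + ‖F 0‖) * M1 p 1 = (4 * (2 * s + 4 * 0) + ‖F 0‖) * M1 p 1 by ring]
    refine ge_of_tendsto hlim ?_
    filter_upwards [eventually_gt_atTop p.natDegree] with N hN
    rw [← coeffPair_truncPoly b p hN, ← hF0 N (by omega)]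
    exact norm_coeffPair_le (by have := tailSum_nonneg b N; positivity) (hg N) p
  refine (dualE_le (by positivity) key).trans ?_
  rw [hBS, ENNReal.ofReal_add (by positivity) (norm_nonneg _), ENNReal.ofReal_mul (by norm_num),
    ENNReal.ofReal_toReal hStop, mul_add, add_comm]
  gcongr
  · exact le_mul_of_one_le_left (by simp) (by norm_num)
  · simp

/-- The `BMOA` norm is dominated by the dual norm. -/
lemma BMOANormE_le_dualE (hb : Summable fun k => ‖b k‖)
    (hF : ∀ z : ℂ, ‖z‖ ≤ 1 → HasSum (fun k => b k * z ^ k) (F z)) :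
    BMOANormE F ≤ 3 * dualE b := by
  have htop := dualE_ne_top hb
  set D := (dualE b).toReal with hD
  have hD0 : 0 ≤ D := ENNReal.toReal_nonneg
  have h0 : ‖F 0‖ ≤ D := by
    have h1 : coeffPair 1 b = conj (F 0) := by
      have h0 := hF 0 (by simp)
      have h1 := hasSum_single (f := fun k => b k * (0:ℂ) ^ k) 0 (fun k hk => by simp [hk])
      rw [h0.unique h1, ← C_1, ← monomial_zero_left, coeffPair_monomial]
      simp
    have h2 : M1 1 1 = 1 := by simp [M1, Real.circleAverage_const]
    have h := norm_coeffPair_le_toReal htop 1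
    rwa [h1, h2, RCLike.norm_conj, mul_one] at h
  have hg : ∀ N, ∀ a : ℂ, ‖a‖ < 1 → garsia (truncPoly b N) a ≤ (D + tailSum b N) ^ 2 :=
    fun N a ha => garsia_le_of_coeffPair_le (add_nonneg hD0 (tailSum_nonneg b N))
      (fun p => norm_coeffPair_truncPoly_le hb p N) ha
  have key : ∀ a : ℂ, ‖a‖ < 1 → ∀ r ∈ Ioo (0:ℝ) 1,
      MpE 2 r (fun z => F (mob a z) - F a) ≤ ENNReal.ofReal (2 * D) := by
    intro a ha r hr
    rw [← ENNReal.pow_le_pow_left_iff two_ne_zero, MpE_two_sq, ← ENNReal.ofReal_pow (by positivity)]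
    have hN : ∀ N, circleLAvg r (fun z => ENNReal.ofReal (‖F (mob a z) - F a‖ ^ 2)) ≤
        ENNReal.ofReal (2 * (D + tailSum b N) ^ 2 + 8 * tailSum b N ^ 2) := fun N => by
      have hc : ContinuousOn
          (fun z => ‖(truncPoly b N).eval (mob a z) - (truncPoly b N).eval a‖ ^ 2)
          (Metric.sphere 0 r) := (continuousOn_norm_eval_mob_sub _ ha).mono
        (Metric.sphere_subset_closedBall.trans (Metric.closedBall_subset_closedBall hr.2.le))
      calc _ ≤ circleLAvg r (fun z => ENNReal.ofReal 2 * ENNReal.ofReal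
              (‖(truncPoly b N).eval (mob a z) - (truncPoly b N).eval a‖ ^ 2) +
              ENNReal.ofReal (8 * tailSum b N ^ 2)) := by
            refine circleLAvg_mono hr.1.le fun z hz => ?_
            rw [← ENNReal.ofReal_mul (by norm_num),
              ← ENNReal.ofReal_add (by positivity) (by positivity)]
            exact ENNReal.ofReal_le_ofReal (norm_sub_sq_le_two_mul
              (norm_sub_eval_truncPoly_le hb hF N (norm_mob_le ha (hz.le.trans hr.2.le)))
              (norm_sub_eval_truncPoly_le hb hF N ha.le))
        _ ≤ ENNReal.ofReal 2 * ENNReal.ofReal ((D + tailSum b N) ^ 2) +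
              ENNReal.ofReal (8 * tailSum b N ^ 2) := by
            rw [circleLAvg_add_const, circleLAvg_const_mul _ _ ENNReal.ofReal_ne_top,
              circleLAvg_ofReal hr.1.le (fun _ => by positivity) hc]
            gcongr
            exact (circleAverage_mob_le_garsia _ ha hr.1.le hr.2.le).trans (hg N a ha)
        _ = _ := by
            rw [← ENNReal.ofReal_mul (by norm_num),
              ← ENNReal.ofReal_add (by positivity) (by positivity)]
    have ht := tendsto_tailSum b
    have hlim : Tendsto (fun N => ENNReal.ofReal (2 * (D + tailSum b N) ^ 2 + 8 * tailSum b N ^ 2))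
        atTop (nhds (ENNReal.ofReal (2 * (D + 0) ^ 2 + 8 * 0 ^ 2))) :=
      ENNReal.tendsto_ofReal ((((ht.const_add D).pow 2).const_mul 2).add ((ht.pow 2).const_mul 8))
    refine (ge_of_tendsto' hlim hN).trans (ENNReal.ofReal_le_ofReal ?_)
    nlinarith
  have hS : (⨆ a ∈ Metric.ball (0:ℂ) 1, ⨆ r ∈ Ioo (0:ℝ) 1,
      MpE 2 r (fun z => F ((a - z) / (1 - conj a * z)) - F a)) ≤ ENNReal.ofReal (2 * D) :=
    iSup₂_le fun a ha => iSup₂_le fun r hr => key a (by simpa using ha) r hr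
  calc BMOANormE F ≤ ENNReal.ofReal D + ENNReal.ofReal (2 * D) :=
        add_le_add (ENNReal.ofReal_le_ofReal h0) hS
    _ = ENNReal.ofReal (3 * D) := by
        rw [← ENNReal.ofReal_add hD0 (by positivity)]; congr 1; ring
    _ = 3 * dualE b := by
        rw [ENNReal.ofReal_mul (by norm_num), ENNReal.ofReal_toReal htop]; simp
end truncation

/-- Moments with natural exponents. -/
def natMoment (ω : ℝ → ℝ) (n : ℕ) : ℝ := ∫ r in Ioo (0:ℝ) 1, r ^ n * ω r

lemma momentCoeff_eq (ω : ℝ → ℝ) (k : ℕ) : momentCoeff ω k = natMoment ω (2 * k + 1) := by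
  rw [momentCoeff, momentW, intervalIntegral.integral_of_le zero_le_one, integral_Ioc_eq_integral_Ioo,
    natMoment]
  refine integral_congr_ae (Eventually.of_forall fun r => ?_)
  have h : (2 * (k:ℝ) + 1) = ((2 * k + 1 : ℕ) : ℝ) := by push_cast; ring
  beta_reduce
  rw [h, Real.rpow_natCast]

section Weight

variable {ω : ℝ → ℝ}

lemma IsRadialWeight.integrableOn_Ioo (hω : IsRadialWeight ω) : IntegrableOn ω (Ioo 0 1) :=
  hω.2.mono_set Ioo_subset_Ico_self

lemma IsRadialWeight.integrableOn_pow_mul (hω : IsRadialWeight ω) (n : ℕ) :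
    IntegrableOn (fun r => r ^ n * ω r) (Ioo 0 1) := by
  refine Integrable.bdd_mul (c := 1) hω.integrableOn_Ioo (by fun_prop) ?_
  filter_upwards [ae_restrict_mem measurableSet_Ioo] with r hr
  rw [norm_pow, Real.norm_of_nonneg hr.1.le]
  exact pow_le_one₀ hr.1.le hr.2.le

lemma omegaHat_eq {r : ℝ} (hr : r ≤ 1) : omegaHat ω r = ∫ s in Ioo r 1, ω s := by
  rw [omegaHat, intervalIntegral.integral_of_le hr, integral_Ioc_eq_integral_Ioo]

lemma IsRadialWeight.omegaHat_nonneg (hω : IsRadialWeight ω) {r : ℝ} (h0 : 0 ≤ r) (h1 : r ≤ 1) :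
    0 ≤ omegaHat ω r := by
  rw [omegaHat_eq h1]
  exact setIntegral_nonneg measurableSet_Ioo fun s hs => hω.1 s ⟨h0.trans hs.1.le, hs.2⟩

lemma IsRadialWeight.omegaHat_anti (hω : IsRadialWeight ω) {r s : ℝ} (h0 : 0 ≤ r) (hrs : r ≤ s)
    (h1 : s ≤ 1) : omegaHat ω s ≤ omegaHat ω r := by
  rw [omegaHat_eq h1, omegaHat_eq (hrs.trans h1)]
  refine setIntegral_mono_set (hω.2.mono_set fun x hx => ⟨h0.trans hx.1.le, hx.2⟩) ?_
    (Ioo_subset_Ioo_left hrs).eventuallyLE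
  filter_upwards [ae_restrict_mem measurableSet_Ioo] with x hx
  exact hω.1 x ⟨h0.trans hx.1.le, hx.2⟩

lemma IsRadialWeight.continuousOn_omegaHat (hω : IsRadialWeight ω) :
    ContinuousOn (omegaHat ω) (Icc 0 1) := by
  have h := intervalIntegral.continuousOn_primitive_interval_left (f := ω) (a := 0) (b := 1)
    (μ := volume) (by
      rw [uIcc_of_le zero_le_one, integrableOn_Icc_iff_integrableOn_Ico]
      exact hω.2)
  rwa [uIcc_of_le zero_le_one] at h

lemma IsRadialWeight.natMoment_anti (hω : IsRadialWeight ω) : Antitone (natMoment ω) := by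
  intro m n hmn
  refine setIntegral_mono_on (hω.integrableOn_pow_mul n) (hω.integrableOn_pow_mul m)
    measurableSet_Ioo fun r hr => ?_
  exact mul_le_mul_of_nonneg_right (pow_le_pow_of_le_one hr.1.le hr.2.le hmn)
    (hω.1 r ⟨hr.1.le, hr.2⟩)

lemma IsRadialWeight.pow_mul_omegaHat_le (hω : IsRadialWeight ω) {r : ℝ} (hr : r ∈ Ico (0:ℝ) 1)
    (n : ℕ) : r ^ n * omegaHat ω r ≤ natMoment ω n := by
  have hsub : Ioo r 1 ⊆ Ioo 0 1 := Ioo_subset_Ioo_left hr.1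
  rw [omegaHat_eq hr.2.le, ← integral_const_mul]
  calc ∫ s in Ioo r 1, r ^ n * ω s ≤ ∫ s in Ioo r 1, s ^ n * ω s := by
        refine setIntegral_mono_on ((hω.integrableOn_Ioo.mono_set hsub).const_mul _)
          ((hω.integrableOn_pow_mul n).mono_set hsub) measurableSet_Ioo fun s hs => ?_
        exact mul_le_mul_of_nonneg_right (pow_le_pow_left₀ hr.1 hs.1.le n)
          (hω.1 s ⟨hr.1.trans hs.1.le, hs.2⟩)
    _ ≤ natMoment ω n := by
        refine setIntegral_mono_set (hω.integrableOn_pow_mul n) ?_ hsub.eventuallyLE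
        filter_upwards [ae_restrict_mem measurableSet_Ioo] with x hx
        exact mul_nonneg (pow_nonneg hx.1.le n) (hω.1 x ⟨hx.1.le, hx.2⟩)

lemma IsRadialWeight.natMoment_pos (hω : IsRadialWeight ω)
    (hpos : ∀ r ∈ Ico (0:ℝ) 1, 0 < omegaHat ω r) (n : ℕ) : 0 < natMoment ω n :=
  lt_of_lt_of_le (mul_pos (by positivity) (hpos (1 / 2) (by norm_num)))
    (hω.pow_mul_omegaHat_le (r := 1 / 2) (by norm_num) n)

/-- Integration by parts (layer-cake form) for the moments. -/
lemma IsRadialWeight.natMoment_succ (hω : IsRadialWeight ω) (n : ℕ) :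
    natMoment ω (n + 1) = (n + 1) * ∫ t in Ioo (0:ℝ) 1, t ^ n * omegaHat ω t := by
  have hcont : IntegrableOn (fun t => t ^ n * omegaHat ω t) (Ioo 0 1) :=
    ((by fun_prop : Continuous fun t : ℝ => t ^ n).continuousOn.mul
      hω.continuousOn_omegaHat).integrableOn_Icc.mono_set Ioo_subset_Icc_self
  have hn0 : ∀ᵐ t ∂(volume.restrict (Ioo (0:ℝ) 1)), 0 ≤ t ^ n * omegaHat ω t := by
    filter_upwards [ae_restrict_mem measurableSet_Ioo] with x hx
    exact mul_nonneg (pow_nonneg hx.1.le n) (hω.omegaHat_nonneg hx.1.le hx.2.le)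
  have hm0 : ∀ᵐ t ∂(volume.restrict (Ioo (0:ℝ) 1)), 0 ≤ t ^ (n + 1) * ω t := by
    filter_upwards [ae_restrict_mem measurableSet_Ioo] with x hx
    exact mul_nonneg (pow_nonneg hx.1.le _) (hω.1 x ⟨hx.1.le, hx.2⟩)
  have hωm : AEMeasurable (fun r => ENNReal.ofReal (ω r)) (volume.restrict (Ioo (0:ℝ) 1)) :=
    hω.integrableOn_Ioo.aestronglyMeasurable.aemeasurable.ennreal_ofReal
  set ν : Measure ℝ := (volume.restrict (Ioo (0:ℝ) 1)).withDensity fun r => ENNReal.ofReal (ω r)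
    with hν
  have hν0 : ∀ᵐ r ∂ν, r ∈ Ioo (0:ℝ) 1 :=
    (withDensity_absolutelyContinuous _ _).ae_le (ae_restrict_mem measurableSet_Ioo)
  have hlc := lintegral_rpow_eq_lintegral_meas_lt_mul ν (f := fun r : ℝ => r)
    (hν0.mono fun r hr => hr.1.le) aemeasurable_id (p := (n:ℝ) + 1) (by positivity)
  have hleft : ∫⁻ r, ENNReal.ofReal (r ^ ((n:ℝ) + 1)) ∂ν = ENNReal.ofReal (natMoment ω (n + 1)) := by
    rw [hν, lintegral_withDensity_eq_lintegral_mul₀ hωm (by fun_prop), natMoment,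
      ofReal_integral_eq_lintegral_ofReal (hω.integrableOn_pow_mul _) hm0]
    refine setLIntegral_congr_fun measurableSet_Ioo fun r hr => ?_
    simp only [Pi.mul_apply]
    rw [mul_comm (r ^ (n + 1)), ENNReal.ofReal_mul (hω.1 r ⟨hr.1.le, hr.2⟩)]
    congr 2
    exact_mod_cast Real.rpow_natCast r (n + 1)
  have hmeas : ∀ t ∈ Ioi (0:ℝ), ν {a | t < a} * ENNReal.ofReal (t ^ ((n:ℝ) + 1 - 1))
      = (Ioo (0:ℝ) 1).indicator (fun t => ENNReal.ofReal (t ^ n * omegaHat ω t)) t := by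
    intro t ht
    have hset : {a : ℝ | t < a} = Ioi t := rfl
    rw [hset, hν, withDensity_apply _ measurableSet_Ioi, Measure.restrict_restrict measurableSet_Ioi]
    by_cases h1 : t < 1
    · have hI : Ioi t ∩ Ioo 0 1 = Ioo t 1 := by
        ext x
        simp only [mem_inter_iff, mem_Ioi, mem_Ioo]
        have := mem_Ioi.1 ht
        constructor
        · rintro ⟨a, b, c⟩; exact ⟨a, c⟩
        · rintro ⟨a, b⟩; exact ⟨a, this.trans a, b⟩
      rw [indicator_of_mem (show t ∈ Ioo (0:ℝ) 1 from ⟨ht, h1⟩), hI, mul_comm,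
        ENNReal.ofReal_mul (pow_nonneg (le_of_lt ht) n), omegaHat_eq h1.le,
        ofReal_integral_eq_lintegral_ofReal]
      · congr 2
        rw [add_sub_cancel_right]
        exact_mod_cast Real.rpow_natCast t n
      · exact hω.integrableOn_Ioo.mono_set (Ioo_subset_Ioo_left (le_of_lt ht))
      · filter_upwards [ae_restrict_mem measurableSet_Ioo] with x hx
        exact hω.1 x ⟨(lt_trans ht hx.1).le, hx.2⟩
    · have hI : Ioi t ∩ Ioo 0 1 = ∅ := by
        ext x
        simp only [mem_inter_iff, mem_Ioi, mem_Ioo, mem_empty_iff_false, iff_false]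
        rintro ⟨a, b, c⟩
        exact h1 (a.trans c)
      rw [hI, indicator_of_notMem (fun h => h1 h.2)]
      simp
  rw [hleft, setLIntegral_congr_fun measurableSet_Ioi hmeas,
    setLIntegral_indicator measurableSet_Ioo, inter_eq_left.2 (fun x hx => hx.1),
    ← ofReal_integral_eq_lintegral_ofReal hcont hn0, ← ENNReal.ofReal_mul (by positivity)] at hlc
  refine (ENNReal.ofReal_eq_ofReal_iff (integral_nonneg_of_ae hm0)
    (mul_nonneg (by positivity) (integral_nonneg_of_ae hn0))).1 hlc

/-- Doubling of the moments of a weight in `D̂`. -/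
lemma IsRadialWeight.natMoment_doubling (hω : IsRadialWeight ω) {C : ℝ} (hC0 : 0 < C)
    (hC : ∀ r ∈ Ico (0:ℝ) 1, omegaHat ω r ≤ C * omegaHat ω ((1 + r) / 2)) (j : ℕ) :
    natMoment ω (j + 1) ≤ 2 * C * natMoment ω (2 * j + 1) := by
  have hint : ∀ m : ℕ, ContinuousOn (fun t => t ^ m * omegaHat ω t) (Icc 0 1) := fun m =>
    (by fun_prop : Continuous fun t : ℝ => t ^ m).continuousOn.mul hω.continuousOn_omegaHat
  have hΩ : ContinuousOn (fun u => (2 * u - 1) ^ j * omegaHat ω u) (Icc (1 / 2) 1) :=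
    (by fun_prop : Continuous fun t : ℝ => (2 * t - 1) ^ j).continuousOn.mul
      (hω.continuousOn_omegaHat.mono (Icc_subset_Icc_left (by norm_num)))
  have hcomp : ContinuousOn (fun t => t ^ j * omegaHat ω ((1 + t) / 2)) (Icc 0 1) :=
    (by fun_prop : Continuous fun t : ℝ => t ^ j).continuousOn.mul
      (hω.continuousOn_omegaHat.comp (by fun_prop) fun t ht =>
        ⟨by linarith [ht.1], by linarith [ht.2]⟩)
  have e1 : ∫ t in Ioo (0:ℝ) 1, t ^ j * omegaHat ω t
      ≤ ∫ t in Ioo (0:ℝ) 1, C * (t ^ j * omegaHat ω ((1 + t) / 2)) := by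
    refine setIntegral_mono_on ((hint j).integrableOn_Icc.mono_set Ioo_subset_Icc_self)
      ((hcomp.integrableOn_Icc.mono_set Ioo_subset_Icc_self).const_mul C)
      measurableSet_Ioo fun t ht => ?_
    have := mul_le_mul_of_nonneg_left (hC t ⟨ht.1.le, ht.2⟩) (pow_nonneg ht.1.le j)
    linarith
  have e2 : ∫ t in Ioo (0:ℝ) 1, t ^ j * omegaHat ω ((1 + t) / 2)
      = 2 * ∫ u in Ioo (1 / 2 : ℝ) 1, (2 * u - 1) ^ j * omegaHat ω u := by
    rw [← integral_Ioc_eq_integral_Ioo, ← integral_Ioc_eq_integral_Ioo,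
      ← intervalIntegral.integral_of_le zero_le_one,
      ← intervalIntegral.integral_of_le (by norm_num)]
    have := intervalIntegral.integral_comp_div_add (a := 0) (b := 1)
      (fun u => (2 * u - 1) ^ j * omegaHat ω u) (c := 2) two_ne_zero (1 / 2)
    rw [smul_eq_mul] at this
    norm_num at this ⊢
    rw [← this]
    refine intervalIntegral.integral_congr fun t _ => ?_
    congr 2 <;> ring
  have e3 : ∫ u in Ioo (1 / 2 : ℝ) 1, (2 * u - 1) ^ j * omegaHat ω u
      ≤ ∫ u in Ioo (0 : ℝ) 1, u ^ (2 * j) * omegaHat ω u := by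
    have hs : Ioo (1 / 2 : ℝ) 1 ⊆ Ioo 0 1 := Ioo_subset_Ioo_left (by norm_num)
    calc _ ≤ ∫ u in Ioo (1 / 2 : ℝ) 1, u ^ (2 * j) * omegaHat ω u := by
          refine setIntegral_mono_on (hΩ.integrableOn_Icc.mono_set Ioo_subset_Icc_self)
            (((hint (2 * j)).integrableOn_Icc.mono_set Ioo_subset_Icc_self).mono_set hs)
            measurableSet_Ioo fun u hu => ?_
          refine mul_le_mul_of_nonneg_right ?_
            (hω.omegaHat_nonneg (by linarith [hu.1]) hu.2.le)
          rw [pow_mul]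
          exact pow_le_pow_left₀ (by linarith [hu.1]) (by nlinarith [sq_nonneg (u - 1)]) j
      _ ≤ _ := by
          refine setIntegral_mono_set ((hint (2 * j)).integrableOn_Icc.mono_set Ioo_subset_Icc_self)
            ?_ hs.eventuallyLE
          filter_upwards [ae_restrict_mem measurableSet_Ioo] with x hx
          exact mul_nonneg (pow_nonneg hx.1.le _) (hω.omegaHat_nonneg hx.1.le hx.2.le)
  have hI : 0 ≤ ∫ u in Ioo (0 : ℝ) 1, u ^ (2 * j) * omegaHat ω u :=
    setIntegral_nonneg measurableSet_Ioo fun x hx =>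
      mul_nonneg (pow_nonneg hx.1.le _) (hω.omegaHat_nonneg hx.1.le hx.2.le)
  rw [integral_const_mul, e2] at e1
  rw [hω.natMoment_succ j, hω.natMoment_succ (2 * j)]
  set I := ∫ u in Ioo (0 : ℝ) 1, u ^ (2 * j) * omegaHat ω u
  calc ((j:ℝ) + 1) * ∫ t in Ioo (0:ℝ) 1, t ^ j * omegaHat ω t
      ≤ (j + 1) * (C * (2 * I)) := by
        refine mul_le_mul_of_nonneg_left (e1.trans ?_) (by positivity)
        gcongr
    _ ≤ 2 * C * ((2 * j + 1) * I) := by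
        have : 0 ≤ C * I * j := by positivity
        nlinarith
    _ = _ := by push_cast; ring

lemma succ_mul_pow_mul_one_sub_le {r : ℝ} (h0 : 0 ≤ r) (h1 : r ≤ 1) (j : ℕ) :
    (j + 1) * (r ^ j * (1 - r)) ≤ 1 := by
  have h : ((j:ℝ) + 1) * r ^ j ≤ ∑ i ∈ Finset.range (j + 1), r ^ i := by
    calc ((j:ℝ) + 1) * r ^ j = ∑ i ∈ Finset.range (j + 1), r ^ j := by simp
      _ ≤ _ := Finset.sum_le_sum fun i hi =>
        pow_le_pow_of_le_one h0 h1 (Nat.lt_succ_iff.1 (Finset.mem_range.1 hi))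
  have h2 := geom_sum_mul_neg r (j + 1)
  have h3 := mul_le_mul_of_nonneg_right h (sub_nonneg.2 h1)
  have := pow_nonneg h0 (j + 1)
  linarith

lemma IsRadialWeight.succ_mul_natMoment_sub_le (hω : IsRadialWeight ω) {C : ℝ} (hC0 : 0 < C)
    (hC : ∀ r ∈ Ico (0:ℝ) 1, omegaHat ω r ≤ C * omegaHat ω ((1 + r) / 2)) (j : ℕ) :
    (j + 1) * (natMoment ω (2 * j + 1) - natMoment ω (2 * (j + 2) + 1))
      ≤ 8 * C * natMoment ω (2 * j + 1) := by
  have h : (j + 1) * (natMoment ω (2 * j + 1) - natMoment ω (2 * (j + 2) + 1))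
      ≤ 4 * natMoment ω (j + 1) := by
    unfold natMoment
    rw [← integral_sub (hω.integrableOn_pow_mul _) (hω.integrableOn_pow_mul _),
      ← integral_const_mul, ← integral_const_mul]
    refine setIntegral_mono_on (((hω.integrableOn_pow_mul _).sub (hω.integrableOn_pow_mul _)).const_mul _)
      ((hω.integrableOn_pow_mul _).const_mul _) measurableSet_Ioo fun r hr => ?_
    have hr0 := hr.1.le
    have h1 := succ_mul_pow_mul_one_sub_le hr0 hr.2.le j
    have h4 : (1 + r) * (1 + r ^ 2) ≤ 4 := by nlinarith [hr.1, hr.2]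
    have hw := hω.1 r ⟨hr.1.le, hr.2⟩
    have hp : 0 ≤ r ^ (j + 1) * ω r := mul_nonneg (pow_nonneg hr0 _) hw
    have h5 : ((j:ℝ) + 1) * (r ^ j * (1 - r)) * ((1 + r) * (1 + r ^ 2)) ≤ 1 * 4 :=
      mul_le_mul h1 h4 (by positivity) zero_le_one
    calc _ = ((j:ℝ) + 1) * (r ^ j * (1 - r)) * ((1 + r) * (1 + r ^ 2)) * (r ^ (j + 1) * ω r) := by
          ring
      _ ≤ 1 * 4 * (r ^ (j + 1) * ω r) := mul_le_mul_of_nonneg_right h5 hp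
      _ = _ := by ring
  linarith [hω.natMoment_doubling hC0 hC j]

lemma IsRadialWeight.natMoment_convex (hω : IsRadialWeight ω) (j : ℕ) :
    2 * natMoment ω (2 * (j + 1) + 1)
      ≤ natMoment ω (2 * j + 1) + natMoment ω (2 * (j + 2) + 1) := by
  unfold natMoment
  rw [← integral_add (hω.integrableOn_pow_mul _) (hω.integrableOn_pow_mul _),
      ← integral_const_mul]
  refine setIntegral_mono_on ((hω.integrableOn_pow_mul _).const_mul _)
    ((hω.integrableOn_pow_mul _).add (hω.integrableOn_pow_mul _)) measurableSet_Ioo fun r hr => ?_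
  have : 0 ≤ r ^ (2 * j + 1) * ω r * (1 - r ^ 2) ^ 2 :=
    mul_nonneg (mul_nonneg (pow_nonneg hr.1.le _) (hω.1 r ⟨hr.1.le, hr.2⟩)) (sq_nonneg _)
  have e : r ^ (2 * j + 1) * ω r + r ^ (2 * (j + 2) + 1) * ω r - 2 * (r ^ (2 * (j + 1) + 1) * ω r)
      = r ^ (2 * j + 1) * ω r * (1 - r ^ 2) ^ 2 := by ring
  linarith

end Weight

section Multiplier

variable {ω : ℝ → ℝ}

/-- The multiplier sequence `s^j / ω_{2j+1}`. -/
def mulSeq (ω : ℝ → ℝ) (s : ℝ) (j : ℕ) : ℝ := s ^ j / natMoment ω (2 * j + 1)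

/-- Second differences. -/
def secondDiff (a : ℕ → ℝ) (j : ℕ) : ℝ := a j - 2 * a (j + 1) + a (j + 2)

lemma IsRadialWeight.pow_div_natMoment_le (hω : IsRadialWeight ω)
    (hpos : ∀ r ∈ Ico (0:ℝ) 1, 0 < omegaHat ω r) {C : ℝ} (hC0 : 0 < C)
    (hC : ∀ r ∈ Ico (0:ℝ) 1, omegaHat ω r ≤ C * omegaHat ω ((1 + r) / 2))
    {s : ℝ} (hs : s ∈ Ico (0:ℝ) 1) (j : ℕ) :
    s ^ j / natMoment ω (2 * (j + 2) + 1) ≤ 5 * C ^ 2 / omegaHat ω s * ((3 + s) / 4) ^ j := by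
  set t := (3 + s) / 4 with ht
  have ht0 : 3 / 4 ≤ t := by rw [ht]; linarith [hs.1]
  have ht1 : t < 1 := by rw [ht]; linarith [hs.2]
  have htpos : 0 < t := by linarith
  have h1 : omegaHat ω s ≤ C ^ 2 * omegaHat ω t := by
    have a := hC s hs
    have b := hC ((1 + s) / 2) ⟨by linarith [hs.1], by linarith [hs.2]⟩
    have e : (1 + (1 + s) / 2) / 2 = t := by rw [ht]; ring
    rw [e] at b
    nlinarith
  have h2 := hω.pow_mul_omegaHat_le (r := t) ⟨htpos.le, ht1⟩ (2 * (j + 2) + 1)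
  have hst : s ≤ t ^ 4 := by
    have := one_add_mul_le_pow (a := t - 1) (by linarith) 4
    norm_num at this
    have e : 1 + 4 * (t - 1) = s := by rw [ht]; ring
    linarith
  have hsj : s ^ j ≤ t ^ (2 * j) * t ^ (2 * j) := by
    calc s ^ j ≤ (t ^ 4) ^ j := pow_le_pow_left₀ hs.1 hst j
      _ = _ := by rw [← pow_mul, ← pow_add]; congr 1; ring
  have ht2j : t ^ (2 * j) ≤ t ^ j := pow_le_pow_of_le_one htpos.le ht1.le (by omega)
  have h5 : 1 ≤ 5 * t ^ 5 := by
    have : (3 / 4 : ℝ) ^ 5 ≤ t ^ 5 := pow_le_pow_left₀ (by norm_num) ht0 5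
    norm_num at this
    linarith
  have hω0 := hpos s hs
  have hΩ := hpos t ⟨htpos.le, ht1⟩
  rw [div_le_iff₀ (hω.natMoment_pos hpos _), div_mul_eq_mul_div, div_mul_eq_mul_div,
    le_div_iff₀ hω0]
  calc s ^ j * omegaHat ω s ≤ (t ^ (2 * j) * t ^ (2 * j)) * (C ^ 2 * omegaHat ω t) := by gcongr
    _ ≤ (t ^ j * t ^ (2 * j)) * (C ^ 2 * omegaHat ω t) * (5 * t ^ 5) := by
        refine le_trans (by gcongr) (le_mul_of_one_le_right (by positivity) h5)
    _ = 5 * C ^ 2 * t ^ j * (t ^ (2 * (j + 2) + 1) * omegaHat ω t) := by ring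
    _ ≤ _ := by gcongr

lemma secondDiff_inv_le {a b c : ℝ} (ha : 0 < a) (hb : 0 < b) (hc : 0 < c) (h : 2 * b ≤ a + c) :
    1 / a - 2 * (1 / b) + 1 / c ≤ (a - c) ^ 2 / (a * c * (a + c)) := by
  have h1 : 2 / (a + c) ≤ 1 / b := by
    rw [div_le_div_iff₀ (by positivity) hb]; linarith
  have h2 : (a - c) ^ 2 / (a * c * (a + c)) = 1 / a - 2 * (2 / (a + c)) + 1 / c := by
    field_simp; ring
  rw [h2]; linarith

lemma mul_le_of_doubling {a c D n : ℝ} (ha : 0 < a) (hc : 0 < c) (hD : 0 ≤ D) (hca : c ≤ a)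
    (h : n * (a - c) ≤ D * a) :
    n * ((a - c) ^ 2 / (a * c * (a + c))) ≤ D * (1 / c - 1 / a) := by
  have e : D * (1 / c - 1 / a) = D * (a + c) * (a - c) / (a * c * (a + c)) := by
    field_simp
  rw [e, ← mul_div_assoc]
  refine div_le_div_of_nonneg_right ?_ (by positivity)
  have : n * (a - c) * (a - c) ≤ D * a * (a - c) :=
    mul_le_mul_of_nonneg_right h (sub_nonneg.2 hca)
  nlinarith [mul_nonneg (mul_nonneg hD hc.le) (sub_nonneg.2 hca)]

lemma sum_pow_le_of_lt_one {t : ℝ} (h0 : 0 ≤ t) (h1 : t < 1) (J : ℕ) :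
    ∑ j ∈ Finset.range J, t ^ j ≤ (1 - t)⁻¹ := by
  rw [← tsum_geometric_of_lt_one h0 h1]
  exact (summable_geometric_of_lt_one h0 h1).sum_le_tsum _ fun j _ => pow_nonneg h0 j

lemma sum_succ_mul_pow_le {t : ℝ} (h0 : 0 ≤ t) (h1 : t < 1) (J : ℕ) :
    ∑ j ∈ Finset.range J, ((j:ℝ) + 1) * t ^ j ≤ ((1 - t) ^ 2)⁻¹ := by
  have h : (1 - t) * ∑ j ∈ Finset.range J, ((j:ℝ) + 1) * t ^ j
      = ∑ j ∈ Finset.range J, t ^ j - J * t ^ J := by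
    induction J with
    | zero => simp
    | succ J ih =>
      rw [Finset.sum_range_succ, Finset.sum_range_succ, mul_add, ih]
      push_cast; ring
  have h2 := sum_pow_le_of_lt_one h0 h1 J
  have h3 : 0 < 1 - t := by linarith
  rw [← one_div, le_div_iff₀ (by positivity)]
  have h4 : (1 - t) * (1 - t)⁻¹ = 1 := mul_inv_cancel₀ h3.ne'
  have h5 : 0 ≤ J * t ^ J := by positivity
  calc _ = (1 - t) * ((1 - t) * ∑ j ∈ Finset.range J, ((j:ℝ) + 1) * t ^ j) := by ring
    _ ≤ (1 - t) * (1 - t)⁻¹ := by rw [h]; gcongr; linarith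
    _ = 1 := h4

lemma sum_mul_secondDiff (a : ℕ → ℝ) (k m : ℕ) :
    ∑ j ∈ Finset.range m, ((j:ℝ) + 1) * secondDiff a (k + j)
      = a k - (m * (a (k + m) - a (k + m + 1)) + a (k + m)) := by
  induction m with
  | zero => simp
  | succ m ih =>
    rw [Finset.sum_range_succ, ih]
    simp only [secondDiff, ← add_assoc]
    push_cast; ring

lemma IsRadialWeight.mulSeq_nonneg (hω : IsRadialWeight ω)
    (hpos : ∀ r ∈ Ico (0:ℝ) 1, 0 < omegaHat ω r) {s : ℝ} (hs : 0 ≤ s) (j : ℕ) :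
    0 ≤ mulSeq ω s j :=
  div_nonneg (pow_nonneg hs j) (hω.natMoment_pos hpos _).le

lemma IsRadialWeight.tendsto_mul_mulSeq (hω : IsRadialWeight ω)
    (hpos : ∀ r ∈ Ico (0:ℝ) 1, 0 < omegaHat ω r) {C : ℝ} (hC0 : 0 < C)
    (hC : ∀ r ∈ Ico (0:ℝ) 1, omegaHat ω r ≤ C * omegaHat ω ((1 + r) / 2))
    {s : ℝ} (hs : s ∈ Ico (0:ℝ) 1) :
    Tendsto (fun J : ℕ => ((J:ℝ) + 1) * mulSeq ω s J) atTop (nhds 0) := by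
  set t := (3 + s) / 4 with ht
  have ht0 : 0 ≤ t := by rw [ht]; linarith [hs.1]
  have ht1 : t < 1 := by rw [ht]; linarith [hs.2]
  have hlim : Tendsto (fun j : ℕ => 5 * C ^ 2 / omegaHat ω s * ((j:ℝ) * t ^ j + t ^ j))
      atTop (nhds 0) := by
    have := ((tendsto_self_mul_const_pow_of_lt_one ht0 ht1).add
      (tendsto_pow_atTop_nhds_zero_of_lt_one ht0 ht1)).const_mul (5 * C ^ 2 / omegaHat ω s)
    simpa using this
  refine squeeze_zero (fun j => mul_nonneg (by positivity) (hω.mulSeq_nonneg hpos hs.1 j))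
    (fun j => ?_) hlim
  have h1 : mulSeq ω s j ≤ s ^ j / natMoment ω (2 * (j + 2) + 1) :=
    div_le_div_of_nonneg_left (pow_nonneg hs.1 j) (hω.natMoment_pos hpos _)
      (hω.natMoment_anti (by omega))
  have h2 := h1.trans (hω.pow_div_natMoment_le hpos hC0 hC hs j)
  calc ((j:ℝ) + 1) * mulSeq ω s j
      ≤ (j + 1) * (5 * C ^ 2 / omegaHat ω s * t ^ j) := by gcongr
    _ = _ := by ring

lemma secondDiff_mulSeq_le (hω : IsRadialWeight ω)
    (hpos : ∀ r ∈ Ico (0:ℝ) 1, 0 < omegaHat ω r) {s : ℝ} (hs : s ∈ Ico (0:ℝ) 1) (j : ℕ) :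
    secondDiff (mulSeq ω s) j
      ≤ s ^ j * ((natMoment ω (2 * j + 1) - natMoment ω (2 * (j + 2) + 1)) ^ 2 /
          (natMoment ω (2 * j + 1) * natMoment ω (2 * (j + 2) + 1) *
            (natMoment ω (2 * j + 1) + natMoment ω (2 * (j + 2) + 1))))
        + (1 - s) ^ 2 * (s ^ j / natMoment ω (2 * (j + 2) + 1)) := by
  have ha := hω.natMoment_pos hpos (2 * j + 1)
  have hb := hω.natMoment_pos hpos (2 * (j + 1) + 1)
  have hc := hω.natMoment_pos hpos (2 * (j + 2) + 1)
  have hbc : natMoment ω (2 * (j + 2) + 1) ≤ natMoment ω (2 * (j + 1) + 1) :=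
    hω.natMoment_anti (by omega)
  have h1 := secondDiff_inv_le ha hb hc (hω.natMoment_convex j)
  have h2 : 1 / natMoment ω (2 * (j + 1) + 1) ≤ 1 / natMoment ω (2 * (j + 2) + 1) :=
    one_div_le_one_div_of_le hc hbc
  have hsj := pow_nonneg hs.1 j
  have h3 := mul_le_mul_of_nonneg_left h1 hsj
  have h4 := mul_nonneg (mul_nonneg (sub_nonneg.2 hs.2.le) hsj) (sub_nonneg.2 h2)
  have e : secondDiff (mulSeq ω s) j = s ^ j * (1 / natMoment ω (2 * j + 1)
      - 2 * (1 / natMoment ω (2 * (j + 1) + 1)) + 1 / natMoment ω (2 * (j + 2) + 1))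
      - 2 * ((1 - s) * s ^ j * (1 / natMoment ω (2 * (j + 2) + 1)
        - 1 / natMoment ω (2 * (j + 1) + 1)))
      + (1 - s) ^ 2 * (s ^ j / natMoment ω (2 * (j + 2) + 1)) := by
    simp only [secondDiff, mulSeq]
    ring
  rw [e]
  linarith

lemma sum_pow_mul_sub_le {s : ℝ} (hs0 : 0 ≤ s) (μ : ℕ → ℝ) (hμ : ∀ j, 0 ≤ μ j) (J : ℕ) :
    ∑ j ∈ Finset.range J, s ^ j * (μ (j + 2) - μ j)
      ≤ (1 - s ^ 2) * ∑ j ∈ Finset.range J, s ^ j * μ (j + 2)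
        + (s ^ J * μ J + s ^ (J + 1) * μ (J + 1)) := by
  have h : ∑ j ∈ Finset.range J, s ^ j * (μ (j + 2) - μ j)
      = (1 - s ^ 2) * ∑ j ∈ Finset.range J, s ^ j * μ (j + 2)
        + (s ^ J * μ J + s ^ (J + 1) * μ (J + 1)) - (μ 0 + s * μ 1) := by
    induction J with
    | zero => simp
    | succ J ih =>
      rw [Finset.sum_range_succ, Finset.sum_range_succ, ih]
      ring
  have := mul_nonneg hs0 (hμ 1)
  linarith [hμ 0]

lemma IsRadialWeight.sum_abs_secondDiff_le (hω : IsRadialWeight ω)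
    (hpos : ∀ r ∈ Ico (0:ℝ) 1, 0 < omegaHat ω r) {C : ℝ} (hC0 : 0 < C)
    (hC : ∀ r ∈ Ico (0:ℝ) 1, omegaHat ω r ≤ C * omegaHat ω ((1 + r) / 2))
    {s : ℝ} (hs : s ∈ Ico (0:ℝ) 1) (J : ℕ) :
    ∑ j ∈ Finset.range J, ((j:ℝ) + 1) * |secondDiff (mulSeq ω s) j|
      ≤ (128 * C + 32) * (5 * C ^ 2) / omegaHat ω s
        + (16 * C * (mulSeq ω s J + mulSeq ω s (J + 1)) + (J + 1) * mulSeq ω s J) := by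
  set t := (3 + s) / 4 with ht
  have ht0 : 0 ≤ t := by rw [ht]; linarith [hs.1]
  have ht1 : t < 1 := by rw [ht]; linarith [hs.2]
  have hts : 1 - t = (1 - s) / 4 := by rw [ht]; ring
  have hs1 : 0 < 1 - s := by linarith [hs.2]
  set K := 5 * C ^ 2 / omegaHat ω s with hK
  have hK0 : 0 ≤ K := div_nonneg (by positivity) (hpos s hs).le
  have hα := hω.pow_div_natMoment_le hpos hC0 hC hs
  set w : ℕ → ℝ := fun j => natMoment ω (2 * j + 1) with hw
  have hwpos : ∀ j, 0 < w j := fun j => hω.natMoment_pos hpos _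
  set A : ℕ → ℝ := fun j => (w j - w (j + 2)) ^ 2 / (w j * w (j + 2) * (w j + w (j + 2))) with hA
  set N : ℕ → ℝ := fun j => s ^ j * A j + (1 - s) ^ 2 * (s ^ j / w (j + 2)) with hN
  have hA0 : ∀ j, 0 ≤ A j := fun j => div_nonneg (sq_nonneg _)
    (mul_nonneg (mul_nonneg (hwpos _).le (hwpos _).le) (add_nonneg (hwpos _).le (hwpos _).le))
  have hN0 : ∀ j, 0 ≤ N j := fun j => add_nonneg (mul_nonneg (pow_nonneg hs.1 j) (hA0 j))
    (mul_nonneg (sq_nonneg _) (div_nonneg (pow_nonneg hs.1 j) (hwpos _).le))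
  have hle : ∀ j, |secondDiff (mulSeq ω s) j| ≤ 2 * N j - secondDiff (mulSeq ω s) j := fun j => by
    have h1 : secondDiff (mulSeq ω s) j ≤ N j := secondDiff_mulSeq_le hω hpos hs j
    exact abs_le.2 ⟨by linarith [hN0 j], by linarith⟩
  have hAj : ∀ j : ℕ, ((j:ℝ) + 1) * A j ≤ 8 * C * (1 / w (j + 2) - 1 / w j) := fun j =>
    mul_le_of_doubling (hwpos _) (hwpos _) (by positivity) (hω.natMoment_anti (by omega))
      (hω.succ_mul_natMoment_sub_le hC0 hC j)
  have hS1 : ∑ j ∈ Finset.range J, s ^ j * (1 / w (j + 2) - 1 / w j)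
      ≤ 8 * K + (mulSeq ω s J + mulSeq ω s (J + 1)) := by
    have h1 := sum_pow_mul_sub_le hs.1 (fun j => 1 / w j) (fun j => (one_div_pos.2 (hwpos j)).le) J
    have h2 : ∑ j ∈ Finset.range J, s ^ j * (1 / w (j + 2)) ≤ K * (4 / (1 - s)) := by
      calc _ ≤ ∑ j ∈ Finset.range J, K * t ^ j := Finset.sum_le_sum fun j _ => by
            rw [mul_one_div]; exact hα j
        _ ≤ K * (1 - t)⁻¹ := by
            rw [← Finset.mul_sum]
            exact mul_le_mul_of_nonneg_left (sum_pow_le_of_lt_one ht0 ht1 J) hK0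
        _ = _ := by rw [hts, inv_div]
    have h3 : (1 - s ^ 2) * ∑ j ∈ Finset.range J, s ^ j * (1 / w (j + 2)) ≤ 8 * K := by
      calc _ ≤ (1 - s ^ 2) * (K * (4 / (1 - s))) :=
            mul_le_mul_of_nonneg_left h2 (by nlinarith [hs.1, hs.2])
        _ = 4 * (1 + s) * K := by field_simp; ring
        _ ≤ 8 * K := mul_le_mul_of_nonneg_right (by linarith [hs.2]) hK0
    have h4 : ∀ i, mulSeq ω s i = s ^ i * (1 / w i) := fun i => by
      rw [mul_one_div, mulSeq]
    rw [h4, h4]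
    linarith
  have hS2 : ∑ j ∈ Finset.range J, ((j:ℝ) + 1) * ((1 - s) ^ 2 * (s ^ j / w (j + 2))) ≤ 16 * K := by
    calc _ ≤ ∑ j ∈ Finset.range J, (1 - s) ^ 2 * K * (((j:ℝ) + 1) * t ^ j) :=
          Finset.sum_le_sum fun j _ => by
            have := mul_le_mul_of_nonneg_left (hα j)
              (mul_nonneg (sq_nonneg (1 - s)) (by positivity : (0:ℝ) ≤ j + 1))
            calc _ = (1 - s) ^ 2 * (j + 1) * (s ^ j / w (j + 2)) := by ring
              _ ≤ _ := this
              _ = _ := by ring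
      _ ≤ (1 - s) ^ 2 * K * ((1 - t) ^ 2)⁻¹ := by
          rw [← Finset.mul_sum]
          exact mul_le_mul_of_nonneg_left (sum_succ_mul_pow_le ht0 ht1 J) (by positivity)
      _ = 16 * K := by rw [hts]; field_simp; norm_num
  have hS : ∑ j ∈ Finset.range J, ((j:ℝ) + 1) * N j
      ≤ 8 * C * (8 * K + (mulSeq ω s J + mulSeq ω s (J + 1))) + 16 * K := by
    calc _ = ∑ j ∈ Finset.range J, s ^ j * (((j:ℝ) + 1) * A j)
          + ∑ j ∈ Finset.range J, ((j:ℝ) + 1) * ((1 - s) ^ 2 * (s ^ j / w (j + 2))) := by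
          rw [← Finset.sum_add_distrib]
          exact Finset.sum_congr rfl fun j _ => by simp only [hN]; ring
      _ ≤ ∑ j ∈ Finset.range J, 8 * C * (s ^ j * (1 / w (j + 2) - 1 / w j)) + 16 * K := by
          refine add_le_add (Finset.sum_le_sum fun j _ => ?_) hS2
          have := mul_le_mul_of_nonneg_left (hAj j) (pow_nonneg hs.1 j)
          linarith
      _ ≤ _ := by
          rw [← Finset.mul_sum]
          gcongr
  have htel := sum_mul_secondDiff (mulSeq ω s) 0 J
  simp only [zero_add] at htel
  have hfin : ∑ j ∈ Finset.range J, ((j:ℝ) + 1) * |secondDiff (mulSeq ω s) j|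
      ≤ 2 * ∑ j ∈ Finset.range J, ((j:ℝ) + 1) * N j
        - ∑ j ∈ Finset.range J, ((j:ℝ) + 1) * secondDiff (mulSeq ω s) j := by
    rw [Finset.mul_sum, ← Finset.sum_sub_distrib]
    refine Finset.sum_le_sum fun j _ => ?_
    have := mul_le_mul_of_nonneg_left (hle j) (by positivity : (0:ℝ) ≤ j + 1)
    linarith
  have h0 := hω.mulSeq_nonneg hpos hs.1 0
  have hJ1 := mul_nonneg (Nat.cast_nonneg (α := ℝ) J) (hω.mulSeq_nonneg hpos hs.1 (J + 1))
  have hKe : (128 * C + 32) * (5 * C ^ 2) / omegaHat ω s = (128 * C + 32) * K := by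
    rw [hK, mul_div_assoc]
  rw [hKe]
  rw [htel] at hfin
  linarith

end Multiplier

section Cesaro

lemma circleAverage_comm {F : ℂ → ℂ → ℝ} (hF : Continuous (Function.uncurry F)) (r s : ℝ) :
    Real.circleAverage (fun z => Real.circleAverage (fun ξ => F z ξ) 0 s) 0 r
      = Real.circleAverage (fun ξ => Real.circleAverage (fun z => F z ξ) 0 r) 0 s := by
  simp only [Real.circleAverage, intervalIntegral.integral_smul]
  congr 2
  refine intervalIntegral_intervalIntegral_swap
    (F := fun x y => F (circleMap 0 r x) (circleMap 0 s y)) ?_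
  have hc : Continuous (Function.uncurry fun x y => F (circleMap 0 r x) (circleMap 0 s y)) :=
    hF.comp (by fun_prop :
      Continuous fun x : ℝ × ℝ => (circleMap 0 r x.1, circleMap 0 s x.2))
  exact (hc.continuousOn.integrableOn_compact (isCompact_uIcc.prod isCompact_uIcc)).mono_set
    (prod_mono uIoc_subset_uIcc uIoc_subset_uIcc)

lemma circleAverage_mul_right {E : Type*} [NormedAddCommGroup E] [NormedSpace ℝ E] (f : ℂ → E)
    {r : ℝ} {ξ : ℂ} (hξ : ‖ξ‖ = 1) :
    Real.circleAverage (fun z => f (z * ξ)) 0 r = Real.circleAverage f 0 r := by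
  obtain ⟨η, hη⟩ := (Complex.norm_eq_one_iff ξ).1 hξ
  rw [Real.circleAverage_eq_integral_add (f := f) η, Real.circleAverage]
  simp only [circleMap, zero_add, ← hη]
  congr 2
  ext θ
  rw [mul_assoc, ← Complex.exp_add]
  push_cast
  ring_nf

/-- The polynomial `∑_{i ≤ j} X^i`. -/
def dirichletPoly (j : ℕ) : Polynomial ℂ := ∑ i ∈ Finset.range (j + 1), X ^ i

lemma coeff_dirichletPoly (j m : ℕ) : (dirichletPoly j).coeff m = if m < j + 1 then 1 else 0 := by
  simp [dirichletPoly, coeff_X_pow]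

/-- The sum of the partial sums of order at most `j`. -/
def fejerSum (j : ℕ) (p : Polynomial ℂ) : Polynomial ℂ :=
  ∑ k ∈ Finset.range (j + 1), monomial k (((j:ℂ) + 1 - k) * p.coeff k)

lemma coeff_fejerSum (j : ℕ) (p : Polynomial ℂ) (k : ℕ) :
    (fejerSum j p).coeff k = if k < j + 1 then ((j:ℂ) + 1 - k) * p.coeff k else 0 := by
  simp [fejerSum, coeff_monomial]

lemma fejerSum_add (j : ℕ) (p q : Polynomial ℂ) :
    fejerSum j (p + q) = fejerSum j p + fejerSum j q := by
  simp [fejerSum, mul_add, Finset.sum_add_distrib]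

lemma coeffPair_monomial_mul_dirichletPoly (j k : ℕ) (a : ℂ) :
    coeffPair (monomial k a * dirichletPoly j) (dirichletPoly j).coeff
      = if k < j + 1 then ((j:ℂ) + 1 - k) * a else 0 := by
  have h : ∀ n, coeffPair (monomial k a * ∑ i ∈ Finset.range n, X ^ i) (dirichletPoly j).coeff
      = ∑ i ∈ Finset.range n, if k + i < j + 1 then a else 0 := by
    intro n
    induction n with
    | zero => simp [coeffPair_zero]
    | succ n ih =>
      rw [Finset.sum_range_succ, mul_add, coeffPair_add, ih, Finset.sum_range_succ,
        monomial_mul_X_pow, coeffPair_monomial, coeff_dirichletPoly]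
      split_ifs <;> simp
  refine (h (j + 1)).trans ?_
  split_ifs with hk
  · rw [← Finset.sum_filter]
    have hf : Finset.filter (fun i => k + i < j + 1) (Finset.range (j + 1))
        = Finset.range (j + 1 - k) := by
      ext i; simp only [Finset.mem_filter, Finset.mem_range]; omega
    rw [hf, Finset.sum_const, Finset.card_range, nsmul_eq_mul, Nat.cast_sub hk.le]
    push_cast; ring
  · exact Finset.sum_eq_zero fun i _ => if_neg (by omega)

lemma eval_fejerSum (j : ℕ) (p : Polynomial ℂ) (z : ℂ) :
    (fejerSum j p).eval z = Real.circleAverage (fun ξ =>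
      p.eval (z * ξ) * ((dirichletPoly j).eval ξ * conj ((dirichletPoly j).eval ξ))) 0 1 := by
  have h : ∀ p : Polynomial ℂ, (fejerSum j p).eval z
      = coeffPair (p.comp (C z * X) * dirichletPoly j) (dirichletPoly j).coeff := by
    intro p
    induction p using Polynomial.induction_on' with
    | add p q hp hq => rw [fejerSum_add, eval_add, hp, hq, add_comp, add_mul, coeffPair_add]
    | monomial k a =>
      have e : (monomial k a).comp (C z * X) = monomial k (a * z ^ k) := by
        rw [monomial_comp, mul_pow, ← C_pow, ← mul_assoc, ← C_mul, C_mul_X_pow_eq_monomial]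
      rw [e, coeffPair_monomial_mul_dirichletPoly, fejerSum, eval_finsetSum]
      simp only [coeff_monomial, eval_monomial, mul_ite, mul_zero, ite_mul, zero_mul,
        Finset.sum_ite_eq, Finset.mem_range]
      split_ifs <;> ring
  rw [h, ← circleAverage_eval_mul_conj]
  simp only [eval_mul, eval_comp, eval_C, eval_X, mul_assoc]

lemma M1_fejerSum_le (j : ℕ) (p : Polynomial ℂ) : M1 (fejerSum j p) 1 ≤ (j + 1) * M1 p 1 := by
  set D := dirichletPoly j with hD
  have hker : Real.circleAverage (fun ξ => ‖D.eval ξ‖ ^ 2) 0 1 = (j:ℝ) + 1 := by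
    have h := circleAverage_eval_mul_conj D D
    have h2 := coeffPair_monomial_mul_dirichletPoly j 0 1
    rw [monomial_zero_left, C_1, one_mul, if_pos (by omega), ← hD, ← h] at h2
    have hi : CircleIntegrable (fun ξ => ‖D.eval ξ‖ ^ 2) 0 1 :=
      Continuous.circleIntegrable' (by fun_prop) _ _
    have h3 : Real.circleAverage (fun ξ => ((‖D.eval ξ‖ ^ 2 : ℝ) : ℂ)) 0 1
        = ((Real.circleAverage (fun ξ => ‖D.eval ξ‖ ^ 2) 0 1 : ℝ) : ℂ) :=
      Complex.ofRealCLM.circleAverage_comp_comm hi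
    have h4 : (fun z => D.eval z * conj (D.eval z)) = fun ξ => ((‖D.eval ξ‖ ^ 2 : ℝ) : ℂ) := by
      ext ξ
      rw [Complex.mul_conj, Complex.normSq_eq_norm_sq]
    rw [h4, h3] at h2
    have : ((Real.circleAverage (fun ξ => ‖D.eval ξ‖ ^ 2) 0 1 : ℝ) : ℂ) = (((j:ℝ) + 1 : ℝ) : ℂ) := by
      rw [h2]; push_cast; ring
    exact_mod_cast this
  have hcont : Continuous (Function.uncurry fun z ξ : ℂ => ‖p.eval (z * ξ)‖ * ‖D.eval ξ‖ ^ 2) := by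
    unfold Function.uncurry
    fun_prop
  have hcz : ∀ z : ℂ, Continuous fun ξ : ℂ => ‖p.eval (z * ξ)‖ * ‖D.eval ξ‖ ^ 2 := fun z => by
    fun_prop
  calc M1 (fejerSum j p) 1
      ≤ Real.circleAverage (fun z => Real.circleAverage
          (fun ξ => ‖p.eval (z * ξ)‖ * ‖D.eval ξ‖ ^ 2) 0 1) 0 1 := by
        refine Real.circleAverage_mono ((continuous_norm_eval _).circleIntegrable' 0 1) ?_
          fun z _ => ?_
        · refine Continuous.circleIntegrable' ?_ 0 1
          simp only [Real.circleAverage]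
          simp only [smul_eq_mul]
          refine continuous_const.mul ?_
          exact intervalIntegral.continuous_parametric_intervalIntegral_of_continuous'
            (f := fun z θ => ‖p.eval (z * circleMap 0 1 θ)‖ * ‖D.eval (circleMap 0 1 θ)‖ ^ 2)
            (by unfold Function.uncurry; fun_prop) _ _
        · rw [eval_fejerSum]
          refine (norm_circleAverage_le _ _ _).trans (le_of_eq ?_)
          congr 1
          ext ξ
          rw [norm_mul, norm_mul, RCLike.norm_conj, sq]
    _ = Real.circleAverage (fun ξ => ‖D.eval ξ‖ ^ 2 * M1 p 1) 0 1 := by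
        rw [circleAverage_comm hcont]
        refine Real.circleAverage_congr_sphere fun ξ hξ => ?_
        have hξ1 : ‖ξ‖ = 1 := by simpa using hξ
        simp only [mul_comm _ (‖D.eval ξ‖ ^ 2), circleAverage_const_mul]
        rw [circleAverage_mul_right (fun z => ‖p.eval z‖) hξ1, M1]
    _ = (j + 1) * M1 p 1 := by
        simp only [mul_comm _ (M1 p 1), circleAverage_const_mul, hker]

lemma M1_monomial (k : ℕ) (c : ℂ) : M1 (monomial k c) 1 = ‖c‖ := by
  rw [M1, ← Real.circleAverage_const ‖c‖ 0 1]
  refine Real.circleAverage_congr_sphere fun z hz => ?_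
  have : ‖z‖ = 1 := by simpa using hz
  simp [this]

/-- Coefficient multiplier of a polynomial. -/
def coeffMul (a : ℕ → ℝ) (p : Polynomial ℂ) : Polynomial ℂ :=
  ∑ k ∈ Finset.range (p.natDegree + 1), monomial k ((a k : ℂ) * p.coeff k)

lemma coeff_coeffMul (a : ℕ → ℝ) (p : Polynomial ℂ) (k : ℕ) :
    (coeffMul a p).coeff k = a k * p.coeff k := by
  simp only [coeffMul, finsetSum_coeff, coeff_monomial, Finset.sum_ite_eq', Finset.mem_range]
  split_ifs with h
  · rfl
  · rw [coeff_eq_zero_of_natDegree_lt (by omega), mul_zero]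

lemma M1_coeffMul_le_sum (a : ℕ → ℝ) (p : Polynomial ℂ) :
    M1 (coeffMul a p) 1 ≤ ∑ k ∈ Finset.range (p.natDegree + 1), |a k| * ‖p.coeff k‖ := by
  refine (M1_sum_le _ _ _).trans (Finset.sum_le_sum fun k _ => ?_)
  rw [M1_monomial, norm_mul, Complex.norm_real, Real.norm_eq_abs]

/-- Summation by parts twice: a multiplier as a combination of Fejér sums plus a remainder. -/
lemma coeffMul_eq_sum_fejerSum (a : ℕ → ℝ) (p : Polynomial ℂ) {J : ℕ} (hJ : p.natDegree < J) :
    coeffMul a p = ∑ j ∈ Finset.range J, C (secondDiff a j : ℂ) * fejerSum j p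
      + coeffMul (fun k => ((J:ℝ) - k) * (a J - a (J + 1)) + a J) p := by
  ext k
  rw [coeff_add, coeff_coeffMul, coeff_coeffMul, finsetSum_coeff]
  simp only [coeff_C_mul, coeff_fejerSum]
  by_cases hk : J ≤ k
  · rw [coeff_eq_zero_of_natDegree_lt (by omega)]; simp
  obtain ⟨m, rfl⟩ := Nat.exists_eq_add_of_le (not_le.1 hk).le
  have h0 : ∑ j ∈ Finset.range k, (secondDiff a j : ℂ) *
      (if k < j + 1 then ((j:ℂ) + 1 - k) * p.coeff k else 0) = 0 :=
    Finset.sum_eq_zero fun j hj => by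
      rw [if_neg (by have := Finset.mem_range.1 hj; omega), mul_zero]
  rw [Finset.sum_range_add, h0, zero_add]
  have h1 : ∑ j ∈ Finset.range m, (secondDiff a (k + j) : ℂ) *
      (if k < k + j + 1 then (((k + j : ℕ) : ℂ) + 1 - k) * p.coeff k else 0)
      = ((∑ j ∈ Finset.range m, ((j:ℝ) + 1) * secondDiff a (k + j) : ℝ) : ℂ) * p.coeff k := by
    push_cast
    rw [Finset.sum_mul]
    refine Finset.sum_congr rfl fun j _ => ?_
    rw [if_pos (by omega)]
    ring
  rw [h1, sum_mul_secondDiff]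
  push_cast
  ring

lemma IsRadialWeight.M1_coeffMul_mulSeq_le {ω : ℝ → ℝ} (hω : IsRadialWeight ω)
    (hpos : ∀ r ∈ Ico (0:ℝ) 1, 0 < omegaHat ω r) {C : ℝ} (hC0 : 0 < C)
    (hC : ∀ r ∈ Ico (0:ℝ) 1, omegaHat ω r ≤ C * omegaHat ω ((1 + r) / 2))
    {s : ℝ} (hs : s ∈ Ico (0:ℝ) 1) (p : Polynomial ℂ) :
    M1 (coeffMul (mulSeq ω s) p) 1
      ≤ (128 * C + 32) * (5 * C ^ 2) / omegaHat ω s * M1 p 1 := by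
  set l := mulSeq ω s with hl
  set e : ℕ → ℝ := fun J => (J + 1) * l J with he
  have hl0 : ∀ j, 0 ≤ l j := hω.mulSeq_nonneg hpos hs.1
  have he0 : Tendsto e atTop (nhds 0) := hω.tendsto_mul_mulSeq hpos hC0 hC hs
  have hle : ∀ j, l j ≤ e j := fun j =>
    le_mul_of_one_le_left (hl0 j) (by have := Nat.cast_nonneg (α := ℝ) j; linarith)
  have he1 : Tendsto (fun J => e (J + 1)) atTop (nhds 0) := (tendsto_add_atTop_iff_nat 1).2 he0
  set B := (128 * C + 32) * (5 * C ^ 2) / omegaHat ω s with hB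
  have hlim : Tendsto (fun J => (B + (16 * C * (e J + e (J + 1)) + e J)) * M1 p 1
      + ∑ k ∈ Finset.range (p.natDegree + 1), (e J + e (J + 1)) * ‖p.coeff k‖)
      atTop (nhds (B * M1 p 1)) := by
    have h1 : Tendsto (fun J => (B + (16 * C * (e J + e (J + 1)) + e J)) * M1 p 1) atTop
        (nhds ((B + (16 * C * (0 + 0) + 0)) * M1 p 1)) :=
      ((((he0.add he1).const_mul (16 * C)).add he0).const_add B).mul_const _
    have h2 : Tendsto (fun J => ∑ k ∈ Finset.range (p.natDegree + 1),
        (e J + e (J + 1)) * ‖p.coeff k‖) atTop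
        (nhds (∑ k ∈ Finset.range (p.natDegree + 1), (0 + 0) * ‖p.coeff k‖)) :=
      tendsto_finsetSum _ fun k _ => (he0.add he1).mul_const _
    simpa using h1.add h2
  refine ge_of_tendsto hlim ?_
  filter_upwards [eventually_gt_atTop p.natDegree] with J hJ
  rw [coeffMul_eq_sum_fejerSum l p hJ]
  refine (M1_add_le _ _ _).trans (add_le_add ?_ ?_)
  · calc _ ≤ ∑ j ∈ Finset.range J, (((j:ℝ) + 1) * |secondDiff l j|) * M1 p 1 := by
          refine (M1_sum_le _ _ _).trans (Finset.sum_le_sum fun j _ => ?_)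
          rw [M1_C_mul, Complex.norm_real, Real.norm_eq_abs, mul_comm ((j:ℝ) + 1), mul_assoc]
          exact mul_le_mul_of_nonneg_left (M1_fejerSum_le j p) (abs_nonneg _)
      _ ≤ _ := by
          rw [← Finset.sum_mul]
          refine mul_le_mul_of_nonneg_right ?_ (M1_nonneg _ _)
          refine (hω.sum_abs_secondDiff_le hpos hC0 hC hs J).trans ?_
          have := mul_le_mul_of_nonneg_left (add_le_add (hle J) (hle (J + 1)))
            (by positivity : 0 ≤ 16 * C)
          simp only [he] at this ⊢
          linarith
  · refine (M1_coeffMul_le_sum _ _).trans (Finset.sum_le_sum fun k hk => ?_)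
    refine mul_le_mul_of_nonneg_right ?_ (norm_nonneg _)
    have hkJ : (k:ℝ) ≤ J := by
      exact_mod_cast (Nat.lt_succ_iff.1 (Finset.mem_range.1 hk)).trans hJ.le
    have hk0 : (0:ℝ) ≤ k := Nat.cast_nonneg k
    have a1 := mul_nonneg hk0 (hl0 J)
    have a2 := mul_nonneg hk0 (hl0 (J + 1))
    have a3 := mul_nonneg (sub_nonneg.2 hkJ) (hl0 J)
    have a4 := mul_nonneg (sub_nonneg.2 hkJ) (hl0 (J + 1))
    have a5 := hl0 J
    have a6 := hl0 (J + 1)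
    simp only [he]
    push_cast
    rw [abs_le]
    constructor <;> linarith

end Cesaro

section Analytic

lemma hasSum_taylorCoeff {f : ℂ → ℂ} (hf : DifferentiableOn ℂ f (Metric.ball 0 1)) {z : ℂ}
    (hz : ‖z‖ < 1) : HasSum (fun k => taylorCoeff f k * z ^ k) (f z) := by
  have h := Complex.hasSum_taylorSeries_on_ball hf (z := z) (by simpa using hz)
  have e : (fun n => ((n.factorial : ℂ))⁻¹ • (z - 0) ^ n • iteratedDeriv n f 0)
      = fun k => taylorCoeff f k * z ^ k := by
    ext k
    simp only [taylorCoeff, sub_zero, smul_eq_mul]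
    ring
  exact e ▸ h

lemma summable_norm_taylorCoeff {f : ℂ → ℂ} (hf : DifferentiableOn ℂ f (Metric.ball 0 1)) {r : ℝ}
    (hr : r ∈ Ico (0:ℝ) 1) : Summable fun k => ‖taylorCoeff f k * (r:ℂ) ^ k‖ :=
  (hasSum_taylorCoeff hf (z := r) (by
    rw [Complex.norm_real, Real.norm_of_nonneg hr.1]; exact hr.2)).summable.norm

lemma hasSum_taylorCoeff_dilateF {f : ℂ → ℂ} (hf : DifferentiableOn ℂ f (Metric.ball 0 1)) {r : ℝ}
    (hr : r ∈ Ico (0:ℝ) 1) {z : ℂ} (hz : ‖z‖ ≤ 1) :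
    HasSum (fun k => taylorCoeff f k * (r:ℂ) ^ k * z ^ k) (dilateF f r z) := by
  have h := hasSum_taylorCoeff hf (z := r * z) (by
    rw [norm_mul, Complex.norm_real, Real.norm_of_nonneg hr.1]
    nlinarith [hr.1, hr.2, norm_nonneg z])
  simpa only [dilateF, mul_pow, ← mul_assoc] using h

/-- The integral mean `M_1(r,f)`, as a real number. -/
def meanNorm (f : ℂ → ℂ) (r : ℝ) : ℝ := Real.circleAverage (fun z => ‖f z‖) 0 r

lemma meanNorm_dilateF (f : ℂ → ℂ) (t r : ℝ) : meanNorm (dilateF f t) r = meanNorm f (t * r) := by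
  rw [meanNorm, meanNorm, Real.circleAverage_eq_circleAverage_zero_one,
    Real.circleAverage_eq_circleAverage_zero_one (R := t * r)]
  simp only [dilateF, add_zero, Complex.ofReal_mul, mul_assoc]

lemma M1_eq_meanNorm (p : Polynomial ℂ) (r : ℝ) : M1 p r = meanNorm (fun z => p.eval z) r := rfl

lemma meanNorm_nonneg (f : ℂ → ℂ) (r : ℝ) : 0 ≤ meanNorm f r :=
  Real.circleAverage_nonneg_of_nonneg fun _ _ => norm_nonneg _

lemma continuousOn_norm_sphere {f : ℂ → ℂ} (hf : DifferentiableOn ℂ f (Metric.ball 0 1)) {r : ℝ}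
    (hr : r ∈ Ico (0:ℝ) 1) : ContinuousOn (fun z => ‖f z‖) (Metric.sphere 0 r) :=
  (hf.continuousOn.mono fun z hz => by
    rw [mem_sphere_zero_iff_norm] at hz
    rw [mem_ball_zero_iff, hz]; exact hr.2).norm

lemma MpE_one_eq_meanNorm {f : ℂ → ℂ} (hf : DifferentiableOn ℂ f (Metric.ball 0 1)) {r : ℝ}
    (hr : r ∈ Ico (0:ℝ) 1) : MpE 1 r f = ENNReal.ofReal (meanNorm f r) := by
  rw [MpE_one_eq, circleLAvg_ofReal hr.1 (fun _ => norm_nonneg _) (continuousOn_norm_sphere hf hr),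
    meanNorm]

lemma tendsto_M1_truncPoly {a : ℕ → ℂ} {F : ℂ → ℂ} (ha : Summable fun k => ‖a k‖)
    (hF : ∀ z : ℂ, ‖z‖ ≤ 1 → HasSum (fun k => a k * z ^ k) (F z)) {r : ℝ} (hr : r ∈ Icc (0:ℝ) 1)
    (hc : ContinuousOn (fun z => ‖F z‖) (Metric.sphere 0 r)) :
    Tendsto (fun N => M1 (truncPoly a N) r) atTop (nhds (meanNorm F r)) := by
  have hi : CircleIntegrable (fun z => ‖F z‖) 0 r := hc.circleIntegrable hr.1
  have hp : ∀ N, CircleIntegrable (fun z => ‖(truncPoly a N).eval z‖) 0 r := fun N =>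
    (continuous_norm_eval _).circleIntegrable' 0 r
  have hk : ∀ c : ℝ, CircleIntegrable (fun _ : ℂ => c) 0 r := fun c =>
    continuous_const.circleIntegrable' 0 r
  rw [tendsto_iff_norm_sub_tendsto_zero]
  refine squeeze_zero (fun _ => norm_nonneg _) (fun N => ?_) (tendsto_tailSum a)
  have hd : ∀ z ∈ Metric.sphere (0:ℂ) |r|, ‖F z - (truncPoly a N).eval z‖ ≤ tailSum a N :=
    fun z hz => norm_sub_eval_truncPoly_le ha hF N (by
      rw [mem_sphere_zero_iff_norm, abs_of_nonneg hr.1] at hz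
      rw [hz]; exact hr.2)
  have h1 : M1 (truncPoly a N) r ≤ meanNorm F r + tailSum a N := by
    have : meanNorm F r + tailSum a N
        = Real.circleAverage (fun z => ‖F z‖ + tailSum a N) 0 r := by
      rw [Real.circleAverage_fun_add hi (hk _), Real.circleAverage_const, meanNorm]
    rw [this]
    refine Real.circleAverage_mono (hp N) (hi.add (hk _)) fun z hz => ?_
    have := norm_sub_norm_le ((truncPoly a N).eval z) (F z)
    rw [norm_sub_rev] at this
    linarith [hd z hz]
  have h2 : meanNorm F r ≤ M1 (truncPoly a N) r + tailSum a N := by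
    have : M1 (truncPoly a N) r + tailSum a N
        = Real.circleAverage (fun z => ‖(truncPoly a N).eval z‖ + tailSum a N) 0 r := by
      rw [Real.circleAverage_fun_add (hp N) (hk _), Real.circleAverage_const, M1]
    rw [this]
    refine Real.circleAverage_mono hi ((hp N).add (hk _)) fun z hz => ?_
    have := norm_sub_norm_le (F z) ((truncPoly a N).eval z)
    linarith [hd z hz]
  rw [Real.norm_eq_abs, abs_le]
  constructor <;> linarith

lemma continuousOn_norm_dilateF {f : ℂ → ℂ} (hf : DifferentiableOn ℂ f (Metric.ball 0 1)) {t r : ℝ}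
    (ht : t ∈ Ico (0:ℝ) 1) (hr : r ∈ Icc (0:ℝ) 1) :
    ContinuousOn (fun z => ‖dilateF f t z‖) (Metric.sphere 0 r) := by
  refine (hf.continuousOn.comp (by fun_prop) fun z hz => ?_).norm
  rw [mem_sphere_zero_iff_norm] at hz
  rw [mem_ball_zero_iff, norm_mul, hz, Complex.norm_real, Real.norm_of_nonneg ht.1]
  nlinarith [ht.1, ht.2, hr.1, hr.2]

lemma tendsto_M1_truncPoly_taylorCoeff {f : ℂ → ℂ} (hf : DifferentiableOn ℂ f (Metric.ball 0 1))
    {t r : ℝ} (ht : t ∈ Ico (0:ℝ) 1) (hr : r ∈ Icc (0:ℝ) 1) :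
    Tendsto (fun N => M1 (truncPoly (fun k => taylorCoeff f k * (t:ℂ) ^ k) N) r) atTop
      (nhds (meanNorm f (t * r))) := by
  rw [← meanNorm_dilateF]
  exact tendsto_M1_truncPoly (summable_norm_taylorCoeff hf ht)
    (fun z hz => hasSum_taylorCoeff_dilateF hf ht hz) hr (continuousOn_norm_dilateF hf ht hr)

lemma monotoneOn_meanNorm {f : ℂ → ℂ} (hf : DifferentiableOn ℂ f (Metric.ball 0 1)) :
    MonotoneOn (meanNorm f) (Ico 0 1) := by
  intro r hr t ht hrt
  rcases eq_or_lt_of_le ht.1 with h | h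
  · rw [le_antisymm (h ▸ hrt) hr.1, h]
  have hρ : r / t ∈ Icc (0:ℝ) 1 := ⟨div_nonneg hr.1 ht.1, (div_le_one h).2 hrt⟩
  have h1 := tendsto_M1_truncPoly_taylorCoeff hf ht hρ
  have h2 := tendsto_M1_truncPoly_taylorCoeff hf ht (right_mem_Icc.2 zero_le_one)
  rw [mul_div_cancel₀ _ h.ne'] at h1
  rw [mul_one] at h2
  exact le_of_tendsto_of_tendsto' h1 h2 fun N => M1_mono _ hρ (right_mem_Icc.2 zero_le_one) hρ.2

lemma coeffPair_truncPoly_left (a b : ℕ → ℂ) (N : ℕ) :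
    coeffPair (truncPoly a N) b = ∑ k ∈ Finset.range N, a k * conj (b k) := by
  induction N with
  | zero => simp [truncPoly, coeffPair_zero]
  | succ N ih =>
    rw [Finset.sum_range_succ, ← ih, truncPoly, Finset.sum_range_succ, coeffPair_add,
      coeffPair_monomial, truncPoly]

/-- The pairing of two power series on the circle is bounded by the dual norm. -/
lemma norm_tsum_mul_conj_le {f : ℂ → ℂ} (hf : DifferentiableOn ℂ f (Metric.ball 0 1)) {t : ℝ}
    (ht : t ∈ Ico (0:ℝ) 1) {b : ℕ → ℂ} (hb : Summable fun k => ‖b k‖) :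
    ‖∑' k, taylorCoeff f k * (t:ℂ) ^ k * conj (b k)‖ ≤ (dualE b).toReal * meanNorm f t := by
  have ha := summable_norm_taylorCoeff hf ht
  have hs : Summable fun k => taylorCoeff f k * (t:ℂ) ^ k * conj (b k) := by
    refine Summable.of_norm ?_
    obtain ⟨B, hB⟩ := hb.tendsto_atTop_zero.bddAbove_range
    refine Summable.of_nonneg_of_le (fun _ => norm_nonneg _) (fun k => ?_) (ha.mul_right B)
    rw [norm_mul, RCLike.norm_conj]
    exact mul_le_mul_of_nonneg_left (hB ⟨k, rfl⟩) (norm_nonneg _)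
  have h1 := hs.hasSum.tendsto_sum_nat.norm
  have h2 := (tendsto_M1_truncPoly_taylorCoeff hf ht (right_mem_Icc.2 zero_le_one)).const_mul
    (dualE b).toReal
  rw [mul_one] at h2
  refine le_of_tendsto_of_tendsto' h1 h2 fun N => ?_
  have := norm_coeffPair_le_toReal (dualE_ne_top hb)
    (truncPoly (fun k => taylorCoeff f k * (t:ℂ) ^ k) N)
  rwa [coeffPair_truncPoly_left] at this

lemma M1_comp_C_mul_X (p : Polynomial ℂ) (ρ : ℝ) : M1 (p.comp (C (ρ:ℂ) * X)) 1 = M1 p ρ := by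
  have h := meanNorm_dilateF (fun z => p.eval z) ρ 1
  rw [mul_one] at h
  rw [M1_eq_meanNorm p ρ, ← h, M1_eq_meanNorm]
  simp only [eval_comp, eval_mul, eval_C, eval_X]
  rfl

lemma coeffPair_comp_C_mul_X (p : Polynomial ℂ) (ρ : ℝ) (b : ℕ → ℂ) :
    coeffPair (p.comp (C (ρ:ℂ) * X)) b = coeffPair p (fun k => b k * (ρ:ℂ) ^ k) := by
  induction p using Polynomial.induction_on' with
  | add p q hp hq => rw [add_comp, coeffPair_add, coeffPair_add, hp, hq]
  | monomial k a =>
    rw [monomial_comp, mul_pow, ← C_pow, ← mul_assoc, ← C_mul, C_mul_X_pow_eq_monomial,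
      coeffPair_monomial, coeffPair_monomial]
    simp only [map_mul, map_pow, Complex.conj_ofReal]
    ring

lemma dualE_mul_pow_le (b : ℕ → ℂ) {ρ : ℝ} (hρ : ρ ∈ Icc (0:ℝ) 1) :
    dualE (fun k => b k * (ρ:ℂ) ^ k) ≤ dualE b := by
  refine iSup₂_le fun p hp => ?_
  rw [← coeffPair_comp_C_mul_X]
  refine le_iSup₂_of_le (p.comp (C (ρ:ℂ) * X)) ?_ le_rfl
  rw [M1_comp_C_mul_X]
  exact (M1_mono p hρ (right_mem_Icc.2 zero_le_one) hρ.2).trans hp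

lemma monotoneOn_dualE (b : ℕ → ℂ) :
    MonotoneOn (fun r : ℝ => dualE fun k => b k * (r:ℂ) ^ k) (Ico 0 1) := by
  intro r hr t ht hrt
  rcases eq_or_lt_of_le ht.1 with h | h
  · rw [le_antisymm (h ▸ hrt) hr.1, h]
  have hρ : r / t ∈ Icc (0:ℝ) 1 := ⟨div_nonneg hr.1 ht.1, (div_le_one h).2 hrt⟩
  have h1 := dualE_mul_pow_le (fun k => b k * (t:ℂ) ^ k) hρ
  have e : (fun k => b k * (t:ℂ) ^ k * ((r / t : ℝ) : ℂ) ^ k) = fun k => b k * (r:ℂ) ^ k := by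
    ext k
    rw [mul_assoc, ← mul_pow, ← Complex.ofReal_mul, mul_div_cancel₀ _ h.ne']
  rw [e] at h1
  exact h1

end Analytic

section PairingBound

lemma continuousAt_tsum_mul_pow {c : ℕ → ℂ}
    (hc : ∀ ρ ∈ Ico (0:ℝ) 1, Summable fun k => ‖c k‖ * ρ ^ k) {z : ℂ} (hz : ‖z‖ < 1) :
    ContinuousAt (fun z : ℂ => ∑' k, c k * z ^ k) z := by
  obtain ⟨ρ, h1, h2⟩ := exists_between hz
  have h0 : 0 ≤ ρ := (norm_nonneg z).trans h1.le
  have : ContinuousOn (fun z : ℂ => ∑' k, c k * z ^ k) (Metric.ball 0 ρ) := by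
    refine continuousOn_tsum (fun k => by fun_prop) (hc ρ ⟨h0, h2⟩) fun k x hx => ?_
    rw [norm_mul, norm_pow]
    rw [mem_ball_zero_iff] at hx
    gcongr
  exact this.continuousAt (Metric.isOpen_ball.mem_nhds (by simpa using h1))

/-- The regularized pairing written as an integral over the radius. -/
lemma IsRadialWeight.hasSum_momentCoeff_mul_pow {ω : ℝ → ℝ} (hω : IsRadialWeight ω) {c : ℕ → ℂ}
    {ρ : ℝ} (hρ : ρ ∈ Ico (0:ℝ) 1) (hc : Summable fun k => ‖c k‖ * ρ ^ k) :
    HasSum (fun k => c k * ((momentCoeff ω k : ℝ) : ℂ) * (ρ:ℂ) ^ k)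
      (∫ r in Ioo (0:ℝ) 1, ((r * ω r : ℝ) : ℂ) * ∑' k, c k * ((r ^ 2 * ρ : ℝ) : ℂ) ^ k) := by
  set F : ℕ → ℝ → ℂ := fun k r => c k * (ρ:ℂ) ^ k * ((r ^ (2 * k + 1) * ω r : ℝ) : ℂ) with hF
  have hi : ∀ k, Integrable (F k) (volume.restrict (Ioo 0 1)) := fun k =>
    (hω.integrableOn_pow_mul (2 * k + 1)).ofReal.const_mul _
  have hn : ∀ k, ∫ r in Ioo (0:ℝ) 1, ‖F k r‖ = ‖c k‖ * ρ ^ k * natMoment ω (2 * k + 1) := by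
    intro k
    rw [natMoment, ← integral_const_mul]
    refine setIntegral_congr_fun measurableSet_Ioo fun r hr => ?_
    have : 0 ≤ r ^ (2 * k + 1) * ω r := mul_nonneg (pow_nonneg hr.1.le _) (hω.1 r ⟨hr.1.le, hr.2⟩)
    simp only [hF, norm_mul, norm_pow, Complex.norm_real, Real.norm_of_nonneg this,
      Real.norm_of_nonneg hρ.1]
  have hs : Summable fun k => ∫ r in Ioo (0:ℝ) 1, ‖F k r‖ := by
    simp only [hn]
    refine Summable.of_nonneg_of_le (fun k => ?_) (fun k => ?_) (hc.mul_right (natMoment ω 0))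
    · rw [← hn]; exact integral_nonneg fun _ => norm_nonneg _
    · have := hω.natMoment_anti (Nat.zero_le (2 * k + 1))
      have := pow_nonneg hρ.1 k
      gcongr
  have h := hasSum_integral_of_summable_integral_norm hi hs
  have e1 : (fun k => ∫ r in Ioo (0:ℝ) 1, F k r)
      = fun k => c k * ((momentCoeff ω k : ℝ) : ℂ) * (ρ:ℂ) ^ k := by
    ext k
    rw [hF, integral_const_mul, integral_complex_ofReal, momentCoeff_eq, natMoment]
    ring
  have e2 : ∫ r in Ioo (0:ℝ) 1, ∑' k, F k r
      = ∫ r in Ioo (0:ℝ) 1, ((r * ω r : ℝ) : ℂ) * ∑' k, c k * ((r ^ 2 * ρ : ℝ) : ℂ) ^ k := by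
    refine integral_congr_ae (ae_of_all _ fun r => ?_)
    simp only [hF]
    rw [← tsum_mul_left]
    refine tsum_congr fun k => ?_
    push_cast
    ring
  rwa [e1, e2] at h

variable {f g : ℂ → ℂ}

lemma summable_norm_taylorCoeff_mul_conj (hf : DifferentiableOn ℂ f (Metric.ball 0 1))
    (hg : DifferentiableOn ℂ g (Metric.ball 0 1)) {ρ : ℝ} (hρ : ρ ∈ Ico (0:ℝ) 1) :
    Summable fun k => ‖taylorCoeff f k * conj (taylorCoeff g k)‖ * ρ ^ k := by
  have hs : √ρ ∈ Ico (0:ℝ) 1 := ⟨Real.sqrt_nonneg _, by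
    rw [Real.sqrt_lt' one_pos]; simpa using hρ.2⟩
  have h1 := summable_norm_taylorCoeff hf hs
  have h2 := summable_norm_taylorCoeff hg hs
  obtain ⟨B, hB⟩ := h2.tendsto_atTop_zero.bddAbove_range
  refine Summable.of_nonneg_of_le (fun k => mul_nonneg (norm_nonneg _) (pow_nonneg hρ.1 k))
    (fun k => ?_) (h1.mul_right B)
  have h3 : ‖taylorCoeff g k * ((√ρ : ℝ) : ℂ) ^ k‖ ≤ B := hB ⟨k, rfl⟩
  calc ‖taylorCoeff f k * conj (taylorCoeff g k)‖ * ρ ^ k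
      = ‖taylorCoeff f k * ((√ρ : ℝ) : ℂ) ^ k‖ * ‖taylorCoeff g k * ((√ρ : ℝ) : ℂ) ^ k‖ := by
        simp only [norm_mul, norm_pow, Complex.norm_real, Real.norm_of_nonneg hs.1,
          RCLike.norm_conj]
        nth_rewrite 1 [← Real.mul_self_sqrt hρ.1]
        rw [mul_pow]; ring
    _ ≤ _ := mul_le_mul_of_nonneg_left h3 (norm_nonneg _)

/-- The dual norm of the dilation `g_r`. -/
def dilDual (g : ℂ → ℂ) (r : ℝ) : ℝ≥0∞ := dualE fun k => taylorCoeff g k * (r:ℂ) ^ k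

lemma dilDual_ne_top (hg : DifferentiableOn ℂ g (Metric.ball 0 1)) {r : ℝ}
    (hr : r ∈ Ico (0:ℝ) 1) : dilDual g r ≠ ⊤ :=
  dualE_ne_top (summable_norm_taylorCoeff hg hr)

lemma monotoneOn_dilDual (g : ℂ → ℂ) : MonotoneOn (dilDual g) (Ico 0 1) := monotoneOn_dualE _

lemma dilDual_le (hg : DifferentiableOn ℂ g (Metric.ball 0 1)) {r : ℝ} (hr : r ∈ Ico (0:ℝ) 1) :
    dilDual g r ≤ 8 * BMOANormE (dilateF g r) :=
  dualE_le_BMOANormE (summable_norm_taylorCoeff hg hr)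
    fun _ hz => hasSum_taylorCoeff_dilateF hg hr hz

lemma BMOANormE_dilateF_le (hg : DifferentiableOn ℂ g (Metric.ball 0 1)) {r : ℝ}
    (hr : r ∈ Ico (0:ℝ) 1) : BMOANormE (dilateF g r) ≤ 3 * dilDual g r :=
  BMOANormE_le_dualE (summable_norm_taylorCoeff hg hr)
    fun _ hz => hasSum_taylorCoeff_dilateF hg hr hz

lemma norm_tsum_taylorCoeff_le (hf : DifferentiableOn ℂ f (Metric.ball 0 1))
    (hg : DifferentiableOn ℂ g (Metric.ball 0 1)) {r ρ : ℝ} (hr : r ∈ Ico (0:ℝ) 1)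
    (hρ : ρ ∈ Icc (0:ℝ) 1) :
    ‖∑' k, taylorCoeff f k * conj (taylorCoeff g k) * ((r ^ 2 * ρ : ℝ) : ℂ) ^ k‖
      ≤ (dilDual g r).toReal * meanNorm f r := by
  have ht : r * ρ ∈ Ico (0:ℝ) 1 := ⟨mul_nonneg hr.1 hρ.1, by nlinarith [hr.1, hr.2, hρ.1, hρ.2]⟩
  have h := norm_tsum_mul_conj_le hf ht (summable_norm_taylorCoeff hg hr)
  have e : ∀ k, taylorCoeff f k * ((r * ρ : ℝ) : ℂ) ^ k * conj (taylorCoeff g k * (r:ℂ) ^ k)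
      = taylorCoeff f k * conj (taylorCoeff g k) * ((r ^ 2 * ρ : ℝ) : ℂ) ^ k := by
    intro k
    simp only [map_mul, map_pow, Complex.conj_ofReal]
    push_cast
    ring
  simp only [e] at h
  refine h.trans (mul_le_mul_of_nonneg_left ?_ ENNReal.toReal_nonneg)
  exact monotoneOn_meanNorm hf ht hr (by nlinarith [hr.1, hρ.2])

lemma aemeasurable_dilDual (g : ℂ → ℂ) :
    AEMeasurable (dilDual g) (volume.restrict (Ioo 0 1)) :=
  aemeasurable_restrict_of_monotoneOn measurableSet_Ioo
    ((monotoneOn_dilDual g).mono Ioo_subset_Ico_self)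

lemma aemeasurable_meanNorm (hf : DifferentiableOn ℂ f (Metric.ball 0 1)) :
    AEMeasurable (meanNorm f) (volume.restrict (Ioo 0 1)) :=
  aemeasurable_restrict_of_monotoneOn measurableSet_Ioo
    ((monotoneOn_meanNorm hf).mono Ioo_subset_Ico_self)

variable {ω : ℝ → ℝ} {q q' : ℝ}

lemma IsRadialWeight.lintegral_dilDual_mul_le (hω : IsRadialWeight ω)
    (hf : DifferentiableOn ℂ f (Metric.ball 0 1)) (hg : DifferentiableOn ℂ g (Metric.ball 0 1))
    (hq : q'.HolderConjugate q) :
    ∫⁻ r in Ioo (0:ℝ) 1, ENNReal.ofReal (r * ω r * ((dilDual g r).toReal * meanNorm f r))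
      ≤ 8 * XqNormE BMOANormE ω q' g * LpqNormE ω 1 q f := by
  have hq0 := hq.pos
  have hq1 := hq.symm.pos
  have hωm : AEMeasurable ω (volume.restrict (Ioo 0 1)) := hω.integrableOn_Ioo.aemeasurable
  set u : ℝ → ℝ≥0∞ := fun r => dilDual g r * ENNReal.ofReal (ω r) ^ (1 / q')
  set v : ℝ → ℝ≥0∞ := fun r => ENNReal.ofReal (meanNorm f r) * ENNReal.ofReal (r * ω r) ^ (1 / q)
  have hu : AEMeasurable u (volume.restrict (Ioo 0 1)) :=
    (aemeasurable_dilDual g).mul (hωm.ennreal_ofReal.pow_const _)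
  have hv : AEMeasurable v (volume.restrict (Ioo 0 1)) :=
    (aemeasurable_meanNorm hf).ennreal_ofReal.mul
      ((aemeasurable_id.mul hωm).ennreal_ofReal.pow_const _)
  have h1 : ∫⁻ r in Ioo (0:ℝ) 1, ENNReal.ofReal (r * ω r * ((dilDual g r).toReal * meanNorm f r))
      ≤ ∫⁻ r in Ioo (0:ℝ) 1, (u * v) r := by
    refine setLIntegral_mono' measurableSet_Ioo fun r hr => ?_
    have hr' : r ∈ Ico (0:ℝ) 1 := ⟨hr.1.le, hr.2⟩
    have hw := hω.1 r hr'
    rw [ENNReal.ofReal_mul (mul_nonneg hr.1.le hw), ENNReal.ofReal_mul ENNReal.toReal_nonneg,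
      ENNReal.ofReal_toReal (dilDual_ne_top hg hr')]
    have h2 : ENNReal.ofReal (r * ω r)
        ≤ ENNReal.ofReal (ω r) ^ (1 / q') * ENNReal.ofReal (r * ω r) ^ (1 / q) := by
      calc ENNReal.ofReal (r * ω r)
          = ENNReal.ofReal (r * ω r) ^ (1 / q') * ENNReal.ofReal (r * ω r) ^ (1 / q) := by
            rw [← ENNReal.rpow_add_of_nonneg _ _ (by positivity) (by positivity), one_div, one_div,
              hq.inv_add_inv_eq_one, ENNReal.rpow_one]
        _ ≤ _ := by
            gcongr
            nlinarith [hr.2]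
    calc _ ≤ _ := mul_le_mul_left h2 _
      _ = _ := by simp only [u, v, Pi.mul_apply]; ring
  refine h1.trans ((ENNReal.lintegral_mul_le_Lp_mul_Lq _ hq hu hv).trans (mul_le_mul' ?_ ?_))
  · have h8 : (8:ℝ≥0∞) = ((8:ℝ≥0∞) ^ q') ^ (1 / q') := by
      rw [← ENNReal.rpow_mul, mul_one_div_cancel hq0.ne', ENNReal.rpow_one]
    rw [XqNormE, h8, ← ENNReal.mul_rpow_of_nonneg _ _ (by positivity),
      ← lintegral_const_mul' _ _ (by simp)]
    refine ENNReal.rpow_le_rpow (setLIntegral_mono' measurableSet_Ioo fun r hr => ?_)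
      (by positivity)
    simp only [u]
    rw [ENNReal.mul_rpow_of_nonneg _ _ hq0.le, ← ENNReal.rpow_mul, one_div_mul_cancel hq0.ne',
      ENNReal.rpow_one, ← mul_assoc, ← ENNReal.mul_rpow_of_nonneg _ _ hq0.le]
    gcongr
    exact dilDual_le hg ⟨hr.1.le, hr.2⟩
  · rw [LpqNormE]
    refine ENNReal.rpow_le_rpow (setLIntegral_mono' measurableSet_Ioo fun r hr => ?_)
      (by positivity)
    simp only [v]
    rw [ENNReal.mul_rpow_of_nonneg _ _ hq1.le, ← ENNReal.rpow_mul, one_div_mul_cancel hq1.ne',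
      ENNReal.rpow_one, MpE_one_eq_meanNorm hf ⟨hr.1.le, hr.2⟩]

/-- The pairing of `A^{1,q}_ω` with `BMOA(q',ω)` exists and is bounded. -/
theorem IsRadialWeight.exists_hasPairingC (hω : IsRadialWeight ω) (hq : q'.HolderConjugate q)
    (hg : DifferentiableOn ℂ g (Metric.ball 0 1)) (hg' : XqNormE BMOANormE ω q' g < ⊤)
    (hf : InApq ω 1 q f) :
    ∃ l : ℂ, HasPairingC (momentCoeff ω) f g l ∧
      ‖l‖ ≤ 8 * (XqNormE BMOANormE ω q' g).toReal * (LpqNormE ω 1 q f).toReal := by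
  obtain ⟨hf, hf'⟩ := hf
  set c : ℕ → ℂ := fun k => taylorCoeff f k * conj (taylorCoeff g k) with hc
  have hcs : ∀ ρ ∈ Ico (0:ℝ) 1, Summable fun k => ‖c k‖ * ρ ^ k := fun ρ hρ =>
    summable_norm_taylorCoeff_mul_conj hf hg hρ
  have hωm := hω.integrableOn_Ioo
  set B : ℝ → ℝ := fun r => r * ω r * ((dilDual g r).toReal * meanNorm f r) with hB
  have hB0 : ∀ r ∈ Ioo (0:ℝ) 1, 0 ≤ B r := fun r hr =>
    mul_nonneg (mul_nonneg hr.1.le (hω.1 r ⟨hr.1.le, hr.2⟩))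
      (mul_nonneg ENNReal.toReal_nonneg (meanNorm_nonneg f r))
  have hBl := hω.lintegral_dilDual_mul_le hf hg hq
  have hXY : 8 * XqNormE BMOANormE ω q' g * LpqNormE ω 1 q f < ⊤ :=
    ENNReal.mul_lt_top (ENNReal.mul_lt_top (by norm_num) hg') hf'
  have hBm : AEStronglyMeasurable B (volume.restrict (Ioo 0 1)) :=
    ((aemeasurable_id.mul hωm.aemeasurable).mul
      ((aemeasurable_dilDual g).ennreal_toReal.mul (aemeasurable_meanNorm hf))).aestronglyMeasurable
  have hBae : 0 ≤ᵐ[volume.restrict (Ioo 0 1)] B :=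
    (ae_restrict_mem measurableSet_Ioo).mono hB0
  have hBi : Integrable B (volume.restrict (Ioo 0 1)) := by
    refine ⟨hBm, ?_⟩
    rw [hasFiniteIntegral_iff_ofReal hBae]
    exact hBl.trans_lt hXY
  set H : ℝ → ℝ → ℂ := fun ρ r => ((r * ω r : ℝ) : ℂ) * ∑' k, c k * ((r ^ 2 * ρ : ℝ) : ℂ) ^ k
    with hH
  have hnorm : ∀ r ∈ Ioo (0:ℝ) 1, ∀ ρ ∈ Icc (0:ℝ) 1, ((r ^ 2 * ρ : ℝ)) ∈ Ico (0:ℝ) 1 := by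
    intro r hr ρ hρ
    refine ⟨mul_nonneg (sq_nonneg r) hρ.1, ?_⟩
    have : r ^ 2 < 1 := pow_lt_one₀ hr.1.le hr.2 two_ne_zero
    nlinarith [hρ.1, hρ.2, sq_nonneg r]
  have hcont : ∀ x ∈ Ico (0:ℝ) 1, ContinuousAt (fun x : ℝ => ∑' k, c k * (x:ℂ) ^ k) x := by
    intro x hx
    have := continuousAt_tsum_mul_pow hcs (z := (x:ℂ)) (by
      rw [Complex.norm_real, Real.norm_of_nonneg hx.1]; exact hx.2)
    exact ContinuousAt.comp (f := fun x : ℝ => (x:ℂ)) this Complex.continuous_ofReal.continuousAt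
  have hHb : ∀ ρ ∈ Icc (0:ℝ) 1, ∀ r ∈ Ioo (0:ℝ) 1, ‖H ρ r‖ ≤ B r := by
    intro ρ hρ r hr
    have h0 : 0 ≤ r * ω r := mul_nonneg hr.1.le (hω.1 r ⟨hr.1.le, hr.2⟩)
    simp only [hH, hB]
    rw [norm_mul, Complex.norm_real, Real.norm_of_nonneg h0]
    exact mul_le_mul_of_nonneg_left (norm_tsum_taylorCoeff_le hf hg ⟨hr.1.le, hr.2⟩ hρ) h0
  have hHm : ∀ ρ ∈ Icc (0:ℝ) 1, AEStronglyMeasurable (H ρ) (volume.restrict (Ioo 0 1)) := by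
    intro ρ hρ
    refine AEStronglyMeasurable.mul (Complex.continuous_ofReal.comp_aestronglyMeasurable
      (aestronglyMeasurable_id.mul hωm.aestronglyMeasurable)) ?_
    refine ContinuousOn.aestronglyMeasurable (fun r hr => ContinuousAt.continuousWithinAt ?_)
      measurableSet_Ioo
    exact ContinuousAt.comp (f := fun r : ℝ => r ^ 2 * ρ) (hcont _ (hnorm r hr ρ hρ)) (by fun_prop)
  have hmem : ∀ᶠ ρ : ℝ in nhdsWithin 1 (Iio 1), ρ ∈ Ico (0:ℝ) 1 :=
    Ico_mem_nhdsLT zero_lt_one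
  have hlim : Tendsto (fun ρ => ∫ r in Ioo (0:ℝ) 1, H ρ r) (nhdsWithin 1 (Iio 1))
      (nhds (∫ r in Ioo (0:ℝ) 1, H 1 r)) := by
    refine tendsto_integral_filter_of_dominated_convergence B ?_ ?_ hBi ?_
    · exact hmem.mono fun ρ hρ => hHm ρ ⟨hρ.1, hρ.2.le⟩
    · exact hmem.mono fun ρ hρ => (ae_restrict_mem measurableSet_Ioo).mono
        fun r hr => hHb ρ ⟨hρ.1, hρ.2.le⟩ r hr
    · refine (ae_restrict_mem measurableSet_Ioo).mono fun r hr => ?_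
      refine Tendsto.const_mul _ ?_
      have h1 := hcont _ (hnorm r hr 1 ⟨zero_le_one, le_rfl⟩)
      have h2 : Tendsto (fun ρ : ℝ => r ^ 2 * ρ) (nhdsWithin 1 (Iio 1)) (nhds (r ^ 2 * 1)) :=
        ((continuous_const.mul continuous_id).tendsto 1).mono_left nhdsWithin_le_nhds
      exact h1.tendsto.comp h2
  refine ⟨∫ r in Ioo (0:ℝ) 1, H 1 r, ⟨fun ρ hρ => ?_, ?_⟩, ?_⟩
  · exact (hω.hasSum_momentCoeff_mul_pow hρ (hcs ρ hρ)).summable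
  · refine hlim.congr' (hmem.mono fun ρ hρ => ?_)
    exact (hω.hasSum_momentCoeff_mul_pow hρ (hcs ρ hρ)).tsum_eq.symm
  · have h1 : ‖∫ r in Ioo (0:ℝ) 1, H 1 r‖ ≤ ∫ r in Ioo (0:ℝ) 1, B r :=
      norm_integral_le_of_norm_le hBi ((ae_restrict_mem measurableSet_Ioo).mono
        fun r hr => hHb 1 ⟨zero_le_one, le_rfl⟩ r hr)
    refine h1.trans ?_
    rw [integral_eq_lintegral_of_nonneg_ae hBae hBm]
    refine (ENNReal.toReal_mono hXY.ne hBl).trans_eq ?_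
    rw [ENNReal.toReal_mul, ENNReal.toReal_mul]
    simp

end PairingBound

section Dyadic

lemma tsum_pow_natAbs_ne_top {η : ℝ≥0∞} (hη : η < 1) : ∑' j : ℤ, η ^ j.natAbs ≠ ⊤ := by
  lift η to NNReal using (hη.trans ENNReal.one_lt_top).ne
  have h1 : (η : ℝ) < 1 := by exact_mod_cast hη
  have hs : Summable fun j : ℤ => (η : ℝ) ^ j.natAbs := by
    refine Summable.of_nat_of_neg ?_ ?_ <;>
      simpa using summable_geometric_of_lt_one η.coe_nonneg h1
  have : Summable fun j : ℤ => η ^ j.natAbs := by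
    rw [← NNReal.summable_coe]; simpa using hs
  simpa using ENNReal.tsum_coe_ne_top_iff_summable.2 this

/-- Schur's test for a nonnegative matrix. -/
lemma tsum_rpow_sum_mul_le {q : ℝ} (hq : 1 ≤ q) (k : ℕ → ℕ → ℝ≥0∞) (s : Finset ℕ) {K : ℝ≥0∞}
    (h1 : ∀ m, ∑ n ∈ s, k m n ≤ K) (h2 : ∀ n, ∑' m, k m n ≤ K) (e : ℕ → ℝ≥0∞) :
    ∑' m, (∑ n ∈ s, k m n * e n) ^ q ≤ K ^ q * ∑ n ∈ s, e n ^ q := by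
  have hq0 : 0 < q := zero_lt_one.trans_le hq
  have hrow : ∀ m, (∑ n ∈ s, k m n * e n) ^ q ≤ K ^ (q - 1) * ∑ n ∈ s, k m n * e n ^ q := by
    intro m
    have h := ENNReal.rpow_le_rpow (ENNReal.inner_le_weight_mul_Lp_of_nonneg s hq (k m) e) hq0.le
    rw [ENNReal.mul_rpow_of_nonneg _ _ hq0.le, ← ENNReal.rpow_mul, ← ENNReal.rpow_mul,
      inv_mul_cancel₀ hq0.ne', ENNReal.rpow_one, sub_mul, one_mul, inv_mul_cancel₀ hq0.ne'] at h
    refine h.trans ?_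
    gcongr
    exact h1 m
  calc ∑' m, (∑ n ∈ s, k m n * e n) ^ q
      ≤ ∑' m, K ^ (q - 1) * ∑ n ∈ s, k m n * e n ^ q := ENNReal.tsum_le_tsum hrow
    _ = K ^ (q - 1) * ∑ n ∈ s, (∑' m, k m n) * e n ^ q := by
        rw [ENNReal.tsum_mul_left, Summable.tsum_finsetSum fun _ _ => ENNReal.summable]
        simp only [ENNReal.tsum_mul_right]
    _ ≤ K ^ (q - 1) * ∑ n ∈ s, K * e n ^ q := by
        gcongr with n
        exact h2 n
    _ = K ^ q * ∑ n ∈ s, e n ^ q := by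
        have : K ^ q = K ^ (q - 1) * K := by
          nth_rewrite 3 [← ENNReal.rpow_one K]
          rw [← ENNReal.rpow_add_of_nonneg _ _ (by linarith) zero_le_one, sub_add_cancel]
        rw [← Finset.mul_sum, ← mul_assoc, this]

lemma exists_tsum_dyadic_le {q q' : ℝ} (hq : q'.HolderConjugate q) :
    ∃ K : ℝ≥0∞, K ≠ ⊤ ∧ ∀ (d : ℕ → ℝ≥0∞) (N : ℕ),
      ∑' m : ℕ, (∑ n ∈ Finset.range N, d n * 2⁻¹ ^ (n - m)) ^ q * 2⁻¹ ^ m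
        ≤ K * ∑ n ∈ Finset.range N, d n ^ q * 2⁻¹ ^ n := by
  have hq0 := hq.pos
  have hq1 := hq.symm.pos
  set x : ℝ≥0∞ := 2⁻¹ ^ (1 / q) with hx
  set y : ℝ≥0∞ := 2⁻¹ ^ (1 / q') with hy
  have h2 : (2⁻¹ : ℝ≥0∞) < 1 := by simp
  have hxy : y * x = 2⁻¹ := by
    rw [hx, hy, ← ENNReal.rpow_add_of_nonneg _ _ (by positivity) (by positivity), one_div, one_div,
      hq.inv_add_inv_eq_one, ENNReal.rpow_one]
  have hxq : ∀ n : ℕ, (x ^ n) ^ q = 2⁻¹ ^ n := by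
    intro n
    rw [← ENNReal.rpow_natCast x, hx, ← ENNReal.rpow_mul, ← ENNReal.rpow_mul,
      ← ENNReal.rpow_natCast]
    congr 1
    field_simp
  set η : ℝ≥0∞ := max x y with hη
  have hη1 : η < 1 := max_lt (ENNReal.rpow_lt_one h2 (by positivity))
    (ENNReal.rpow_lt_one h2 (by positivity))
  set K := ∑' j : ℤ, η ^ j.natAbs with hK
  have hKt : K ≠ ⊤ := tsum_pow_natAbs_ne_top hη1
  refine ⟨K ^ q, ENNReal.rpow_ne_top_of_nonneg hq1.le hKt, fun d N => ?_⟩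
  set k : ℕ → ℕ → ℝ≥0∞ := fun m n => η ^ ((m : ℤ) - n).natAbs with hk
  have hrow : ∀ m, ∑ n ∈ Finset.range N, k m n ≤ K := fun m =>
    (ENNReal.sum_le_tsum _).trans (ENNReal.tsum_comp_le_tsum_of_injective
      (f := fun n : ℕ => (m : ℤ) - n) (fun a b h => by simpa using h) fun j => η ^ j.natAbs)
  have hcol : ∀ n, ∑' m, k m n ≤ K := fun n =>
    ENNReal.tsum_comp_le_tsum_of_injective
      (f := fun m : ℕ => (m : ℤ) - n) (fun a b h => by simpa using h) fun j => η ^ j.natAbs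
  have hker : ∀ m n : ℕ, 2⁻¹ ^ (n - m) * x ^ m ≤ k m n * x ^ n := by
    intro m n
    rcases le_total n m with h | h
    · have e : ((m : ℤ) - n).natAbs = m - n := by omega
      simp only [hk, e]
      rw [Nat.sub_eq_zero_of_le h, pow_zero, one_mul]
      calc x ^ m = x ^ (m - n) * x ^ n := by rw [← pow_add, Nat.sub_add_cancel h]
        _ ≤ _ := by gcongr; exact le_max_left _ _
    · have e : ((m : ℤ) - n).natAbs = n - m := by omega
      simp only [hk, e]
      calc 2⁻¹ ^ (n - m) * x ^ m = y ^ (n - m) * x ^ n := by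
            rw [← hxy, mul_pow, mul_assoc, ← pow_add, Nat.sub_add_cancel h]
        _ ≤ _ := by gcongr; exact le_max_right _ _
  calc ∑' m : ℕ, (∑ n ∈ Finset.range N, d n * 2⁻¹ ^ (n - m)) ^ q * 2⁻¹ ^ m
      ≤ ∑' m : ℕ, (∑ n ∈ Finset.range N, k m n * (d n * x ^ n)) ^ q := by
        refine ENNReal.tsum_le_tsum fun m => ?_
        rw [← hxq, ← ENNReal.mul_rpow_of_nonneg _ _ hq1.le, Finset.sum_mul]
        refine ENNReal.rpow_le_rpow (Finset.sum_le_sum fun n _ => ?_) hq1.le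
        calc d n * 2⁻¹ ^ (n - m) * x ^ m = d n * (2⁻¹ ^ (n - m) * x ^ m) := by ring
          _ ≤ d n * (k m n * x ^ n) := mul_le_mul' le_rfl (hker m n)
          _ = _ := by ring
    _ ≤ K ^ q * ∑ n ∈ Finset.range N, (d n * x ^ n) ^ q :=
        tsum_rpow_sum_mul_le hq.symm.lt.le k _ hrow hcol _
    _ = _ := by
        congr 1
        refine Finset.sum_congr rfl fun n _ => ?_
        rw [ENNReal.mul_rpow_of_nonneg _ _ hq1.le, hxq]

variable {ω : ℝ → ℝ}

/-- Radii along which `ω̂` is halved at each step. -/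
structure DyadicRadii (ω : ℝ → ℝ) (r : ℕ → ℝ) : Prop where
  zero : r 0 = 0
  mem : ∀ n, r n ∈ Ico (0:ℝ) 1
  value : ∀ n, omegaHat ω (r n) = omegaHat ω 0 * 2⁻¹ ^ n

lemma omegaHat_one (ω : ℝ → ℝ) : omegaHat ω 1 = 0 := intervalIntegral.integral_same

lemma IsRadialWeight.exists_dyadicRadii (hω : IsRadialWeight ω)
    (hpos : ∀ r ∈ Ico (0:ℝ) 1, 0 < omegaHat ω r) : ∃ r, DyadicRadii ω r := by
  have hA := hpos 0 ⟨le_rfl, zero_lt_one⟩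
  have h : ∀ n : ℕ, ∃ r ∈ Ico (0:ℝ) 1,
      omegaHat ω r = omegaHat ω 0 * 2⁻¹ ^ n ∧ (n = 0 → r = 0) := by
    intro n
    rcases n.eq_zero_or_pos with rfl | hn
    · exact ⟨0, ⟨le_rfl, zero_lt_one⟩, by simp, fun _ => rfl⟩
    · have hmem : omegaHat ω 0 * 2⁻¹ ^ n ∈ Icc (omegaHat ω 1) (omegaHat ω 0) := by
        rw [omegaHat_one]
        exact ⟨by positivity, mul_le_of_le_one_right hA.le (pow_le_one₀ (by norm_num)
          (by norm_num))⟩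
      obtain ⟨r, hr, hr'⟩ := intermediate_value_Icc' zero_le_one hω.continuousOn_omegaHat hmem
      refine ⟨r, ⟨hr.1, lt_of_le_of_ne hr.2 ?_⟩, hr', fun h => absurd h hn.ne'⟩
      rintro rfl
      rw [omegaHat_one] at hr'
      have : 0 < omegaHat ω 0 * 2⁻¹ ^ n := by positivity
      exact this.ne hr'
  choose r h1 h2 h3 using h
  exact ⟨r, h3 0 rfl, h1, h2⟩

variable {r : ℕ → ℝ}

lemma DyadicRadii.exists_mem (hω : IsRadialWeight ω)
    (hpos : ∀ r ∈ Ico (0:ℝ) 1, 0 < omegaHat ω r) (hr : DyadicRadii ω r) {x : ℝ}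
    (hx : x ∈ Ico (0:ℝ) 1) : ∃ m, x ∈ Ico (r m) (r (m + 1)) := by
  have hex : ∃ n, x < r n := by
    by_contra! h
    have ht : Tendsto (fun n : ℕ => omegaHat ω 0 * (2⁻¹:ℝ) ^ n) atTop (nhds (omegaHat ω 0 * 0)) :=
      (tendsto_pow_atTop_nhds_zero_of_lt_one (by norm_num) (by norm_num)).const_mul _
    have := ge_of_tendsto' ht fun n => by
      rw [← hr.value n]
      exact hω.omegaHat_anti (hr.mem n).1 (h n) hx.2.le
    rw [mul_zero] at this
    exact (hpos x hx).not_ge this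
  classical
  have h1 := Nat.find_spec hex
  have h0 : Nat.find hex ≠ 0 := by
    intro h
    rw [h, hr.zero] at h1
    exact hx.1.not_gt h1
  obtain ⟨m, hm⟩ := Nat.exists_eq_succ_of_ne_zero h0
  refine ⟨m, not_lt.1 (Nat.find_min hex (by omega)), ?_⟩
  rwa [hm] at h1

lemma IsRadialWeight.lintegral_Ico_le (hω : IsRadialWeight ω) {s : ℝ} (hs : s ∈ Ico (0:ℝ) 1) :
    ∫⁻ x in Ico s 1, ENNReal.ofReal (ω x) = ENNReal.ofReal (omegaHat ω s) := by
  have hi : IntegrableOn ω (Ico s 1) := hω.2.mono_set (Ico_subset_Ico_left hs.1)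
  rw [omegaHat_eq hs.2.le, ← integral_Ico_eq_integral_Ioo,
    ofReal_integral_eq_lintegral_ofReal hi]
  exact (ae_restrict_mem measurableSet_Ico).mono fun x hx => hω.1 x ⟨hs.1.trans hx.1, hx.2⟩

lemma DyadicRadii.lintegral_le (hω : IsRadialWeight ω)
    (hpos : ∀ r ∈ Ico (0:ℝ) 1, 0 < omegaHat ω r) (hr : DyadicRadii ω r) {Φ : ℝ → ℝ≥0∞}
    {B : ℕ → ℝ≥0∞} (hB : ∀ m, ∀ x ∈ Ico (r m) (r (m + 1)), Φ x ≤ B m) :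
    ∫⁻ x in Ioo (0:ℝ) 1, Φ x * ENNReal.ofReal (ω x)
      ≤ ENNReal.ofReal (omegaHat ω 0) * ∑' m, B m * 2⁻¹ ^ m := by
  have hsub : Ioo (0:ℝ) 1 ⊆ ⋃ m, Ico (r m) (r (m + 1)) := fun x hx =>
    mem_iUnion.2 (hr.exists_mem hω hpos ⟨hx.1.le, hx.2⟩)
  refine (lintegral_mono_set hsub).trans ((lintegral_iUnion_le _ _).trans ?_)
  rw [← ENNReal.tsum_mul_left]
  refine ENNReal.tsum_le_tsum fun m => ?_
  calc ∫⁻ x in Ico (r m) (r (m + 1)), Φ x * ENNReal.ofReal (ω x)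
      ≤ ∫⁻ x in Ico (r m) (r (m + 1)), B m * ENNReal.ofReal (ω x) :=
        setLIntegral_mono' measurableSet_Ico fun x hx => by gcongr; exact hB m x hx
    _ ≤ ∫⁻ x in Ico (r m) 1, B m * ENNReal.ofReal (ω x) :=
        lintegral_mono_set (Ico_subset_Ico_right (hr.mem (m + 1)).2.le)
    _ = B m * ENNReal.ofReal (omegaHat ω (r m)) := by
        rw [lintegral_const_mul'', hω.lintegral_Ico_le (hr.mem m)]
        exact ((hω.2.mono_set (Ico_subset_Ico_left (hr.mem m).1)).aemeasurable).ennreal_ofReal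
    _ = _ := by
        rw [hr.value, ENNReal.ofReal_mul' (by positivity), ENNReal.ofReal_pow (by norm_num),
          ENNReal.ofReal_inv_of_pos two_pos, ENNReal.ofReal_ofNat]
        ring

end Dyadic

section Functional

variable {ω : ℝ → ℝ} {q : ℝ} {f g : ℂ → ℂ}

lemma LpqNormE_rpow (hq : 0 < q) (hf : DifferentiableOn ℂ f (Metric.ball 0 1)) :
    LpqNormE ω 1 q f ^ q
      = ∫⁻ r in Ioo (0:ℝ) 1, ENNReal.ofReal (meanNorm f r) ^ q * ENNReal.ofReal (r * ω r) := by
  rw [LpqNormE, ← ENNReal.rpow_mul, one_div_mul_cancel hq.ne', ENNReal.rpow_one]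
  refine setLIntegral_congr_fun measurableSet_Ioo fun r hr => ?_
  rw [MpE_one_eq_meanNorm hf ⟨hr.1.le, hr.2⟩]

lemma meanNorm_le_of_forall_le (hf : DifferentiableOn ℂ f (Metric.ball 0 1)) {r B : ℝ}
    (hr : r ∈ Ico (0:ℝ) 1) (hB : ∀ z, ‖z‖ = r → ‖f z‖ ≤ B) : meanNorm f r ≤ B :=
  Real.circleAverage_mono_on_of_le_circle ((continuousOn_norm_sphere hf hr).circleIntegrable hr.1)
    fun z hz => hB z (by rwa [mem_sphere_zero_iff_norm, abs_of_nonneg hr.1] at hz)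

lemma meanNorm_sub_le (hf : DifferentiableOn ℂ f (Metric.ball 0 1))
    (hg : DifferentiableOn ℂ g (Metric.ball 0 1)) {r : ℝ} (hr : r ∈ Ico (0:ℝ) 1) :
    meanNorm (f - g) r ≤ meanNorm f r + meanNorm g r := by
  have h1 := (continuousOn_norm_sphere hf hr).circleIntegrable hr.1
  have h2 := (continuousOn_norm_sphere hg hr).circleIntegrable hr.1
  rw [meanNorm, meanNorm, meanNorm, ← Real.circleAverage_fun_add h1 h2]
  exact Real.circleAverage_mono ((continuousOn_norm_sphere (hf.sub hg) hr).circleIntegrable hr.1)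
    (h1.add h2) fun z _ => norm_sub_le _ _

lemma IsRadialWeight.LpqNormE_le (hω : IsRadialWeight ω) (hq : 0 < q)
    (hf : DifferentiableOn ℂ f (Metric.ball 0 1)) {B : ℝ}
    (hB : ∀ z, ‖z‖ < 1 → ‖f z‖ ≤ B) :
    LpqNormE ω 1 q f ≤ ENNReal.ofReal B * ENNReal.ofReal (omegaHat ω 0) ^ (1 / q) := by
  rw [← ENNReal.rpow_le_rpow_iff hq, ENNReal.mul_rpow_of_nonneg _ _ hq.le, ← ENNReal.rpow_mul,
    one_div_mul_cancel hq.ne', ENNReal.rpow_one, LpqNormE_rpow hq hf,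
    ← hω.lintegral_Ico_le ⟨le_rfl, zero_lt_one⟩,
    ← lintegral_const_mul' _ _ (ENNReal.rpow_ne_top_of_nonneg hq.le ENNReal.ofReal_ne_top)]
  refine (setLIntegral_mono' measurableSet_Ioo fun r hr => ?_).trans
    (lintegral_mono_set Ioo_subset_Ico_self)
  have hr' : r ∈ Ico (0:ℝ) 1 := ⟨hr.1.le, hr.2⟩
  gcongr
  · exact meanNorm_le_of_forall_le hf hr' fun z hz => hB z (hz ▸ hr.2)
  · nlinarith [hr.2, hω.1 r hr']

lemma IsRadialWeight.inApq_of_bounded (hω : IsRadialWeight ω) (hq : 0 < q)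
    (hf : DifferentiableOn ℂ f (Metric.ball 0 1)) {B : ℝ}
    (hB : ∀ z, ‖z‖ < 1 → ‖f z‖ ≤ B) : InApq ω 1 q f :=
  ⟨hf, (hω.LpqNormE_le hq hf hB).trans_lt (ENNReal.mul_lt_top ENNReal.ofReal_lt_top
    (ENNReal.rpow_lt_top_of_nonneg (by positivity) ENNReal.ofReal_ne_top))⟩

lemma IsRadialWeight.inApq_eval (hω : IsRadialWeight ω) (hq : 0 < q) (p : Polynomial ℂ) :
    InApq ω 1 q fun z => p.eval z := by
  obtain ⟨B, hB⟩ := (isCompact_closedBall (0:ℂ) 1).exists_bound_of_continuousOn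
    (f := fun z => p.eval z) (by fun_prop)
  exact hω.inApq_of_bounded hq (p.differentiable.differentiableOn) fun z hz =>
    hB z (by simpa using hz.le)

lemma IsRadialWeight.LpqNormE_one_pos (hω : IsRadialWeight ω)
    (hpos : ∀ r ∈ Ico (0:ℝ) 1, 0 < omegaHat ω r) (hq : 0 < q) :
    0 < LpqNormE ω 1 q fun _ => 1 := by
  rw [pos_iff_ne_zero]
  intro h
  have h1 := LpqNormE_rpow (ω := ω) hq (differentiableOn_const (𝕜 := ℂ) (s := Metric.ball 0 1)
    (1:ℂ))
  have h2 : ∀ r, meanNorm (fun _ => 1) r = 1 := fun r => by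
    simp [meanNorm, Real.circleAverage_const]
  have h3 := hω.natMoment_pos hpos 1
  have hi := hω.integrableOn_pow_mul 1
  have h0 : 0 ≤ᵐ[volume.restrict (Ioo 0 1)] fun r => r ^ 1 * ω r :=
    (ae_restrict_mem measurableSet_Ioo).mono fun r hr =>
      mul_nonneg (pow_nonneg hr.1.le 1) (hω.1 r ⟨hr.1.le, hr.2⟩)
  rw [h, ENNReal.zero_rpow_of_pos hq] at h1
  simp only [h2, ENNReal.ofReal_one, ENNReal.one_rpow, one_mul] at h1
  rw [natMoment, integral_eq_lintegral_of_nonneg_ae h0 hi.aestronglyMeasurable] at h3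
  simp only [pow_one, ← h1, ENNReal.toReal_zero, lt_irrefl] at h3

lemma differentiableOn_dilateF (hf : DifferentiableOn ℂ f (Metric.ball 0 1)) {ρ : ℝ}
    (hρ : ρ ∈ Icc (0:ℝ) 1) : DifferentiableOn ℂ (dilateF f ρ) (Metric.ball 0 1) := by
  refine hf.comp (by fun_prop) fun z hz => ?_
  rw [mem_ball_zero_iff] at hz ⊢
  rw [norm_mul, Complex.norm_real, Real.norm_of_nonneg hρ.1]
  exact (mul_le_of_le_one_left (norm_nonneg _) hρ.2).trans_lt hz

lemma meanNorm_dilateF_sub_le (hf : DifferentiableOn ℂ f (Metric.ball 0 1)) {r ρ : ℝ}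
    (hr : r ∈ Ico (0:ℝ) 1) (hρ : ρ ∈ Icc (0:ℝ) 1) :
    meanNorm (dilateF f ρ - f) r ≤ 2 * meanNorm f r := by
  have h := meanNorm_sub_le (differentiableOn_dilateF hf hρ) hf hr
  have h1 : ρ * r ≤ r := mul_le_of_le_one_left hr.1 hρ.2
  have := monotoneOn_meanNorm hf ⟨mul_nonneg hρ.1 hr.1, h1.trans_lt hr.2⟩ hr h1
  rw [meanNorm_dilateF] at h
  linarith

lemma tendsto_meanNorm_dilateF_sub (hf : DifferentiableOn ℂ f (Metric.ball 0 1)) {r : ℝ}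
    (hr : r ∈ Ico (0:ℝ) 1) {ρ : ℕ → ℝ} (hρ : ∀ n, ρ n ∈ Icc (0:ℝ) 1)
    (hl : Tendsto ρ atTop (nhds 1)) :
    Tendsto (fun n => meanNorm (dilateF f (ρ n) - f) r) atTop (nhds 0) := by
  have hsub : Metric.closedBall (0:ℂ) r ⊆ Metric.ball 0 1 := Metric.closedBall_subset_ball hr.2
  have hu := (isCompact_closedBall (0:ℂ) r).uniformContinuousOn_of_continuous
    (hf.continuousOn.mono hsub)
  rw [Metric.tendsto_atTop]
  intro ε hε
  obtain ⟨δ, hδ, h⟩ := Metric.uniformContinuousOn_iff.1 hu (ε / 2) (half_pos hε)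
  obtain ⟨N, hN⟩ := Metric.tendsto_atTop.1 hl δ hδ
  refine ⟨N, fun n hn => ?_⟩
  rw [dist_zero_right, Real.norm_of_nonneg (meanNorm_nonneg _ _)]
  refine lt_of_le_of_lt (meanNorm_le_of_forall_le ((differentiableOn_dilateF hf (hρ n)).sub hf) hr
    fun z hz => ?_) (half_lt_self hε)
  have hz' : ‖(ρ n : ℂ) * z‖ ≤ r := by
    rw [norm_mul, hz, Complex.norm_real, Real.norm_of_nonneg (hρ n).1]
    exact mul_le_of_le_one_left hr.1 (hρ n).2
  have hd : dist ((ρ n : ℂ) * z) z < δ := by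
    have h1 := hN n hn
    have e : (ρ n : ℂ) * z - z = ((ρ n - 1 : ℝ) : ℂ) * z := by push_cast; ring
    rw [Real.dist_eq] at h1
    rw [dist_eq_norm, e, norm_mul, hz, Complex.norm_real, Real.norm_eq_abs]
    exact (mul_le_of_le_one_right (abs_nonneg _) hr.2.le).trans_lt h1
  have := h _ (by simpa using hz') z (by simpa using hz.le) hd
  rw [dist_eq_norm] at this
  exact this.le

lemma inApq_dilateF_sub (hq : 0 < q) (hf : InApq ω 1 q f) {ρ : ℝ} (hρ : ρ ∈ Icc (0:ℝ) 1) :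
    InApq ω 1 q (dilateF f ρ - f) := by
  refine ⟨(differentiableOn_dilateF hf.1 hρ).sub hf.1, ?_⟩
  have h1 : LpqNormE ω 1 q (dilateF f ρ - f) ^ q ≤ ENNReal.ofReal 2 ^ q * LpqNormE ω 1 q f ^ q := by
    rw [LpqNormE_rpow hq hf.1, LpqNormE_rpow hq ((differentiableOn_dilateF hf.1 hρ).sub hf.1),
      ← lintegral_const_mul' _ _ (ENNReal.rpow_ne_top_of_nonneg hq.le ENNReal.ofReal_ne_top)]
    refine setLIntegral_mono' measurableSet_Ioo fun r hr => ?_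
    rw [← mul_assoc, ← ENNReal.mul_rpow_of_nonneg _ _ hq.le, ← ENNReal.ofReal_mul zero_le_two]
    gcongr
    exact meanNorm_dilateF_sub_le hf.1 ⟨hr.1.le, hr.2⟩ hρ
  by_contra hc
  rw [not_lt, top_le_iff] at hc
  rw [hc, ENNReal.top_rpow_of_pos hq, top_le_iff] at h1
  exact ENNReal.mul_ne_top (ENNReal.rpow_ne_top_of_nonneg hq.le ENNReal.ofReal_ne_top)
    (ENNReal.rpow_ne_top_of_nonneg hq.le hf.2.ne) h1

/-- Dilations converge in `A^{1,q}_ω`. -/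
lemma IsRadialWeight.tendsto_LpqNormE_dilateF_sub (hω : IsRadialWeight ω) (hq : 0 < q)
    (hf : InApq ω 1 q f) {ρ : ℕ → ℝ} (hρ : ∀ n, ρ n ∈ Icc (0:ℝ) 1)
    (hl : Tendsto ρ atTop (nhds 1)) :
    Tendsto (fun n => LpqNormE ω 1 q (dilateF f (ρ n) - f)) atTop (nhds 0) := by
  have hd : ∀ n, DifferentiableOn ℂ (dilateF f (ρ n) - f) (Metric.ball 0 1) := fun n =>
    (differentiableOn_dilateF hf.1 (hρ n)).sub hf.1
  have hm : AEMeasurable (fun r => ENNReal.ofReal (r * ω r)) (volume.restrict (Ioo 0 1)) :=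
    (aemeasurable_id.mul hω.integrableOn_Ioo.aemeasurable).ennreal_ofReal
  have h : Tendsto (fun n => ∫⁻ r in Ioo (0:ℝ) 1,
      ENNReal.ofReal (meanNorm (dilateF f (ρ n) - f) r) ^ q * ENNReal.ofReal (r * ω r)) atTop
      (nhds (∫⁻ r in Ioo (0:ℝ) 1, 0)) := by
    refine tendsto_lintegral_of_dominated_convergence'
      (fun r => ENNReal.ofReal 2 ^ q *
        (ENNReal.ofReal (meanNorm f r) ^ q * ENNReal.ofReal (r * ω r)))
      (fun n => ((aemeasurable_meanNorm (hd n)).ennreal_ofReal.pow_const _).mul hm) (fun n => ?_)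
      ?_ ?_
    · refine (ae_restrict_mem measurableSet_Ioo).mono fun r hr => ?_
      simp only
      rw [← mul_assoc, ← ENNReal.mul_rpow_of_nonneg _ _ hq.le, ← ENNReal.ofReal_mul zero_le_two]
      gcongr
      exact meanNorm_dilateF_sub_le hf.1 ⟨hr.1.le, hr.2⟩ (hρ n)
    · rw [lintegral_const_mul' _ _ (ENNReal.rpow_ne_top_of_nonneg hq.le ENNReal.ofReal_ne_top),
        ← LpqNormE_rpow hq hf.1]
      exact ENNReal.mul_ne_top (ENNReal.rpow_ne_top_of_nonneg hq.le ENNReal.ofReal_ne_top)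
        (ENNReal.rpow_ne_top_of_nonneg hq.le hf.2.ne)
    · refine (ae_restrict_mem measurableSet_Ioo).mono fun r hr => ?_
      have h1 := ENNReal.tendsto_ofReal
        (tendsto_meanNorm_dilateF_sub hf.1 ⟨hr.1.le, hr.2⟩ hρ hl)
      have h2 := (ENNReal.continuous_rpow_const (y := q)).tendsto _ |>.comp h1
      rw [ENNReal.ofReal_zero, ENNReal.zero_rpow_of_pos hq] at h2
      simpa using ENNReal.Tendsto.mul_const h2 (Or.inr ENNReal.ofReal_ne_top)
  simp only [← LpqNormE_rpow hq (hd _), lintegral_zero] at h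
  have h2 := (ENNReal.continuous_rpow_const (y := 1 / q)).tendsto _ |>.comp h
  rw [ENNReal.zero_rpow_of_pos (by positivity)] at h2
  refine h2.congr fun n => ?_
  simp only [Function.comp]
  rw [← ENNReal.rpow_mul, mul_one_div_cancel hq.ne', ENNReal.rpow_one]

variable {L : (ℂ → ℂ) → ℂ} {M : ℝ}

lemma IsRadialWeight.bound_nonneg (hω : IsRadialWeight ω)
    (hpos : ∀ r ∈ Ico (0:ℝ) 1, 0 < omegaHat ω r) (hq : 0 < q)
    (hM : ∀ f, InApq ω 1 q f → ‖L f‖ ≤ M * (LpqNormE ω 1 q f).toReal) : 0 ≤ M := by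
  have h1 : InApq ω 1 q fun _ => 1 := by simpa using hω.inApq_eval hq 1
  have h2 : 0 < (LpqNormE ω 1 q fun _ => 1).toReal :=
    ENNReal.toReal_pos (hω.LpqNormE_one_pos hpos hq).ne' h1.2.ne
  exact nonneg_of_mul_nonneg_left ((norm_nonneg _).trans (hM _ h1)) h2

lemma IsRadialWeight.norm_apply_le (hω : IsRadialWeight ω) (hq : 0 < q) (hM0 : 0 ≤ M)
    (hM : ∀ f, InApq ω 1 q f → ‖L f‖ ≤ M * (LpqNormE ω 1 q f).toReal)
    (hf : DifferentiableOn ℂ f (Metric.ball 0 1)) {B : ℝ} (hB0 : 0 ≤ B)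
    (hB : ∀ z, ‖z‖ < 1 → ‖f z‖ ≤ B) :
    ‖L f‖ ≤ M * (omegaHat ω 0) ^ (1 / q) * B := by
  have hA := hω.omegaHat_nonneg le_rfl zero_le_one
  refine (hM f (hω.inApq_of_bounded hq hf hB)).trans ?_
  rw [mul_assoc]
  refine mul_le_mul_of_nonneg_left (ENNReal.toReal_le_of_le_ofReal (by positivity) ?_) hM0
  rw [mul_comm, ENNReal.ofReal_mul hB0, ← ENNReal.ofReal_rpow_of_nonneg hA (by positivity)]
  exact hω.LpqNormE_le hq hf hB

lemma IsRadialWeight.norm_apply_pow_le (hω : IsRadialWeight ω) (hq : 0 < q) (hM0 : 0 ≤ M)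
    (hM : ∀ f, InApq ω 1 q f → ‖L f‖ ≤ M * (LpqNormE ω 1 q f).toReal) (k : ℕ) :
    ‖L fun z => z ^ k‖ ≤ M * (omegaHat ω 0) ^ (1 / q) := by
  have := hω.norm_apply_le (f := fun z => z ^ k) hq hM0 hM (by fun_prop) zero_le_one
    fun z hz => by
      rw [norm_pow]; exact pow_le_one₀ (norm_nonneg _) hz.le
  rwa [mul_one] at this

lemma IsRadialWeight.coeffPair_apply (hω : IsRadialWeight ω) (hq : 0 < q)
    (hL : IsLinearOn (InApq ω 1 q) L) (p : Polynomial ℂ) :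
    L (fun z => p.eval z) = coeffPair p fun k => conj (L fun z => z ^ k) := by
  induction p using Polynomial.induction_on' with
  | add p r hp hr =>
    rw [coeffPair_add, ← hp, ← hr, ← hL.1 _ _ (hω.inApq_eval hq p) (hω.inApq_eval hq r)]
    simp only [eval_add]
    rfl
  | monomial k a =>
    have h : InApq ω 1 q fun z => z ^ k := by simpa using hω.inApq_eval hq (X ^ k)
    rw [coeffPair_monomial, Complex.conj_conj, ← hL.2 a _ h]
    simp only [eval_monomial]
    rfl

lemma IsRadialWeight.hasSum_apply_dilateF (hω : IsRadialWeight ω) (hq : 0 < q)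
    (hL : IsLinearOn (InApq ω 1 q) L) (hM0 : 0 ≤ M)
    (hM : ∀ f, InApq ω 1 q f → ‖L f‖ ≤ M * (LpqNormE ω 1 q f).toReal)
    (hf : DifferentiableOn ℂ f (Metric.ball 0 1)) {ρ : ℝ} (hρ : ρ ∈ Ico (0:ℝ) 1) :
    HasSum (fun k => taylorCoeff f k * (ρ:ℂ) ^ k * L fun z => z ^ k) (L (dilateF f ρ)) := by
  set a : ℕ → ℂ := fun k => taylorCoeff f k * (ρ:ℂ) ^ k
  have ha : Summable fun k => ‖a k‖ := summable_norm_taylorCoeff hf hρ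
  have hF : ∀ z : ℂ, ‖z‖ ≤ 1 → HasSum (fun k => a k * z ^ k) (dilateF f ρ z) := fun z hz =>
    hasSum_taylorCoeff_dilateF hf hρ hz
  have hs : Summable fun k => a k * L fun z => z ^ k := by
    refine Summable.of_norm_bounded (ha.mul_right (M * (omegaHat ω 0) ^ (1 / q))) fun k => ?_
    rw [norm_mul]
    exact mul_le_mul_of_nonneg_left (hω.norm_apply_pow_le hq hM0 hM k) (norm_nonneg _)
  have hfd := differentiableOn_dilateF hf ⟨hρ.1, hρ.2.le⟩
  have hlim : Tendsto (fun N => ∑ k ∈ Finset.range N, a k * L fun z => z ^ k) atTop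
      (nhds (L (dilateF f ρ))) := by
    rw [tendsto_iff_norm_sub_tendsto_zero]
    have ht := (tendsto_tailSum a).const_mul (M * (omegaHat ω 0) ^ (1 / q))
    rw [mul_zero] at ht
    refine squeeze_zero (fun _ => norm_nonneg _) (fun N => ?_) ht
    set p := truncPoly a N with hp
    have hp1 := hω.inApq_eval hq p
    have hdiff : DifferentiableOn ℂ (dilateF f ρ - fun z => p.eval z) (Metric.ball 0 1) :=
      hfd.sub hp1.1
    have hb : ∀ z : ℂ, ‖z‖ < 1 → ‖(dilateF f ρ - fun z => p.eval z) z‖ ≤ tailSum a N :=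
      fun z hz => norm_sub_eval_truncPoly_le ha hF N hz.le
    have h1 := hω.norm_apply_le hq hM0 hM hdiff (tailSum_nonneg a N) hb
    have h2 := hL.1 _ _ (hω.inApq_of_bounded hq hdiff hb) hp1
    rw [sub_add_cancel, hω.coeffPair_apply hq hL, hp, coeffPair_truncPoly_left] at h2
    simp only [Complex.conj_conj] at h2
    rw [norm_sub_rev, h2, add_sub_cancel_right]
    exact h1
  rw [← tendsto_nhds_unique hs.hasSum.tendsto_sum_nat hlim]
  exact hs.hasSum

/-- The coefficients of the analytic function representing the functional `L`. -/
def reprCoeff (ω : ℝ → ℝ) (L : (ℂ → ℂ) → ℂ) (k : ℕ) : ℂ :=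
  conj (L fun z => z ^ k) / ((natMoment ω (2 * k + 1) : ℝ) : ℂ)

/-- The analytic function representing the functional `L`. -/
def reprFun (ω : ℝ → ℝ) (L : (ℂ → ℂ) → ℂ) (z : ℂ) : ℂ := ∑' k, reprCoeff ω L k * z ^ k

lemma IsRadialWeight.summable_norm_reprCoeff (hω : IsRadialWeight ω)
    (hpos : ∀ r ∈ Ico (0:ℝ) 1, 0 < omegaHat ω r) (hq : 0 < q) (hM0 : 0 ≤ M)
    (hM : ∀ f, InApq ω 1 q f → ‖L f‖ ≤ M * (LpqNormE ω 1 q f).toReal) {ρ : ℝ}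
    (hρ : ρ ∈ Ico (0:ℝ) 1) : Summable fun k => ‖reprCoeff ω L k‖ * ρ ^ k := by
  set r := √((1 + ρ) / 2) with hr
  have h0 : 0 < (1 + ρ) / 2 := by linarith [hρ.1]
  have hr0 : 0 < r := Real.sqrt_pos.2 h0
  have hr2 : r ^ 2 = (1 + ρ) / 2 := Real.sq_sqrt h0.le
  have hr1 : r < 1 := by
    rw [hr, Real.sqrt_lt' one_pos]; linarith [hρ.2]
  have hA := hω.omegaHat_nonneg le_rfl zero_le_one
  have hw := hpos r ⟨hr0.le, hr1⟩
  have hgeo : Summable fun k : ℕ =>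
      M * (omegaHat ω 0) ^ (1 / q) / (r * omegaHat ω r) * (ρ / r ^ 2) ^ k := by
    refine (summable_geometric_of_lt_one (div_nonneg hρ.1 (sq_nonneg r)) ?_).mul_left _
    rw [div_lt_one (by positivity), hr2]
    linarith [hρ.2]
  refine Summable.of_nonneg_of_le (fun k => mul_nonneg (norm_nonneg _) (pow_nonneg hρ.1 k))
    (fun k => ?_) hgeo
  have hwk := hω.natMoment_pos hpos (2 * k + 1)
  have h1 : ‖reprCoeff ω L k‖ ≤ M * (omegaHat ω 0) ^ (1 / q) / (r ^ (2 * k + 1) * omegaHat ω r) := by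
    rw [reprCoeff, norm_div, RCLike.norm_conj, Complex.norm_real, Real.norm_of_nonneg hwk.le]
    gcongr
    · exact hω.norm_apply_pow_le hq hM0 hM k
    · exact hω.pow_mul_omegaHat_le ⟨hr0.le, hr1⟩ _
  calc ‖reprCoeff ω L k‖ * ρ ^ k
      ≤ M * (omegaHat ω 0) ^ (1 / q) / (r ^ (2 * k + 1) * omegaHat ω r) * ρ ^ k :=
        mul_le_mul_of_nonneg_right h1 (pow_nonneg hρ.1 k)
    _ = _ := by
        rw [div_pow, ← pow_mul, pow_succ]
        field_simp

lemma differentiableOn_tsum_mul_pow {c : ℕ → ℂ}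
    (hc : ∀ ρ ∈ Ico (0:ℝ) 1, Summable fun k => ‖c k‖ * ρ ^ k) :
    DifferentiableOn ℂ (fun z : ℂ => ∑' k, c k * z ^ k) (Metric.ball 0 1) := by
  intro z hz
  rw [mem_ball_zero_iff] at hz
  obtain ⟨ρ, h1, h2⟩ := exists_between hz
  have h0 : 0 ≤ ρ := (norm_nonneg z).trans h1.le
  have : DifferentiableOn ℂ (fun z : ℂ => ∑' k, c k * z ^ k) (Metric.ball 0 ρ) := by
    refine Complex.differentiableOn_tsum_of_summable_norm (hc ρ ⟨h0, h2⟩) (fun k => by fun_prop)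
      Metric.isOpen_ball fun k x hx => ?_
    rw [norm_mul, norm_pow]
    rw [mem_ball_zero_iff] at hx
    gcongr
  exact ((this z (by simpa using h1)).differentiableAt
    (Metric.isOpen_ball.mem_nhds (by simpa using h1))).differentiableWithinAt

lemma taylorCoeff_tsum {c : ℕ → ℂ}
    (hc : ∀ ρ ∈ Ico (0:ℝ) 1, Summable fun k => ‖c k‖ * ρ ^ k) (n : ℕ) :
    taylorCoeff (fun z : ℂ => ∑' k, c k * z ^ k) n = c n := by
  set g : ℂ → ℂ := fun z => ∑' k, c k * z ^ k
  have hg : DifferentiableOn ℂ g (Metric.ball 0 1) := differentiableOn_tsum_mul_pow hc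
  have h1 : HasFPowerSeriesAt g (FormalMultilinearSeries.ofScalars ℂ c) 0 := by
    rw [hasFPowerSeriesAt_iff]
    filter_upwards [Metric.ball_mem_nhds (0:ℂ) one_pos] with z hz
    rw [mem_ball_zero_iff] at hz
    simp only [FormalMultilinearSeries.coeff_ofScalars, smul_eq_mul, zero_add, mul_comm (z ^ _)]
    have hs : Summable fun k => c k * z ^ k := by
      refine Summable.of_norm ?_
      simpa only [norm_mul, norm_pow] using hc ‖z‖ ⟨norm_nonneg z, hz⟩
    exact hs.hasSum
  have h2 : HasFPowerSeriesAt g (FormalMultilinearSeries.ofScalars ℂ (taylorCoeff g)) 0 := by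
    rw [hasFPowerSeriesAt_iff]
    filter_upwards [Metric.ball_mem_nhds (0:ℂ) one_pos] with z hz
    rw [mem_ball_zero_iff] at hz
    simp only [FormalMultilinearSeries.coeff_ofScalars, smul_eq_mul, zero_add, mul_comm (z ^ _)]
    exact hasSum_taylorCoeff hg hz
  have h := congrArg (fun p => p.coeff n) (h2.eq_formalMultilinearSeries h1)
  simpa only [FormalMultilinearSeries.coeff_ofScalars] using h

/-- The functional `L` is represented by `reprFun ω L`. -/
lemma IsRadialWeight.hasPairingC_reprFun (hω : IsRadialWeight ω)
    (hpos : ∀ r ∈ Ico (0:ℝ) 1, 0 < omegaHat ω r) (hq : 0 < q)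
    (hL : IsLinearOn (InApq ω 1 q) L) (hM0 : 0 ≤ M)
    (hM : ∀ f, InApq ω 1 q f → ‖L f‖ ≤ M * (LpqNormE ω 1 q f).toReal) (hf : InApq ω 1 q f) :
    HasPairingC (momentCoeff ω) f (reprFun ω L) (L f) := by
  have hc : ∀ k, taylorCoeff (reprFun ω L) k = reprCoeff ω L k :=
    taylorCoeff_tsum fun ρ hρ => hω.summable_norm_reprCoeff hpos hq hM0 hM hρ
  have e : ∀ (ρ : ℝ) k, taylorCoeff f k * conj (taylorCoeff (reprFun ω L) k) *
      ((momentCoeff ω k : ℝ) : ℂ) * (ρ:ℂ) ^ k = taylorCoeff f k * (ρ:ℂ) ^ k * L fun z => z ^ k := by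
    intro ρ k
    have : ((natMoment ω (2 * k + 1) : ℝ) : ℂ) ≠ 0 := by
      exact_mod_cast (hω.natMoment_pos hpos (2 * k + 1)).ne'
    rw [hc, reprCoeff, momentCoeff_eq, map_div₀, Complex.conj_conj, Complex.conj_ofReal]
    field_simp
  have hs : ∀ ρ ∈ Ico (0:ℝ) 1, HasSum (fun k => taylorCoeff f k *
      conj (taylorCoeff (reprFun ω L) k) * ((momentCoeff ω k : ℝ) : ℂ) * (ρ:ℂ) ^ k)
      (L (dilateF f ρ)) := by
    intro ρ hρ
    simp only [e]
    exact hω.hasSum_apply_dilateF hq hL hM0 hM hf.1 hρ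
  have hmem : ∀ᶠ ρ : ℝ in nhdsWithin 1 (Iio 1), ρ ∈ Ico (0:ℝ) 1 := Ico_mem_nhdsLT zero_lt_one
  refine ⟨fun ρ hρ => (hs ρ hρ).summable, ?_⟩
  have hlim : Tendsto (fun ρ => L (dilateF f ρ)) (nhdsWithin 1 (Iio 1)) (nhds (L f)) := by
    refine tendsto_of_seq_tendsto fun x hx => ?_
    obtain ⟨N, hN⟩ := eventually_atTop.1 (hx.eventually hmem)
    have hx1 : Tendsto x atTop (nhds 1) := hx.mono_right nhdsWithin_le_nhds
    have hρ : ∀ n, x (n + N) ∈ Icc (0:ℝ) 1 := fun n =>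
      Ico_subset_Icc_self (hN _ (Nat.le_add_left N n))
    have h1 := hω.tendsto_LpqNormE_dilateF_sub hq hf hρ ((tendsto_add_atTop_iff_nat N).2 hx1)
    have h2 := ((ENNReal.tendsto_toReal ENNReal.zero_ne_top).comp h1).const_mul M
    rw [ENNReal.toReal_zero, mul_zero] at h2
    rw [← tendsto_add_atTop_iff_nat N, tendsto_iff_norm_sub_tendsto_zero]
    refine squeeze_zero (fun _ => norm_nonneg _) (fun n => ?_) h2
    have hd := inApq_dilateF_sub hq hf (hρ n)
    have h3 := hL.1 _ _ hd hf
    rw [sub_add_cancel] at h3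
    simp only [Function.comp]
    rw [h3, add_sub_cancel_right]
    exact hM _ hd
  exact hlim.congr' (hmem.mono fun ρ hρ => (hs ρ hρ).tsum_eq.symm)

end Functional

section NormBound

variable {ω : ℝ → ℝ} {q q' : ℝ}

lemma coeffPair_sum {ι : Type*} (s : Finset ι) (p : ι → Polynomial ℂ) (b : ℕ → ℂ) :
    coeffPair (∑ i ∈ s, p i) b = ∑ i ∈ s, coeffPair (p i) b := by
  classical
  induction s using Finset.induction_on with
  | empty => simp [coeffPair_zero]
  | insert i s hi ih => rw [Finset.sum_insert hi, Finset.sum_insert hi, coeffPair_add, ih]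

lemma coeffPair_coeffMul (a : ℕ → ℝ) (p : Polynomial ℂ) (b : ℕ → ℂ) :
    coeffPair (coeffMul a p) b = coeffPair p fun k => a k * b k := by
  rw [coeffMul, coeffPair_sum, coeffPair, Polynomial.sum_over_range _ (by simp)]
  refine Finset.sum_congr rfl fun k _ => ?_
  rw [coeffPair_monomial, map_mul, Complex.conj_ofReal]
  ring

lemma coeffMul_mulSeq_comp (s ρ : ℝ) (p : Polynomial ℂ) :
    (coeffMul (mulSeq ω s) p).comp (C (ρ:ℂ) * X) = coeffMul (mulSeq ω (s * ρ)) p := by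
  ext k
  rw [comp_C_mul_X_coeff, coeff_coeffMul, coeff_coeffMul, mulSeq, mulSeq, mul_pow]
  push_cast
  ring

lemma IsRadialWeight.M1_coeffMul_mulSeq_le' (hω : IsRadialWeight ω)
    (hpos : ∀ r ∈ Ico (0:ℝ) 1, 0 < omegaHat ω r) {C : ℝ} (hC0 : 0 < C)
    (hC : ∀ r ∈ Ico (0:ℝ) 1, omegaHat ω r ≤ C * omegaHat ω ((1 + r) / 2))
    {s ρ : ℝ} (hs : s ∈ Ico (0:ℝ) 1) (hρ : ρ ∈ Icc (0:ℝ) 1) {p : Polynomial ℂ}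
    (hp : M1 p 1 ≤ 1) :
    M1 (coeffMul (mulSeq ω s) p) ρ
      ≤ (128 * C + 32) * (5 * C ^ 2) / max (omegaHat ω s) (omegaHat ω ρ) := by
  have h1 : s * ρ ≤ s := mul_le_of_le_one_right hs.1 hρ.2
  have h2 : s * ρ ≤ ρ := mul_le_of_le_one_left hρ.1 hs.2.le
  have h0 : 0 ≤ s * ρ := mul_nonneg hs.1 hρ.1
  have hsρ : s * ρ ∈ Ico (0:ℝ) 1 := ⟨h0, h1.trans_lt hs.2⟩
  rw [← M1_comp_C_mul_X, coeffMul_mulSeq_comp]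
  refine (hω.M1_coeffMul_mulSeq_le hpos hC0 hC hsρ p).trans ?_
  have hpos' := hpos _ hsρ
  refine (mul_le_of_le_one_right (by positivity) hp).trans ?_
  refine div_le_div_of_nonneg_left (by positivity) (lt_max_of_lt_left (hpos s hs)) (max_le ?_ ?_)
  · exact hω.omegaHat_anti h0 h1 hs.2.le
  · exact hω.omegaHat_anti h0 h2 hρ.2

lemma exists_half_dualE_le {b : ℕ → ℂ} (hb : dualE b ≠ ⊤) :
    ∃ p, M1 p 1 ≤ 1 ∧ (dualE b).toReal / 2 ≤ (coeffPair p b).re := by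
  rcases eq_or_ne (dualE b) 0 with h | h
  · exact ⟨0, by simp [M1_zero], by simp [h, coeffPair_zero]⟩
  obtain ⟨p, hp⟩ := lt_iSup_iff.1 (ENNReal.half_lt_self h hb)
  obtain ⟨hp1, hp2⟩ := lt_iSup_iff.1 hp
  have h1 : (dualE b).toReal / 2 ≤ ‖coeffPair p b‖ := by
    have := (ENNReal.toReal_le_of_le_ofReal (norm_nonneg _) hp2.le)
    rwa [ENNReal.toReal_div, ENNReal.toReal_ofNat] at this
  have h2 : 0 < ‖coeffPair p b‖ := (half_pos (ENNReal.toReal_pos h hb)).trans_le h1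
  refine ⟨Polynomial.C (conj (coeffPair p b) / ‖coeffPair p b‖) * p, ?_, ?_⟩
  · rw [M1_C_mul, norm_div, RCLike.norm_conj, Complex.norm_real, norm_norm, div_self h2.ne',
      one_mul]
    exact hp1
  · have e : conj (coeffPair p b) / (‖coeffPair p b‖ : ℂ) * coeffPair p b
        = ((‖coeffPair p b‖ : ℝ) : ℂ) := by
      have : ((‖coeffPair p b‖ : ℝ) : ℂ) ≠ 0 := by exact_mod_cast h2.ne'
      rw [div_mul_eq_mul_div, div_eq_iff this, mul_comm, Complex.mul_conj']
      ring
    rw [coeffPair_C_mul, e, Complex.ofReal_re]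
    exact h1

/-- Superposition of smoothed extremal polynomials along the dyadic radii. -/
lemma DyadicRadii.LpqNormE_sum_rpow_le {r : ℕ → ℝ} (hr : DyadicRadii ω r) (hω : IsRadialWeight ω)
    (hpos : ∀ r ∈ Ico (0:ℝ) 1, 0 < omegaHat ω r) {C : ℝ} (hC0 : 0 < C)
    (hC : ∀ r ∈ Ico (0:ℝ) 1, omegaHat ω r ≤ C * omegaHat ω ((1 + r) / 2))
    (hq : 0 < q) {p : ℕ → Polynomial ℂ} (hp : ∀ n, M1 (p n) 1 ≤ 1) {d : ℕ → ℝ}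
    (hd : ∀ n, 0 ≤ d n) (N : ℕ) :
    LpqNormE ω 1 q (fun z => (∑ n ∈ Finset.range N, Polynomial.C ((d n * 2⁻¹ ^ n : ℝ) : ℂ) *
        coeffMul (mulSeq ω (r n)) (p n)).eval z) ^ q
      ≤ ENNReal.ofReal (omegaHat ω 0) *
        (ENNReal.ofReal (2 * ((128 * C + 32) * (5 * C ^ 2)) / omegaHat ω 0) ^ q *
        ∑' m, (∑ n ∈ Finset.range N, ENNReal.ofReal (d n) * 2⁻¹ ^ (n - m)) ^ q * 2⁻¹ ^ m) := by
  have hA := hpos 0 ⟨le_rfl, zero_lt_one⟩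
  set A := omegaHat ω 0
  set K := (128 * C + 32) * (5 * C ^ 2) with hK
  have hK0 : 0 < K := by positivity
  set F : Polynomial ℂ := ∑ n ∈ Finset.range N, Polynomial.C ((d n * 2⁻¹ ^ n : ℝ) : ℂ) *
        coeffMul (mulSeq ω (r n)) (p n) with hF
  have hFM : ∀ m, ∀ x ∈ Ico (r m) (r (m + 1)),
      M1 F x ≤ 2 * K / A * ∑ n ∈ Finset.range N, d n * 2⁻¹ ^ (n - m) := by
    intro m x hx
    have hx1 : x < 1 := hx.2.trans (hr.mem _).2
    have hx0 : 0 ≤ x := (hr.mem m).1.trans hx.1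
    rw [hF, Finset.mul_sum]
    refine (M1_sum_le _ _ _).trans (Finset.sum_le_sum fun n _ => ?_)
    rw [M1_C_mul, Complex.norm_real, Real.norm_of_nonneg (mul_nonneg (hd n) (by positivity))]
    have h1 := hω.M1_coeffMul_mulSeq_le' hpos hC0 hC (hr.mem n) ⟨hx0, hx1.le⟩ (hp n)
    have h2 : A * 2⁻¹ ^ (m + 1) ≤ omegaHat ω x := by
      rw [← hr.value]
      exact hω.omegaHat_anti hx0 hx.2.le (hr.mem _).2.le
    have h3 : A * 2⁻¹ ^ n / (2 * 2⁻¹ ^ (n - m)) ≤ max (omegaHat ω (r n)) (omegaHat ω x) := by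
      rcases le_total n m with h | h
      · refine le_max_of_le_left ?_
        rw [Nat.sub_eq_zero_of_le h, hr.value]
        exact div_le_self (by positivity) (by norm_num)
      · refine le_max_of_le_right (le_trans (le_of_eq ?_) h2)
        obtain ⟨k, rfl⟩ := Nat.exists_eq_add_of_le h
        rw [Nat.add_sub_cancel_left, pow_add, pow_succ]
        field_simp
    calc d n * 2⁻¹ ^ n * M1 (coeffMul (mulSeq ω (r n)) (p n)) x
        ≤ d n * 2⁻¹ ^ n * (K / (A * 2⁻¹ ^ n / (2 * 2⁻¹ ^ (n - m)))) := by
          refine mul_le_mul_of_nonneg_left (h1.trans ?_) (mul_nonneg (hd n) (by positivity))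
          exact div_le_div_of_nonneg_left hK0.le (by positivity) h3
      _ = _ := by field_simp
  rw [LpqNormE_rpow hq F.differentiable.differentiableOn]
  have hKq : ∀ m, ∀ x ∈ Ico (r m) (r (m + 1)),
      ENNReal.ofReal (meanNorm (fun z => F.eval z) x) ^ q
        ≤ (ENNReal.ofReal (2 * K / A) *
          ∑ n ∈ Finset.range N, ENNReal.ofReal (d n) * 2⁻¹ ^ (n - m)) ^ q := by
    intro m x hx
    refine ENNReal.rpow_le_rpow ?_ hq.le
    refine (ENNReal.ofReal_le_ofReal (hFM m x hx)).trans (le_of_eq ?_)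
    rw [ENNReal.ofReal_mul (by positivity), ENNReal.ofReal_sum_of_nonneg fun n _ =>
      mul_nonneg (hd n) (by positivity)]
    congr 1
    refine Finset.sum_congr rfl fun n _ => ?_
    rw [ENNReal.ofReal_mul (hd n), ENNReal.ofReal_pow (by norm_num),
      ENNReal.ofReal_inv_of_pos two_pos, ENNReal.ofReal_ofNat]
  refine (setLIntegral_mono' measurableSet_Ioo fun x hx => ?_).trans
    ((hr.lintegral_le hω hpos hKq).trans (le_of_eq ?_))
  · gcongr
    exact mul_le_of_le_one_left (hω.1 x ⟨hx.1.le, hx.2⟩) hx.2.le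
  · simp only [ENNReal.mul_rpow_of_nonneg _ _ hq.le, mul_assoc]
    rw [ENNReal.tsum_mul_left]

lemma rpow_le_of_le_mul_rpow {S a : ℝ≥0∞} (hq : q'.HolderConjugate q) (hS : S ≠ ⊤)
    (h : S ≤ a * S ^ (1 / q)) : S ≤ a ^ q' := by
  have hq0 := hq.pos
  have hq1 := hq.symm.pos
  rcases eq_or_ne S 0 with h0 | h0
  · simp [h0]
  have h1 : S ^ (1 / q) ≠ 0 := by simp [ENNReal.rpow_eq_zero_iff, h0, hS]
  have h2 : S ^ (1 / q) ≠ ⊤ := ENNReal.rpow_ne_top_of_nonneg (by positivity) hS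
  have h3 : S = S ^ (1 / q') * S ^ (1 / q) := by
    rw [← ENNReal.rpow_add_of_nonneg _ _ (by positivity) (by positivity), one_div, one_div,
      hq.inv_add_inv_eq_one, ENNReal.rpow_one]
  have h4 : S ^ (1 / q') ≤ a := by
    rw [← ENNReal.mul_le_mul_iff_left h1 h2, ← h3]
    exact h
  have := ENNReal.rpow_le_rpow h4 hq0.le
  rwa [← ENNReal.rpow_mul, one_div_mul_cancel hq0.ne', ENNReal.rpow_one] at this

lemma DyadicRadii.XqNormE_rpow_le {r : ℕ → ℝ} (hr : DyadicRadii ω r) (hω : IsRadialWeight ω)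
    (hpos : ∀ r ∈ Ico (0:ℝ) 1, 0 < omegaHat ω r) (hq : 0 < q) {g : ℂ → ℂ}
    (hg : DifferentiableOn ℂ g (Metric.ball 0 1)) :
    XqNormE BMOANormE ω q g ^ q ≤ ENNReal.ofReal (omegaHat ω 0) * 3 ^ q * 2 *
      ∑' n, dilDual g (r n) ^ q * 2⁻¹ ^ n := by
  have hB : ∀ m, ∀ x ∈ Ico (r m) (r (m + 1)),
      BMOANormE (dilateF g x) ^ q ≤ (3 * dilDual g (r (m + 1))) ^ q := by
    intro m x hx
    have hx' : x ∈ Ico (0:ℝ) 1 := ⟨(hr.mem m).1.trans hx.1, hx.2.trans (hr.mem _).2⟩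
    refine ENNReal.rpow_le_rpow ((BMOANormE_dilateF_le hg hx').trans ?_) hq.le
    gcongr
    exact monotoneOn_dilDual g hx' (hr.mem _) hx.2.le
  rw [XqNormE, ← ENNReal.rpow_mul, one_div_mul_cancel hq.ne', ENNReal.rpow_one]
  refine (hr.lintegral_le hω hpos hB).trans ?_
  rw [mul_assoc, mul_assoc]
  gcongr
  have e : ∀ m : ℕ, (3 * dilDual g (r (m + 1))) ^ q * 2⁻¹ ^ m
      = 3 ^ q * 2 * (dilDual g (r (m + 1)) ^ q * 2⁻¹ ^ (m + 1)) := by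
    intro m
    rw [ENNReal.mul_rpow_of_nonneg _ _ hq.le, pow_succ]
    calc 3 ^ q * dilDual g (r (m + 1)) ^ q * 2⁻¹ ^ m
        = 3 ^ q * dilDual g (r (m + 1)) ^ q * 2⁻¹ ^ m * (2 * 2⁻¹) := by
          rw [ENNReal.mul_inv_cancel two_ne_zero ENNReal.ofNat_ne_top, mul_one]
      _ = _ := by ring
  simp only [e]
  rw [ENNReal.tsum_mul_left, mul_assoc]
  refine mul_le_mul' le_rfl (mul_le_mul' le_rfl ?_)
  exact ENNReal.tsum_comp_le_tsum_of_injective (add_left_injective 1)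
    fun n => dilDual g (r n) ^ q * 2⁻¹ ^ n

lemma coeffPair_coeffMul_mulSeq (s : ℝ) (L : (ℂ → ℂ) → ℂ) (p : Polynomial ℂ) :
    (coeffPair (coeffMul (mulSeq ω s) p) fun k => conj (L fun z => z ^ k))
      = coeffPair p fun k => reprCoeff ω L k * (s:ℂ) ^ k := by
  rw [coeffPair_coeffMul]
  congr 1
  ext k
  rw [mulSeq, reprCoeff]
  push_cast
  ring

lemma IsRadialWeight.exists_XqNormE_reprFun_le (hω : IsRadialWeight ω)
    (hpos : ∀ r ∈ Ico (0:ℝ) 1, 0 < omegaHat ω r) (hD : InDhat ω) (hq : q'.HolderConjugate q) :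
    ∃ Λ : ℝ≥0∞, Λ ≠ ⊤ ∧ ∀ (L : (ℂ → ℂ) → ℂ) (M : ℝ), IsLinearOn (InApq ω 1 q) L →
      (∀ f, InApq ω 1 q f → ‖L f‖ ≤ M * (LpqNormE ω 1 q f).toReal) →
      XqNormE BMOANormE ω q' (reprFun ω L) ≤ Λ * ENNReal.ofReal M := by
  obtain ⟨C, hC0, hC⟩ := hD
  obtain ⟨r, hr⟩ := hω.exists_dyadicRadii hpos
  obtain ⟨K, hK, hKd⟩ := exists_tsum_dyadic_le hq
  have hq0 := hq.pos
  have hq1 := hq.symm.pos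
  set A := ENNReal.ofReal (omegaHat ω 0)
  set κ := A * (ENNReal.ofReal (2 * ((128 * C + 32) * (5 * C ^ 2)) / omegaHat ω 0) ^ q * K) with hκ
  have hκt : κ ≠ ⊤ := ENNReal.mul_ne_top ENNReal.ofReal_ne_top (ENNReal.mul_ne_top
    (ENNReal.rpow_ne_top_of_nonneg hq1.le ENNReal.ofReal_ne_top) hK)
  refine ⟨(A * 3 ^ q' * 2) ^ (1 / q') * (2 * κ ^ (1 / q)), ?_, fun L M hL hM => ?_⟩
  · refine ENNReal.mul_ne_top (ENNReal.rpow_ne_top_of_nonneg (by positivity) ?_)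
      (ENNReal.mul_ne_top ENNReal.ofNat_ne_top (ENNReal.rpow_ne_top_of_nonneg (by positivity) hκt))
    exact ENNReal.mul_ne_top (ENNReal.mul_ne_top ENNReal.ofReal_ne_top
      (ENNReal.rpow_ne_top_of_nonneg hq0.le ENNReal.ofNat_ne_top)) ENNReal.ofNat_ne_top
  have hM0 := hω.bound_nonneg hpos hq1 hM
  have hsum : ∀ ρ ∈ Ico (0:ℝ) 1, Summable fun k => ‖reprCoeff ω L k‖ * ρ ^ k := fun ρ hρ =>
    hω.summable_norm_reprCoeff hpos hq1 hM0 hM hρ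
  have hg : DifferentiableOn ℂ (reprFun ω L) (Metric.ball 0 1) := differentiableOn_tsum_mul_pow hsum
  have hc : ∀ k, taylorCoeff (reprFun ω L) k = reprCoeff ω L k := taylorCoeff_tsum hsum
  set D : ℕ → ℝ≥0∞ := fun n => dilDual (reprFun ω L) (r n) with hDdef
  have hDt : ∀ n, D n ≠ ⊤ := fun n => dilDual_ne_top hg (hr.mem n)
  have hext : ∀ n, ∃ p, M1 p 1 ≤ 1 ∧
      (D n).toReal / 2 ≤ (coeffPair p fun k => reprCoeff ω L k * (r n:ℂ) ^ k).re := by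
    intro n
    have := exists_half_dualE_le (hDt n)
    simp only [hDdef, dilDual, hc] at this ⊢
    exact this
  choose p hp1 hp2 using hext
  have hpart : ∀ N, ∑ n ∈ Finset.range N, D n ^ q' * 2⁻¹ ^ n
      ≤ (2 * κ ^ (1 / q) * ENNReal.ofReal M) ^ q' := by
    intro N
    set S := ∑ n ∈ Finset.range N, D n ^ q' * 2⁻¹ ^ n with hS
    have hterm : ∀ n, D n ^ q' * 2⁻¹ ^ n ≠ ⊤ := fun n =>
      ENNReal.mul_ne_top (ENNReal.rpow_ne_top_of_nonneg hq0.le (hDt n))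
        (ENNReal.pow_ne_top (by simp))
    have hSt : S ≠ ⊤ := ENNReal.sum_ne_top.2 fun n _ => hterm n
    set d : ℕ → ℝ := fun n => (D n ^ (q' - 1)).toReal with hd
    have hd0 : ∀ n, 0 ≤ d n := fun n => ENNReal.toReal_nonneg
    have hdt : ∀ n, ENNReal.ofReal (d n) = D n ^ (q' - 1) := fun n =>
      ENNReal.ofReal_toReal (ENNReal.rpow_ne_top_of_nonneg hq.sub_one_pos.le (hDt n))
    set F : Polynomial ℂ := ∑ n ∈ Finset.range N, Polynomial.C ((d n * 2⁻¹ ^ n : ℝ) : ℂ) *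
        coeffMul (mulSeq ω (r n)) (p n) with hF
    have hFq : LpqNormE ω 1 q (fun z => F.eval z) ^ q ≤ κ * S := by
      refine (hr.LpqNormE_sum_rpow_le hω hpos hC0 hC hq1 hp1 hd0 N).trans ?_
      rw [hκ, mul_assoc, mul_assoc]
      gcongr
      refine (hKd _ N).trans (le_of_eq ?_)
      congr 1
      refine Finset.sum_congr rfl fun n _ => ?_
      rw [hdt, ← ENNReal.rpow_mul, hq.sub_one_mul_conj]
    have hFn : LpqNormE ω 1 q (fun z => F.eval z) ≤ κ ^ (1 / q) * S ^ (1 / q) := by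
      rw [← ENNReal.mul_rpow_of_nonneg _ _ (by positivity), one_div, ENNReal.le_rpow_inv_iff hq1]
      exact hFq
    have hLF : S.toReal / 2 ≤ (L fun z => F.eval z).re := by
      rw [hω.coeffPair_apply hq1 hL, hF, coeffPair_sum, Complex.re_sum, hS,
        ENNReal.toReal_sum fun n _ => hterm n, Finset.sum_div]
      refine Finset.sum_le_sum fun n _ => ?_
      rw [coeffPair_C_mul, coeffPair_coeffMul_mulSeq, Complex.re_ofReal_mul]
      refine le_trans (le_of_eq ?_)
        (mul_le_mul_of_nonneg_left (hp2 n) (mul_nonneg (hd0 n) (by positivity)))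
      have : D n ^ q' = D n ^ (q' - 1) * D n := by
        nth_rewrite 3 [← ENNReal.rpow_one (D n)]
        rw [← ENNReal.rpow_add_of_nonneg _ _ hq.sub_one_pos.le zero_le_one, sub_add_cancel]
      rw [this, ENNReal.toReal_mul, ENNReal.toReal_mul, ENNReal.toReal_pow, ENNReal.toReal_inv,
        ENNReal.toReal_ofNat]
      ring
    have hIn := hω.inApq_eval hq1 F
    have hSM : S ≤ 2 * κ ^ (1 / q) * ENNReal.ofReal M * S ^ (1 / q) := by
      have h1 : S.toReal ≤ 2 * (M * (LpqNormE ω 1 q fun z => F.eval z).toReal) := by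
        have := (Complex.re_le_norm _).trans (hM _ hIn)
        linarith
      rw [← ENNReal.ofReal_toReal hSt]
      refine (ENNReal.ofReal_le_ofReal h1).trans ?_
      rw [ENNReal.ofReal_mul zero_le_two, ENNReal.ofReal_mul hM0, ENNReal.ofReal_ofNat,
        ENNReal.ofReal_toReal hIn.2.ne, ENNReal.ofReal_toReal hSt]
      calc 2 * (ENNReal.ofReal M * LpqNormE ω 1 q fun z => F.eval z)
          ≤ 2 * (ENNReal.ofReal M * (κ ^ (1 / q) * S ^ (1 / q))) := by gcongr
        _ = _ := by ring
    exact rpow_le_of_le_mul_rpow hq hSt hSM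
  have htsum : ∑' n, D n ^ q' * 2⁻¹ ^ n ≤ (2 * κ ^ (1 / q) * ENNReal.ofReal M) ^ q' := by
    rw [ENNReal.tsum_eq_iSup_nat]
    exact iSup_le hpart
  rw [← ENNReal.rpow_le_rpow_iff hq0]
  refine (hr.XqNormE_rpow_le hω hpos hq0 hg).trans ?_
  calc A * 3 ^ q' * 2 * ∑' n, D n ^ q' * 2⁻¹ ^ n
      ≤ A * 3 ^ q' * 2 * (2 * κ ^ (1 / q) * ENNReal.ofReal M) ^ q' := mul_le_mul' le_rfl htsum
    _ = _ := by
      rw [mul_assoc ((A * 3 ^ q' * 2) ^ (1 / q')),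
        ENNReal.mul_rpow_of_nonneg ((A * 3 ^ q' * 2) ^ (1 / q')) _ hq0.le,
        ← ENNReal.rpow_mul, one_div_mul_cancel hq0.ne', ENNReal.rpow_one]

end NormBound

end PolynomialMeans

/-- For `ω ∈ D̂` and `1<q<∞`, `(A^{1,q}_ω)* ≃ BMOA(q',ω)` under the
`A²_ω`-pairing with equivalence of norms. -/
theorem duality_A1q_qlarge
    (ω : ℝ → ℝ) (hω : IsRadialWeight ω)
    (hpos : ∀ r ∈ Set.Ico (0:ℝ) 1, 0 < omegaHat ω r)
    (hD : InDhat ω)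
    (q q' : ℝ) (hq : 1 < q) (hq' : q' = q / (q - 1)) :
    ∃ C₁ > (0:ℝ), ∃ C₂ > (0:ℝ),
      (∀ g : ℂ → ℂ, DifferentiableOn ℂ g (Metric.ball 0 1) →
        XqNormE BMOANormE ω q' g < ⊤ →
        ∀ f : ℂ → ℂ, InApq ω 1 q f →
          ∃ l : ℂ, HasPairingC (momentCoeff ω) f g l ∧
            ‖l‖ ≤ C₂ * (XqNormE BMOANormE ω q' g).toReal * (LpqNormE ω 1 q f).toReal) ∧
      (∀ L : (ℂ → ℂ) → ℂ, IsLinearOn (InApq ω 1 q) L →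
        (∃ M : ℝ, ∀ f : ℂ → ℂ, InApq ω 1 q f → ‖L f‖ ≤ M * (LpqNormE ω 1 q f).toReal) →
        ∃ g : ℂ → ℂ, DifferentiableOn ℂ g (Metric.ball 0 1) ∧
          XqNormE BMOANormE ω q' g < ⊤ ∧
          (∀ f : ℂ → ℂ, InApq ω 1 q f → HasPairingC (momentCoeff ω) f g (L f)) ∧
          (∀ M : ℝ, (∀ f : ℂ → ℂ, InApq ω 1 q f → ‖L f‖ ≤ M * (LpqNormE ω 1 q f).toReal) →
            (XqNormE BMOANormE ω q' g).toReal ≤ C₁ * M)) := by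
  have hqq : q'.HolderConjugate q :=
    ((Real.holderConjugate_iff_eq_conjExponent hq).2 hq').symm
  have hq0 := hqq.symm.pos
  obtain ⟨Λ, hΛ, hle⟩ := hω.exists_XqNormE_reprFun_le hpos hD hqq
  refine ⟨Λ.toReal + 1, by positivity, 8, by norm_num,
    fun g hg hg' f hf => hω.exists_hasPairingC hqq hg hg' hf, fun L hL ⟨M, hM⟩ => ?_⟩
  have hM0 := hω.bound_nonneg hpos hq0 hM
  refine ⟨reprFun ω L, ?_, ?_, fun f hf => hω.hasPairingC_reprFun hpos hq0 hL hM0 hM hf, ?_⟩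
  · exact differentiableOn_tsum_mul_pow fun ρ hρ => hω.summable_norm_reprCoeff hpos hq0 hM0 hM hρ
  · exact (hle L M hL hM).trans_lt (ENNReal.mul_lt_top hΛ.lt_top ENNReal.ofReal_lt_top)
  · intro M hM
    have hM0 := hω.bound_nonneg hpos hq0 hM
    have h := ENNReal.toReal_mono (ENNReal.mul_ne_top hΛ ENNReal.ofReal_ne_top) (hle L M hL hM)
    rw [ENNReal.toReal_mul, ENNReal.toReal_ofReal hM0] at h
    exact h.trans (mul_le_mul_of_nonneg_right (by linarith) hM0)
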